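/- (Commutator estimate) Let 0 < α < 1, 0 ≤ β < 1−α and 1 < p,q < ∞. For all smooth space-time functions f, g ∈ S(ℝ²), ‖D_x^β([D_x^α, f] g)‖_{L^p_x L^q_T} ≲ ‖g‖_{L^{p₁}_x L^{q₁}_T} ‖D_x^{α+β} f‖_{L^{p₂}_x L^{q₂}_T}, where [D_x^α, f]g = D_x^α(fg) − f D_x^α g, 1 < p₁,q₁,p₂,q₂ < ∞, 1/p₁ + 1/p₂ = 1/p and 1/q₁ + 1/q₂ = 1/q; moreover if β > 0 then q₁ = ∞ is also allowed. -/

import Mathlib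

open MeasureTheory Real Set Filter
open scoped FourierTransform ENNReal NNReal Topology

noncomputable section

/-- Fourier multiplier operator with symbol `m`. -/
def FMul (m : ℝ → ℂ) (f : ℝ → ℂ) : ℝ → ℂ :=
  𝓕⁻ fun ξ => m ξ * 𝓕 f ξ

/-- `D_x^α`, the Fourier multiplier with symbol `|ξ|^α`. -/
def Dop (α : ℝ) (f : ℝ → ℂ) : ℝ → ℂ :=
  FMul (fun ξ => ((|ξ| ^ α : ℝ) : ℂ)) f

/-- The free Benjamin–Ono group `V(t) = 𝓕⁻¹ e^{itξ|ξ|} 𝓕`. -/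
def BOGroup (t : ℝ) (f : ℝ → ℂ) : ℝ → ℂ :=
  FMul (fun ξ => Complex.exp (Complex.I * (t * ξ * |ξ|))) f

/-- The derivative `∂ₓ` as the Fourier multiplier with symbol `iξ`. -/
def Dx1 (f : ℝ → ℂ) : ℝ → ℂ :=
  FMul (fun ξ => Complex.I * ξ) f

/-- Projection on nonnegative frequencies. -/
def Pplus (f : ℝ → ℂ) : ℝ → ℂ :=
  FMul (fun ξ => if 0 ≤ ξ then 1 else 0) f

/-- Projection on nonpositive frequencies. -/
def Pminus (f : ℝ → ℂ) : ℝ → ℂ :=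
  FMul (fun ξ => if ξ ≤ 0 then 1 else 0) f

/-- The Sobolev `H^s` norm. -/
def HsNorm (s : ℝ) (f : ℝ → ℂ) : ℝ≥0∞ :=
  eLpNorm (fun ξ => (((1 + ξ ^ 2) ^ (s / 2) : ℝ) : ℂ) * 𝓕 f ξ) 2 volume

/-- The mixed space-time norm `L^p_x L^q_T`. -/
def LpLq (p q : ℝ≥0∞) (T : ℝ) (f : ℝ → ℝ → ℂ) : ℝ≥0∞ :=
  eLpNorm (fun x => (eLpNorm (fun t => f x t) q (volume.restrict (Ioc (0:ℝ) T))).toReal) p volume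

/-- The mixed space-time norm `L^q_T L^p_x`. -/
def LqLp (q p : ℝ≥0∞) (T : ℝ) (f : ℝ → ℝ → ℂ) : ℝ≥0∞ :=
  eLpNorm (fun t => (eLpNorm (fun x => f x t) p volume).toReal) q (volume.restrict (Ioc (0:ℝ) T))

/-- The norm `L^∞_T H^s_x`. -/
def LinfHs (s : ℝ) (T : ℝ) (f : ℝ → ℝ → ℂ) : ℝ≥0∞ :=
  eLpNorm (fun t => (HsNorm s (fun x => f x t)).toReal) ∞ (volume.restrict (Ioc (0:ℝ) T))

/-- Apply a spatial operator slice-wise in time. -/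
def sliceOp (A : (ℝ → ℂ) → (ℝ → ℂ)) (f : ℝ → ℝ → ℂ) : ℝ → ℝ → ℂ :=
  fun x t => A (fun y => f y t) x

/-- A smooth nonnegative bump `η` supported in `{1/2 ≤ |ξ| ≤ 2}` giving a dyadic
partition of unity `Σ_k η(2^{-k} ξ) = 1` for `ξ ≠ 0`. -/
structure IsLPBump (η : ℝ → ℝ) : Prop where
  smooth : ContDiff ℝ (⊤ : ℕ∞) η
  nonneg : ∀ ξ, 0 ≤ η ξ
  support : ∀ ξ, η ξ ≠ 0 → 1/2 ≤ |ξ| ∧ |ξ| ≤ 2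
  partition : ∀ ξ : ℝ, ξ ≠ 0 → ∑' k : ℤ, η ((2:ℝ) ^ (-k) * ξ) = 1

/-- The low-frequency symbol `p(ξ) = Σ_{j ≤ -3} η(2^{-j} ξ)`. -/
def lowSymbol (η : ℝ → ℝ) (ξ : ℝ) : ℝ :=
  ∑' j : ℤ, if j ≤ -3 then η ((2:ℝ) ^ (-j) * ξ) else 0

/-- The low-frequency projection `P₀`. -/
def P0 (η : ℝ → ℝ) (f : ℝ → ℂ) : ℝ → ℂ :=
  FMul (fun ξ => ((lowSymbol η ξ : ℝ) : ℂ)) f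

/-- The `X^s_T` norm. -/
def XNorm (η : ℝ → ℝ) (s T : ℝ) (u : ℝ → ℝ → ℂ) : ℝ≥0∞ :=
  LinfHs s T u + LpLq ∞ 2 T (sliceOp (Dop (s + 1/2)) u)
    + LpLq 4 ∞ T (sliceOp (Dop (s - 1/4)) u)
    + LpLq 2 ∞ T (sliceOp (P0 η) u)

/-- The Duhamel integral `∫₀ᵗ V(t-τ) f(τ) dτ`. -/
def duhamel (f : ℝ → ℝ → ℂ) : ℝ → ℝ → ℂ :=
  fun x t => ∫ τ in Ioc (0:ℝ) t, BOGroup (t - τ) (fun y => f y τ) x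

/-- The commutator `[D_x^α, f]g = D_x^α(fg) - f · D_x^α g` (acting in the space
variable), slice-wise in time. -/
def commDf (α : ℝ) (f g : ℝ → ℝ → ℂ) : ℝ → ℝ → ℂ :=
  fun x t => Dop α (fun y => f y t * g y t) x - f x t * Dop α (fun y => g y t) x

/-! ### Dyadic intervals and the dyadic maximal function -/

/-- The index of the dyadic interval of length `2 ^ (-k)` containing `x`. -/
def dq (k : ℤ) (x : ℝ) : ℤ := ⌊(2 : ℝ) ^ k * x⌋

/-- The dyadic interval of length `2 ^ (-k)` containing `x`. -/
def cell (k : ℤ) (x : ℝ) : Set ℝ := {y | dq k y = dq k x}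

/-- The threefold dilate of the dyadic interval of length `2 ^ (-k)` containing `x`. -/
def tri (k : ℤ) (x : ℝ) : Set ℝ := {y | |dq k y - dq k x| ≤ 1}

/-- The power `2 ^ k` as an extended nonnegative real. -/
def e2 (k : ℤ) : ℝ≥0∞ := ENNReal.ofReal ((2 : ℝ) ^ k)

/-- Three times the average of `w` over `tri k x`. -/
def av (k : ℤ) (w : ℝ → ℝ≥0∞) (x : ℝ) : ℝ≥0∞ := e2 k * ∫⁻ y in tri k x, w y

/-- The dyadic maximal function over intervals of length at least `2 ^ (-k)`. -/
def mx (k : ℤ) (w : ℝ → ℝ≥0∞) (x : ℝ) : ℝ≥0∞ := ⨆ i : ℕ, av (k - i) w x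

/-- The dyadic maximal function. -/
def Mx (w : ℝ → ℝ≥0∞) (x : ℝ) : ℝ≥0∞ := ⨆ k : ℤ, av k w x

lemma e2_add (a b : ℤ) : e2 (a + b) = e2 a * e2 b := by
  rw [e2, e2, e2, ← ENNReal.ofReal_mul (by positivity), zpow_add₀ two_ne_zero]

lemma e2_zero : e2 0 = 1 := by simp [e2]

lemma e2_ne_zero (k : ℤ) : e2 k ≠ 0 := by
  simp only [e2, ne_eq, ENNReal.ofReal_eq_zero, not_le]; positivity

lemma e2_ne_top (k : ℤ) : e2 k ≠ ∞ := ENNReal.ofReal_ne_top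

lemma e2_mul_neg (k : ℤ) : e2 k * e2 (-k) = 1 := by rw [← e2_add, add_neg_cancel, e2_zero]

lemma e2_neg_mul (k : ℤ) : e2 (-k) * e2 k = 1 := by rw [← e2_add, neg_add_cancel, e2_zero]

lemma measurable_dq (k : ℤ) : Measurable (dq k) :=
  Int.measurable_floor.comp (measurable_const.mul measurable_id)

lemma measurableSet_cell (k : ℤ) (x : ℝ) : MeasurableSet (cell k x) :=
  measurable_dq k (measurableSet_singleton (dq k x))

lemma measurableSet_tri (k : ℤ) (x : ℝ) : MeasurableSet (tri k x) :=
  measurable_dq k (MeasurableSet.of_discrete (s := {n : ℤ | |n - dq k x| ≤ 1}))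

lemma dq_sub (k : ℤ) (i : ℕ) (x : ℝ) : dq (k - i) x = dq k x / 2 ^ i := by
  have h := Int.floor_div_natCast ((2 : ℝ) ^ k * x) (2 ^ i)
  rw [dq, dq]
  push_cast at h
  rw [← h]
  congr 1
  rw [zpow_sub₀ two_ne_zero, zpow_natCast]
  ring

lemma dq_sub_of_eq {k : ℤ} {x y : ℝ} (h : dq k y = dq k x) (i : ℕ) :
    dq (k - i) y = dq (k - i) x := by
  rw [dq_sub, dq_sub, h]

lemma dq_eq_of_le {j k : ℤ} (hjk : j ≤ k) {x y : ℝ} (h : dq k y = dq k x) : dq j y = dq j x := by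
  have := dq_sub_of_eq h (k - j).toNat
  rwa [show k - ((k - j).toNat : ℤ) = j by omega] at this

lemma tri_subset_sub (k : ℤ) (i : ℕ) (x : ℝ) : tri k x ⊆ tri (k - i) x := by
  intro y hy
  simp only [tri, mem_ofPred_eq, dq_sub] at hy ⊢
  have key : ∀ m n : ℤ, m ≤ n + 1 → m / 2 ^ i ≤ n / 2 ^ i + 1 := by
    intro m n h
    have hp : (0 : ℤ) < 2 ^ i := by positivity
    calc m / 2 ^ i ≤ (n + 1 * 2 ^ i) / 2 ^ i :=
          Int.ediv_le_ediv hp (by omega)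
      _ = n / 2 ^ i + 1 := Int.add_mul_ediv_right _ _ hp.ne'
  rw [abs_le] at hy ⊢
  have h1 := key (dq k y) (dq k x) (by omega)
  have h2 := key (dq k x) (dq k y) (by omega)
  omega

lemma tri_subset_of_le {j k : ℤ} (hjk : j ≤ k) (x : ℝ) : tri k x ⊆ tri j x := by
  have := tri_subset_sub k (k - j).toNat x
  rwa [show k - ((k - j).toNat : ℤ) = j by omega] at this

lemma setOf_dq_eq (k n : ℤ) :
    {y | dq k y = n} = Ico ((n : ℝ) * 2 ^ (-k)) ((n + 1) * 2 ^ (-k)) := by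
  ext y
  have hp : (0 : ℝ) < 2 ^ k := by positivity
  simp only [mem_ofPred_eq, dq, Int.floor_eq_iff, mem_Ico, zpow_neg]
  rw [← div_eq_mul_inv, ← div_eq_mul_inv, div_le_iff₀ hp, lt_div_iff₀ hp, mul_comm y]

lemma tri_eq (k : ℤ) (x : ℝ) :
    tri k x = Ico (((dq k x : ℝ) - 1) * 2 ^ (-k)) ((dq k x + 2) * 2 ^ (-k)) := by
  ext y
  have hp : (0 : ℝ) < 2 ^ k := by positivity
  rw [tri, mem_ofPred_eq, mem_Ico, zpow_neg, ← div_eq_mul_inv, ← div_eq_mul_inv, div_le_iff₀ hp,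
    lt_div_iff₀ hp, mul_comm y, abs_le]
  have h1 := @Int.le_floor ℝ _ _ _ (dq k x - 1) ((2 : ℝ) ^ k * y)
  have h2 := @Int.floor_lt ℝ _ _ _ (dq k x + 2) ((2 : ℝ) ^ k * y)
  push_cast at h1 h2
  rw [← h1, ← h2]
  show _ ↔ dq k x - 1 ≤ dq k y ∧ dq k y < _
  omega

lemma volume_setOf_dq_eq (k n : ℤ) : volume {y | dq k y = n} = e2 (-k) := by
  rw [setOf_dq_eq, Real.volume_Ico, e2]
  congr 1
  ring

lemma volume_cell (k : ℤ) (x : ℝ) : volume (cell k x) = e2 (-k) := volume_setOf_dq_eq k _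

lemma volume_tri (k : ℤ) (x : ℝ) : volume (tri k x) = 3 * e2 (-k) := by
  rw [tri_eq, Real.volume_Ico, e2, ← ENNReal.ofReal_ofNat, ← ENNReal.ofReal_mul (by positivity)]
  congr 1
  ring

lemma le_abs_sub_of_notMem_tri {k : ℤ} {x y : ℝ} (h : y ∉ tri k x) : (2 : ℝ) ^ (-k) ≤ |x - y| := by
  by_contra! hlt
  apply h
  have hp : (0 : ℝ) < 2 ^ k := by positivity
  have h1 : |(2 : ℝ) ^ k * x - 2 ^ k * y| < 1 := by
    rw [← mul_sub, abs_mul, abs_of_pos hp]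
    calc (2 : ℝ) ^ k * |x - y| < 2 ^ k * 2 ^ (-k) := by gcongr
      _ = 1 := by rw [← zpow_add₀ two_ne_zero]; simp
  rw [abs_lt] at h1
  simp only [tri, mem_ofPred_eq, dq, abs_le]
  have a1 := Int.floor_le ((2 : ℝ) ^ k * x)
  have a2 := Int.lt_floor_add_one ((2 : ℝ) ^ k * x)
  have a3 := Int.floor_le ((2 : ℝ) ^ k * y)
  have a4 := Int.lt_floor_add_one ((2 : ℝ) ^ k * y)
  constructor
  · have : (⌊(2 : ℝ) ^ k * x⌋ : ℝ) < ⌊(2 : ℝ) ^ k * y⌋ + 2 := by linarith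
    have : ⌊(2 : ℝ) ^ k * x⌋ < ⌊(2 : ℝ) ^ k * y⌋ + 2 := by exact_mod_cast this
    omega
  · have : (⌊(2 : ℝ) ^ k * y⌋ : ℝ) < ⌊(2 : ℝ) ^ k * x⌋ + 2 := by linarith
    have : ⌊(2 : ℝ) ^ k * y⌋ < ⌊(2 : ℝ) ^ k * x⌋ + 2 := by exact_mod_cast this
    omega

lemma exists_mem_tri (k : ℤ) (x y : ℝ) : ∃ i : ℕ, y ∈ tri (k - i) x := by
  obtain ⟨i, hi⟩ := pow_unbounded_of_one_lt ((2 : ℝ) ^ k * |x - y|) (one_lt_two (α := ℝ))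
  refine ⟨i, ?_⟩
  by_contra h
  have := le_abs_sub_of_notMem_tri h
  rw [neg_sub, zpow_sub₀ two_ne_zero, zpow_natCast, div_le_iff₀ (by positivity)] at this
  linarith [mul_comm |x - y| ((2 : ℝ) ^ k)]

lemma tri_congr {k : ℤ} {x y : ℝ} (h : dq k y = dq k x) : tri k y = tri k x := by
  ext z; simp [tri, h]

lemma av_congr {k : ℤ} {x y : ℝ} (h : dq k y = dq k x) (w : ℝ → ℝ≥0∞) : av k w y = av k w x := by
  rw [av, av, tri_congr h]

lemma mx_congr {k : ℤ} {x y : ℝ} (h : dq k y = dq k x) (w : ℝ → ℝ≥0∞) : mx k w y = mx k w x := by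
  simp only [mx, av_congr (dq_sub_of_eq h _)]

lemma av_le_mx {j k : ℤ} (hjk : j ≤ k) (w : ℝ → ℝ≥0∞) (x : ℝ) : av j w x ≤ mx k w x := by
  have := le_iSup (fun i : ℕ => av (k - i) w x) (k - j).toNat
  rwa [show k - ((k - j).toNat : ℤ) = j by omega] at this

lemma mx_mono {j k : ℤ} (hjk : j ≤ k) (w : ℝ → ℝ≥0∞) (x : ℝ) : mx j w x ≤ mx k w x :=
  iSup_le fun _ => av_le_mx (by omega) w x

lemma mx_le_Mx (k : ℤ) (w : ℝ → ℝ≥0∞) (x : ℝ) : mx k w x ≤ Mx w x :=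
  iSup_le fun i => le_iSup (fun k => av k w x) (k - i)

lemma lintegral_tri (k : ℤ) (w : ℝ → ℝ≥0∞) (x : ℝ) :
    ∫⁻ y in tri k x, w y = e2 (-k) * av k w x := by
  rw [av, ← mul_assoc, e2_neg_mul, one_mul]

lemma av_le_of_le {w : ℝ → ℝ≥0∞} {B : ℝ≥0∞} (h : ∀ x, w x ≤ B) (k : ℤ) (x : ℝ) :
    av k w x ≤ 3 * B := by
  calc av k w x ≤ e2 k * ∫⁻ _ in tri k x, B := by
        rw [av]; gcongr; exact h _
    _ = 3 * B := by
        rw [setLIntegral_const, volume_tri]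
        calc e2 k * (B * (3 * e2 (-k))) = (e2 k * e2 (-k)) * (3 * B) := by ring
          _ = _ := by rw [e2_mul_neg, one_mul]

lemma mx_le_of_le {w : ℝ → ℝ≥0∞} {B : ℝ≥0∞} (h : ∀ x, w x ≤ B) (k : ℤ) (x : ℝ) :
    mx k w x ≤ 3 * B := iSup_le fun _ => av_le_of_le h _ x

lemma measurable_av_prod {τ : Type*} [MeasurableSpace τ] {w : ℝ → τ → ℝ≥0∞}
    (hw : Measurable (fun z : ℝ × τ => w z.1 z.2)) (k : ℤ) :
    Measurable (fun z : ℝ × τ => av k (fun y => w y z.2) z.1) := by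
  have : ∀ z : ℝ × τ, ∫⁻ y in tri k z.1, w y z.2 =
      ∫⁻ y, ({p : (ℝ × τ) × ℝ | |dq k p.2 - dq k p.1.1| ≤ 1}.indicator
        (fun p => w p.2 p.1.2)) (z, y) := by
    intro z
    rw [← lintegral_indicator (measurableSet_tri k z.1)]
    rfl
  simp only [av, this]
  refine Measurable.const_mul (Measurable.lintegral_prod_right' ?_) _
  refine Measurable.indicator (hw.comp (measurable_snd.prodMk (measurable_snd.comp measurable_fst)))
    ?_
  have h1 : Measurable fun p : (ℝ × τ) × ℝ => (dq k p.2, dq k p.1.1) :=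
    ((measurable_dq k).comp measurable_snd).prodMk
      ((measurable_dq k).comp (measurable_fst.comp measurable_fst))
  exact h1 (MeasurableSet.of_discrete (s := {n : ℤ × ℤ | |n.1 - n.2| ≤ 1}))

lemma measurable_Mx_prod {τ : Type*} [MeasurableSpace τ] {w : ℝ → τ → ℝ≥0∞}
    (hw : Measurable (fun z : ℝ × τ => w z.1 z.2)) :
    Measurable (fun z : ℝ × τ => Mx (fun y => w y z.2) z.1) :=
  Measurable.iSup fun k => measurable_av_prod hw k

lemma measurable_av {w : ℝ → ℝ≥0∞} (hw : Measurable w) (k : ℤ) : Measurable (av k w) := by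
  have hw' : Measurable (fun z : ℝ × ℝ => w z.1) := hw.comp measurable_fst
  have h : Measurable (fun z : ℝ × ℝ => av k w z.1) :=
    measurable_av_prod (τ := ℝ) (w := fun y _ => w y) hw' k
  have h' : Measurable fun x : ℝ => (x, (0 : ℝ)) := measurable_id.prodMk measurable_const
  have h2 := Measurable.comp (g := fun z : ℝ × ℝ => av k w z.1) h h'
  simpa only [Function.comp_def] using h2

lemma measurable_mx {w : ℝ → ℝ≥0∞} (hw : Measurable w) (k : ℤ) : Measurable (mx k w) :=
  Measurable.iSup fun _ => measurable_av hw _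

lemma measurable_Mx {w : ℝ → ℝ≥0∞} (hw : Measurable w) : Measurable (Mx w) :=
  Measurable.iSup fun k => measurable_av hw k

/-! ### Rescaled kernels -/

/-- The `L¹`-normalised rescaling of a kernel to the length scale `2 ^ (-k)`. -/
def sc (k : ℤ) (ψ : ℝ → ℂ) (x : ℝ) : ℂ := ((2 : ℝ) ^ k : ℝ) * ψ (2 ^ k * x)

/-- Convolution with a rescaled kernel. -/
def cv (k : ℤ) (ψ F : ℝ → ℂ) (x : ℝ) : ℂ := ∫ y, sc k ψ (x - y) * F y

lemma enorm_sc (k : ℤ) (ψ : ℝ → ℂ) (x : ℝ) : ‖sc k ψ x‖ₑ = e2 k * ‖ψ (2 ^ k * x)‖ₑ := by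
  have h : ‖(((2 : ℝ) ^ k : ℝ) : ℂ)‖ₑ = e2 k := by
    rw [← ofReal_norm, Complex.norm_real, Real.norm_of_nonneg (by positivity), e2]
  rw [sc, enorm_mul, h]

lemma enorm_sc_le {ψ : ℝ → ℂ} {D : ℝ} (hψ : ∀ x, ‖ψ x‖ ≤ D / (1 + |x|) ^ 2) (k : ℤ) {x r : ℝ}
    (hr : 0 ≤ r) (hx : r ≤ |x|) :
    ‖sc k ψ x‖ₑ ≤ ENNReal.ofReal (2 ^ k * (D / (1 + 2 ^ k * r) ^ 2)) := by
  have hD : 0 ≤ D := by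
    have := (norm_nonneg _).trans (hψ 0)
    simpa using this
  rw [enorm_sc, e2, ENNReal.ofReal_mul (by positivity)]
  gcongr
  rw [← ofReal_norm]
  apply ENNReal.ofReal_le_ofReal
  refine (hψ _).trans ?_
  rw [abs_mul, abs_of_pos (show (0 : ℝ) < 2 ^ k by positivity)]
  gcongr

lemma lintegral_compl_tri_sc_le {ψ : ℝ → ℂ} {D : ℝ} (hψ : ∀ x, ‖ψ x‖ ≤ D / (1 + |x|) ^ 2)
    (k l : ℤ) (w : ℝ → ℝ≥0∞) (x : ℝ) :
    ∫⁻ y in (tri k x)ᶜ, ‖sc l ψ (x - y)‖ₑ * w y ≤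
      ENNReal.ofReal (4 * D) * e2 (k - l) * mx k w x := by
  have hD : 0 ≤ D := by
    have := (norm_nonneg _).trans (hψ 0)
    simpa using this
  have hcov : (tri k x)ᶜ ⊆ ⋃ i : ℕ, tri (k - (i + 1 : ℕ)) x \ tri (k - i) x := by
    intro y hy
    classical
    have hex := exists_mem_tri k x y
    have hfs := Nat.find_spec hex
    have hne : Nat.find hex ≠ 0 := by
      intro h0
      rw [h0] at hfs
      simp only [Nat.cast_zero, sub_zero] at hfs
      exact hy hfs
    obtain ⟨i, hi⟩ := Nat.exists_eq_succ_of_ne_zero hne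
    refine mem_iUnion.2 ⟨i, ?_, ?_⟩
    · rw [← Nat.succ_eq_add_one, ← hi]; exact hfs
    · exact Nat.find_min hex (by omega)
  have hterm : ∀ i : ℕ, ∫⁻ y in tri (k - (i + 1 : ℕ)) x \ tri (k - i) x, ‖sc l ψ (x - y)‖ₑ * w y ≤
      ENNReal.ofReal (2 * D) * e2 (k - l) * mx k w x * (2⁻¹) ^ i := by
    intro i
    have h2 : ((2 : ℝ≥0∞)⁻¹) ^ i = e2 (-i) := by
      rw [e2, zpow_neg, zpow_natCast, ENNReal.ofReal_inv_of_pos (by positivity),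
        ENNReal.ofReal_pow (by positivity), ENNReal.ofReal_ofNat, ENNReal.inv_pow]
    calc ∫⁻ y in tri (k - (i + 1 : ℕ)) x \ tri (k - i) x, ‖sc l ψ (x - y)‖ₑ * w y
        ≤ ∫⁻ y in tri (k - (i + 1 : ℕ)) x \ tri (k - i) x,
            ENNReal.ofReal (2 ^ l * (D / (2 ^ l * 2 ^ (-(k - i))) ^ 2)) * w y := by
          refine setLIntegral_mono' ((measurableSet_tri _ _).diff (measurableSet_tri _ _)) ?_
          intro y hy
          gcongr
          refine (enorm_sc_le hψ l (by positivity) (le_abs_sub_of_notMem_tri hy.2)).trans ?_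
          apply ENNReal.ofReal_le_ofReal
          gcongr
          linarith
      _ ≤ ∫⁻ y in tri (k - (i + 1 : ℕ)) x,
            ENNReal.ofReal (2 ^ l * (D / (2 ^ l * 2 ^ (-(k - i))) ^ 2)) * w y :=
          lintegral_mono_set sdiff_subset
      _ = ENNReal.ofReal (2 ^ l * (D / (2 ^ l * 2 ^ (-(k - i))) ^ 2)) *
            (e2 (-(k - (i + 1 : ℕ))) * av (k - (i + 1 : ℕ)) w x) := by
          rw [lintegral_const_mul' _ _ ENNReal.ofReal_ne_top, lintegral_tri]
      _ ≤ ENNReal.ofReal (2 ^ l * (D / (2 ^ l * 2 ^ (-(k - i))) ^ 2)) *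
            (e2 (-(k - (i + 1 : ℕ))) * mx k w x) := by
          gcongr; exact av_le_mx (by omega) w x
      _ = ENNReal.ofReal (2 * D) * e2 (k - l) * mx k w x * (2⁻¹) ^ i := by
          rw [h2, ← mul_assoc, mul_right_comm _ (mx k w x)]
          congr 1
          simp only [e2]
          rw [← ENNReal.ofReal_mul (by positivity), ← ENNReal.ofReal_mul (by positivity),
            ← ENNReal.ofReal_mul (by positivity)]
          congr 1
          have h2l : (2 : ℝ) ^ l ≠ 0 := by positivity
          have h2k : (2 : ℝ) ^ k ≠ 0 := by positivity
          simp only [neg_sub, zpow_sub₀ (two_ne_zero (α := ℝ)), zpow_neg, zpow_natCast, pow_succ]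
          field_simp
  calc ∫⁻ y in (tri k x)ᶜ, ‖sc l ψ (x - y)‖ₑ * w y
      ≤ ∫⁻ y in ⋃ i : ℕ, tri (k - (i + 1 : ℕ)) x \ tri (k - i) x, ‖sc l ψ (x - y)‖ₑ * w y :=
        lintegral_mono_set hcov
    _ ≤ ∑' i : ℕ, ∫⁻ y in tri (k - (i + 1 : ℕ)) x \ tri (k - i) x, ‖sc l ψ (x - y)‖ₑ * w y :=
        lintegral_iUnion_le _ _
    _ ≤ ∑' i : ℕ, ENNReal.ofReal (2 * D) * e2 (k - l) * mx k w x * (2⁻¹) ^ i :=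
        ENNReal.tsum_le_tsum hterm
    _ = ENNReal.ofReal (4 * D) * e2 (k - l) * mx k w x := by
        rw [ENNReal.tsum_mul_left, ENNReal.tsum_geometric, ENNReal.one_sub_inv_two, inv_inv]
        have : ENNReal.ofReal (4 * D) = ENNReal.ofReal (2 * D) * 2 := by
          rw [← ENNReal.ofReal_ofNat 2, ← ENNReal.ofReal_mul (by positivity)]
          congr 1
          ring
        rw [this]
        ring

lemma lintegral_sc_le {ψ : ℝ → ℂ} {D : ℝ} (hψ : ∀ x, ‖ψ x‖ ≤ D / (1 + |x|) ^ 2)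
    (k : ℤ) (w : ℝ → ℝ≥0∞) (x : ℝ) :
    ∫⁻ y, ‖sc k ψ (x - y)‖ₑ * w y ≤ ENNReal.ofReal (5 * D) * mx k w x := by
  have hD : 0 ≤ D := by
    have := (norm_nonneg _).trans (hψ 0)
    simpa using this
  rw [← lintegral_add_compl _ (measurableSet_tri k x)]
  have h1 : ∫⁻ y in tri k x, ‖sc k ψ (x - y)‖ₑ * w y ≤ ENNReal.ofReal D * mx k w x := by
    calc ∫⁻ y in tri k x, ‖sc k ψ (x - y)‖ₑ * w y
        ≤ ∫⁻ y in tri k x, ENNReal.ofReal (2 ^ k * D) * w y := by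
          gcongr with y
          refine (enorm_sc_le hψ k le_rfl (abs_nonneg _)).trans (le_of_eq ?_)
          simp
      _ = ENNReal.ofReal (2 ^ k * D) * (e2 (-k) * av k w x) := by
          rw [lintegral_const_mul' _ _ ENNReal.ofReal_ne_top, lintegral_tri]
      _ = ENNReal.ofReal D * av k w x := by
          rw [ENNReal.ofReal_mul (by positivity), ← e2]
          calc e2 k * ENNReal.ofReal D * (e2 (-k) * av k w x)
              = (e2 k * e2 (-k)) * (ENNReal.ofReal D * av k w x) := by ring
            _ = _ := by rw [e2_mul_neg, one_mul]
      _ ≤ _ := by gcongr; exact av_le_mx le_rfl w x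
  have h2 := lintegral_compl_tri_sc_le hψ k k w x
  rw [sub_self, e2_zero, mul_one] at h2
  calc _ ≤ ENNReal.ofReal D * mx k w x + ENNReal.ofReal (4 * D) * mx k w x := add_le_add h1 h2
    _ = _ := by
        rw [← add_mul, ← ENNReal.ofReal_add hD (by positivity)]
        congr 2
        ring

/-! ### Littlewood–Paley kernels -/

/-- A kernel with quadratic decay and an `L¹`-Lipschitz bound, whose dyadic rescalings satisfy a
square function estimate on `L²`. -/
structure LPKer (ψ : ℝ → ℂ) (D : ℝ) : Prop where
  cont : Continuous ψ
  bound : ∀ x, ‖ψ x‖ ≤ D / (1 + |x|) ^ 2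
  lip : ∀ a, ∫⁻ x, ‖ψ (x + a) - ψ x‖ₑ ≤ ENNReal.ofReal (D * |a|)
  sq : ∀ G : ℝ → ℂ, Integrable G → MemLp G 2 → ∀ s : Finset ℤ,
    ∑ k ∈ s, ∫⁻ x, ‖cv k ψ G x‖ₑ ^ 2 ≤ ENNReal.ofReal D ^ 2 * ∫⁻ x, ‖G x‖ₑ ^ 2

lemma LPKer.nonneg {ψ : ℝ → ℂ} {D : ℝ} (h : LPKer ψ D) : 0 ≤ D := by
  have := (norm_nonneg _).trans (h.bound 0)
  simpa using this

lemma continuous_sc {ψ : ℝ → ℂ} (h : Continuous ψ) (k : ℤ) : Continuous (sc k ψ) := by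
  unfold sc; fun_prop

lemma measurable_kernel {ψ : ℝ → ℂ} (h : Continuous ψ) (k : ℤ) :
    Measurable (fun z : ℝ × ℝ => sc k ψ (z.1 - z.2)) :=
  ((continuous_sc h k).comp (continuous_fst.sub continuous_snd)).measurable

lemma measurable_cv {ψ F : ℝ → ℂ} (h : Continuous ψ) (hF : Measurable F) (k : ℤ) :
    Measurable (cv k ψ F) := by
  have : StronglyMeasurable (fun z : ℝ × ℝ => sc k ψ (z.1 - z.2) * F z.2) :=
    ((measurable_kernel h k).mul (hF.comp measurable_snd)).stronglyMeasurable
  exact this.integral_prod_right'.measurable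

lemma enorm_cv_le (k : ℤ) (ψ F : ℝ → ℂ) (x : ℝ) :
    ‖cv k ψ F x‖ₑ ≤ ∫⁻ y, ‖sc k ψ (x - y)‖ₑ * ‖F y‖ₑ := by
  refine (enorm_integral_le_lintegral_enorm _).trans (le_of_eq ?_)
  simp only [enorm_mul]

lemma enorm_cv_le_mx {ψ : ℝ → ℂ} {D : ℝ} (hψ : ∀ x, ‖ψ x‖ ≤ D / (1 + |x|) ^ 2)
    (k : ℤ) (F : ℝ → ℂ) (x : ℝ) :
    ‖cv k ψ F x‖ₑ ≤ ENNReal.ofReal (5 * D) * mx k (fun y => ‖F y‖ₑ) x :=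
  (enorm_cv_le k ψ F x).trans (lintegral_sc_le hψ k _ x)

lemma integrable_kernel_mul {ψ : ℝ → ℂ} {D : ℝ} (hc : Continuous ψ)
    (hψ : ∀ x, ‖ψ x‖ ≤ D / (1 + |x|) ^ 2) (k : ℤ) {F : ℝ → ℂ} (hF : Measurable F) {B : ℝ≥0}
    (hB : ∀ x, ‖F x‖ₑ ≤ B) (x : ℝ) : Integrable (fun y => sc k ψ (x - y) * F y) := by
  refine ⟨(((continuous_sc hc k).measurable.comp (measurable_const.sub measurable_id)).mul
    hF).aestronglyMeasurable, ?_⟩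
  rw [HasFiniteIntegral]
  simp only [enorm_mul]
  refine (lintegral_sc_le hψ k _ x).trans_lt ?_
  exact ENNReal.mul_lt_top ENNReal.ofReal_lt_top
    ((mx_le_of_le hB k x).trans_lt (ENNReal.mul_lt_top (by simp) (by simp)))

lemma cv_add {ψ : ℝ → ℂ} {D : ℝ} (hc : Continuous ψ)
    (hψ : ∀ x, ‖ψ x‖ ≤ D / (1 + |x|) ^ 2) (k : ℤ) {F G : ℝ → ℂ} (hF : Measurable F)
    (hG : Measurable G) {B B' : ℝ≥0}
    (hB : ∀ x, ‖F x‖ₑ ≤ B) (hB' : ∀ x, ‖G x‖ₑ ≤ B') (x : ℝ) :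
    cv k ψ (fun y => F y + G y) x = cv k ψ F x + cv k ψ G x := by
  unfold cv
  rw [← integral_add (integrable_kernel_mul hc hψ k hF hB x)
    (integrable_kernel_mul hc hψ k hG hB' x)]
  simp only [mul_add]

lemma cv_sum {ψ : ℝ → ℂ} {D : ℝ} (hc : Continuous ψ)
    (hψ : ∀ x, ‖ψ x‖ ≤ D / (1 + |x|) ^ 2) (k : ℤ) {ι : Type*} (s : Finset ι) {F : ι → ℝ → ℂ}
    (hF : ∀ i, Measurable (F i)) {B : ℝ≥0} (hB : ∀ i x, ‖F i x‖ₑ ≤ B) (x : ℝ) :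
    cv k ψ (fun y => ∑ i ∈ s, F i y) x = ∑ i ∈ s, cv k ψ (F i) x := by
  unfold cv
  rw [← integral_finsetSum _ (fun i _ => integrable_kernel_mul hc hψ k (hF i) (hB i) x)]
  simp only [Finset.mul_sum]

/-- Averages over dyadic intervals. -/
def ce (j : ℤ) (F : ℝ → ℂ) (y : ℝ) : ℂ := ((2 : ℝ) ^ j : ℝ) * ∫ z in cell j y, F z

lemma cell_congr {j : ℤ} {x y : ℝ} (h : dq j y = dq j x) : cell j y = cell j x := by
  ext z; simp [cell, h]

lemma ce_congr {j : ℤ} {x y : ℝ} (h : dq j y = dq j x) (F : ℝ → ℂ) : ce j F y = ce j F x := by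
  rw [ce, ce, cell_congr h]

lemma measurable_of_dq {β : Type*} [MeasurableSpace β] {j : ℤ} {f : ℝ → β}
    (h : ∀ x y, dq j y = dq j x → f y = f x) : Measurable f := by
  have h1 : ∀ x, dq j ((dq j x : ℝ) * 2 ^ (-j)) = dq j x := by
    intro x
    have : (2 : ℝ) ^ j * ((dq j x : ℝ) * 2 ^ (-j)) = dq j x := by
      rw [zpow_neg]; field_simp
    rw [dq, this, Int.floor_intCast]
  have h2 : f = (fun n : ℤ => f ((n : ℝ) * 2 ^ (-j))) ∘ dq j := by
    funext x
    exact (h _ _ (h1 x)).symm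
  rw [h2]
  exact Measurable.of_discrete.comp (measurable_dq j)

lemma measurable_ce (j : ℤ) (F : ℝ → ℂ) : Measurable (ce j F) :=
  measurable_of_dq (j := j) fun _ _ h => ce_congr h F

lemma enorm_two_zpow (k : ℤ) : ‖(((2 : ℝ) ^ k : ℝ) : ℂ)‖ₑ = e2 k := by
  rw [← ofReal_norm, Complex.norm_real, Real.norm_of_nonneg (by positivity), e2]

lemma enorm_ce_le (j : ℤ) (F : ℝ → ℂ) (y : ℝ) :
    ‖ce j F y‖ₑ ≤ e2 j * ∫⁻ z in cell j y, ‖F z‖ₑ := by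
  rw [ce, enorm_mul, enorm_two_zpow]
  gcongr
  exact enorm_integral_le_lintegral_enorm _

lemma setIntegral_cell_ce (j : ℤ) (F : ℝ → ℂ) (y : ℝ) :
    ∫ z in cell j y, ce j F z = ∫ z in cell j y, F z := by
  rw [setIntegral_congr_fun (g := fun _ => ce j F y) (measurableSet_cell j y)
    (fun z hz => ce_congr hz F), setIntegral_const, measureReal_def, volume_cell, e2,
    ENNReal.toReal_ofReal (by positivity), ce, Complex.real_smul, ← mul_assoc, ← Complex.ofReal_mul,
    ← zpow_add₀ two_ne_zero]
  simp

/-- A function with mean zero on all dyadic intervals of a generation is orthogonal to functions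
which are constant on these intervals. -/
lemma integral_mul_eq_zero_of_dq {j : ℤ} {h b : ℝ → ℂ} (hh : ∀ x y, dq j y = dq j x → h y = h x)
    (hi : Integrable (fun y => h y * b y)) (hb : ∀ x, ∫ y in cell j x, b y = 0) :
    ∫ y, h y * b y = 0 := by
  have hm : ∀ n : ℤ, MeasurableSet {y | dq j y = n} := fun n =>
    measurable_dq j (measurableSet_singleton n)
  have hu : ⋃ n : ℤ, {y | dq j y = n} = univ := by
    ext y; simp
  have hd : Pairwise (Function.onFun Disjoint fun n : ℤ => {y | dq j y = n}) := by
    intro m n hmn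
    rw [Function.onFun, Set.disjoint_left]
    intro y hy hy'
    simp only [mem_ofPred_eq] at hy hy'
    exact hmn (hy ▸ hy')
  have := hasSum_integral_iUnion (f := fun y => h y * b y) hm hd hi.integrableOn
  rw [hu, setIntegral_univ] at this
  refine this.unique ?_
  have hz : (fun n : ℤ => ∫ y in {y | dq j y = n}, h y * b y) = fun _ => 0 := by
    funext n
    by_cases hne : ∃ x, dq j x = n
    · obtain ⟨x, rfl⟩ := hne
      have : ∫ y in {y | dq j y = dq j x}, h y * b y = ∫ y in cell j x, h x * b y :=
        setIntegral_congr_fun (hm _) (fun y hy => by simp only [hh x y hy])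
      rw [this, integral_const_mul, hb, mul_zero]
    · have : {y | dq j y = n} = ∅ := by
        ext y
        simp only [mem_ofPred_eq, mem_empty_iff_false, iff_false]
        exact fun hy => hne ⟨y, hy⟩
      rw [this]; simp
  rw [hz]
  exact hasSum_zero

lemma lintegral_comp_two_zpow_mul (k : ℤ) {f : ℝ → ℝ≥0∞} (hf : Measurable f) :
    e2 k * ∫⁻ x, f (2 ^ k * x) = ∫⁻ x, f x := by
  have hk : (2 : ℝ) ^ k ≠ 0 := by positivity
  conv_rhs => rw [← Real.smul_map_volume_mul_left hk]
  rw [lintegral_smul_measure, lintegral_map hf (by fun_prop), abs_of_pos (by positivity), e2,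
    smul_eq_mul]

lemma LPKer.lintegral_sc_sub_le {ψ : ℝ → ℂ} {D : ℝ} (h : LPKer ψ D) (k : ℤ) (y c : ℝ) :
    ∫⁻ x, ‖sc k ψ (x - y) - sc k ψ (x - c)‖ₑ ≤ ENNReal.ofReal (D * (2 ^ k * |y - c|)) := by
  have hc := h.cont
  have e1 : ∀ x, ‖sc k ψ (x - y) - sc k ψ (x - c)‖ₑ =
      e2 k * (fun u => ‖ψ (u + 2 ^ k * (c - y)) - ψ u‖ₑ) (2 ^ k * (x - c)) := by
    intro x
    have : (2 : ℝ) ^ k * (x - c) + 2 ^ k * (c - y) = 2 ^ k * (x - y) := by ring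
    simp only [sc, this, ← mul_sub, enorm_mul, enorm_two_zpow]
  have hm : Measurable (fun u => ‖ψ (u + 2 ^ k * (c - y)) - ψ u‖ₑ) := by fun_prop
  simp only [e1]
  rw [lintegral_sub_right_eq_self (μ := volume) (fun x => e2 k *
    (fun u => ‖ψ (u + 2 ^ k * (c - y)) - ψ u‖ₑ) (2 ^ k * x)) c,
    lintegral_const_mul' _ _ (e2_ne_top k), lintegral_comp_two_zpow_mul k hm]
  refine (h.lip _).trans (le_of_eq ?_)
  rw [abs_mul, abs_of_pos (show (0 : ℝ) < 2 ^ k by positivity), abs_sub_comm c y]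

lemma abs_sub_dq_le (j : ℤ) (y : ℝ) : |y - dq j y * 2 ^ (-j)| ≤ 2 ^ (-j) := by
  have h : y ∈ {z | dq j z = dq j y} := rfl
  rw [setOf_dq_eq, mem_Ico] at h
  rw [abs_le]
  have : (0 : ℝ) < 2 ^ (-j) := by positivity
  constructor <;> linarith

lemma LPKer.lintegral_cv_le_of_cancel {ψ : ℝ → ℂ} {D : ℝ} (h : LPKer ψ D) (k j : ℤ) {b : ℝ → ℂ}
    (hb : Measurable b) (hi : Integrable b) (h0 : ∀ x, ∫ y in cell j x, b y = 0) :
    ∫⁻ x, ‖cv k ψ b x‖ₑ ≤ ENNReal.ofReal D * e2 (k - j) * ∫⁻ y, ‖b y‖ₑ := by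
  have hD := h.nonneg
  set c : ℝ → ℝ := fun y => dq j y * 2 ^ (-j) with hc
  have hcm : Measurable c := measurable_of_dq (j := j) fun x y hxy => by simp only [hc, hxy]
  have hbd : ∀ x, ‖sc k ψ x‖ ≤ 2 ^ k * D := by
    intro x
    have := (ENNReal.ofReal_le_ofReal_iff (by positivity)).1
      ((ofReal_norm _).le.trans (enorm_sc_le h.bound k le_rfl (abs_nonneg x)))
    simpa using this
  have hInt : ∀ a : ℝ → ℝ, Measurable a → ∀ x, Integrable (fun y => sc k ψ (x - a y) * b y) := by
    intro a ha x
    refine hi.bdd_mul (c := 2 ^ k * D) ?_ (Eventually.of_forall fun y => hbd _)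
    exact ((continuous_sc h.cont k).measurable.comp (measurable_const.sub ha)).aestronglyMeasurable
  have hrep : ∀ x, cv k ψ b x = ∫ y, (sc k ψ (x - y) - sc k ψ (x - c y)) * b y := by
    intro x
    have hy : Integrable (fun y => sc k ψ (x - y) * b y) := hInt id measurable_id x
    simp only [sub_mul]
    rw [integral_sub hy (hInt c hcm x),
      integral_mul_eq_zero_of_dq (j := j) (h := fun y => sc k ψ (x - c y)) (b := b)
        (fun x y hxy => by simp only [hc, hxy]) (hInt c hcm x) h0, sub_zero, cv]
  have hmeas : Measurable (fun z : ℝ × ℝ => ‖sc k ψ (z.1 - z.2) - sc k ψ (z.1 - c z.2)‖ₑ *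
      ‖b z.2‖ₑ) := by
    have hs := (continuous_sc h.cont k).measurable
    fun_prop
  calc ∫⁻ x, ‖cv k ψ b x‖ₑ
      ≤ ∫⁻ x, ∫⁻ y, ‖sc k ψ (x - y) - sc k ψ (x - c y)‖ₑ * ‖b y‖ₑ := by
        refine lintegral_mono fun x => ?_
        rw [hrep x]
        refine (enorm_integral_le_lintegral_enorm _).trans (le_of_eq ?_)
        simp only [enorm_mul]
    _ = ∫⁻ y, ∫⁻ x, ‖sc k ψ (x - y) - sc k ψ (x - c y)‖ₑ * ‖b y‖ₑ :=
        lintegral_lintegral_swap hmeas.aemeasurable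
    _ ≤ ∫⁻ y, ENNReal.ofReal (D * (2 ^ k * 2 ^ (-j))) * ‖b y‖ₑ := by
        refine lintegral_mono fun y => ?_
        rw [lintegral_mul_const' _ _ enorm_ne_top]
        gcongr
        refine (h.lintegral_sc_sub_le k y (c y)).trans (ENNReal.ofReal_le_ofReal ?_)
        gcongr
        exact abs_sub_dq_le j y
    _ = _ := by
        rw [lintegral_const_mul' _ _ ENNReal.ofReal_ne_top, ENNReal.ofReal_mul hD, e2,
          zpow_sub₀ two_ne_zero, zpow_neg]
        rfl

lemma mem_tri_comm {k : ℤ} {x y : ℝ} : x ∈ tri k y ↔ y ∈ tri k x := by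
  simp only [tri, mem_ofPred_eq, abs_sub_comm]

lemma LPKer.setLIntegral_cv_le_of_separated {ψ : ℝ → ℂ} {D : ℝ} (h : LPKer ψ D) (k j : ℤ)
    {b : ℝ → ℂ} (hb : Measurable b) {V : Set ℝ} (hV : MeasurableSet V)
    (h0 : ∀ x ∈ V, ∀ y ∈ tri j x, b y = 0) :
    ∫⁻ x in V, ‖cv k ψ b x‖ₑ ≤ ENNReal.ofReal (12 * D) * e2 (j - k) * ∫⁻ y, ‖b y‖ₑ := by
  have hD := h.nonneg
  have hS : MeasurableSet {z : ℝ × ℝ | z.1 ∈ (tri j z.2)ᶜ} := by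
    have h1 : Measurable fun p : ℝ × ℝ => (dq j p.1, dq j p.2) :=
      ((measurable_dq j).comp measurable_fst).prodMk ((measurable_dq j).comp measurable_snd)
    exact (h1 (MeasurableSet.of_discrete (s := {n : ℤ × ℤ | |n.1 - n.2| ≤ 1}))).compl
  have hmeas : Measurable (fun z : ℝ × ℝ =>
      ({z : ℝ × ℝ | z.1 ∈ (tri j z.2)ᶜ}).indicator (fun z => ‖sc k ψ (z.1 - z.2)‖ₑ * ‖b z.2‖ₑ) z) := by
    refine Measurable.indicator ?_ hS
    have hs := (continuous_sc h.cont k).measurable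
    fun_prop
  have hψ' : ∀ x, ‖ψ (-x)‖ ≤ D / (1 + |x|) ^ 2 := fun x => by simpa using h.bound (-x)
  calc ∫⁻ x in V, ‖cv k ψ b x‖ₑ
      ≤ ∫⁻ x in V, ∫⁻ y, ({z : ℝ × ℝ | z.1 ∈ (tri j z.2)ᶜ}).indicator
          (fun z => ‖sc k ψ (z.1 - z.2)‖ₑ * ‖b z.2‖ₑ) (x, y) := by
        refine setLIntegral_mono' hV fun x hx => ?_
        refine (enorm_cv_le k ψ b x).trans (lintegral_mono fun y => ?_)
        by_cases hy : y ∈ tri j x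
        · simp [h0 x hx y hy]
        · rw [indicator_of_mem (by simpa [mem_tri_comm] using hy)]
    _ ≤ ∫⁻ x, ∫⁻ y, ({z : ℝ × ℝ | z.1 ∈ (tri j z.2)ᶜ}).indicator
          (fun z => ‖sc k ψ (z.1 - z.2)‖ₑ * ‖b z.2‖ₑ) (x, y) := setLIntegral_le_lintegral _ _
    _ = ∫⁻ y, ∫⁻ x, ({z : ℝ × ℝ | z.1 ∈ (tri j z.2)ᶜ}).indicator
          (fun z => ‖sc k ψ (z.1 - z.2)‖ₑ * ‖b z.2‖ₑ) (x, y) :=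
        lintegral_lintegral_swap hmeas.aemeasurable
    _ ≤ ∫⁻ y, ENNReal.ofReal (12 * D) * e2 (j - k) * ‖b y‖ₑ := by
        refine lintegral_mono fun y => ?_
        have e : ∀ x, ({z : ℝ × ℝ | z.1 ∈ (tri j z.2)ᶜ}).indicator
            (fun z => ‖sc k ψ (z.1 - z.2)‖ₑ * ‖b z.2‖ₑ) (x, y) =
            (tri j y)ᶜ.indicator (fun x => ‖sc k ψ (x - y)‖ₑ * ‖b y‖ₑ) x := by
          intro x; rfl
        simp only [e]
        rw [lintegral_indicator (measurableSet_tri j y).compl, lintegral_mul_const' _ _ enorm_ne_top]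
        gcongr
        have h3 := lintegral_compl_tri_sc_le hψ' j k (fun _ => 1) y
        have h4 : mx j (fun _ => 1) y ≤ 3 * 1 := mx_le_of_le (fun _ => le_rfl) j y
        have e3 : ∀ x, ‖sc k (fun x => ψ (-x)) (y - x)‖ₑ * 1 = ‖sc k ψ (x - y)‖ₑ := by
          intro x
          rw [mul_one, sc, sc]
          congr 3
          ring
        simp only [e3] at h3
        calc _ ≤ _ := h3
          _ ≤ ENNReal.ofReal (4 * D) * e2 (j - k) * (3 * 1) := by gcongr
          _ = _ := by
            rw [show 12 * D = 4 * D * 3 by ring, ENNReal.ofReal_mul (p := 4 * D) (by positivity),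
              ENNReal.ofReal_ofNat]
            ring
    _ = _ := lintegral_const_mul' _ _ (by finiteness [e2_ne_top (j - k)])

lemma add3_sq_le (a b c : ℝ≥0∞) : (a + b + c) ^ 2 ≤ 9 * (a ^ 2 + b ^ 2 + c ^ 2) := by
  obtain ⟨m, ha, hb, hc, hm⟩ : ∃ m, a ≤ m ∧ b ≤ m ∧ c ≤ m ∧ m ^ 2 ≤ a ^ 2 + b ^ 2 + c ^ 2 := by
    refine ⟨max (max a b) c, by simp, by simp, by simp, ?_⟩
    rcases max_choice (max a b) c with h | h <;> rw [h]
    · rcases max_choice a b with h | h <;> rw [h]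
      · rw [add_assoc]; exact le_self_add
      · rw [add_comm (a ^ 2), add_assoc]; exact le_self_add
    · exact le_add_self
  calc (a + b + c) ^ 2 ≤ (m + m + m) ^ 2 := by gcongr
    _ = 9 * m ^ 2 := by ring
    _ ≤ _ := by gcongr

lemma e2_neg_natCast (n : ℕ) : e2 (-n) = 2⁻¹ ^ n := by
  rw [e2, zpow_neg, zpow_natCast, ENNReal.ofReal_inv_of_pos (by positivity),
    ENNReal.ofReal_pow (by positivity), ENNReal.ofReal_ofNat, ENNReal.inv_pow]

lemma tsum_two_inv_pow : ∑' n : ℕ, (2⁻¹ : ℝ≥0∞) ^ n = 2 := by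
  rw [ENNReal.tsum_geometric, ENNReal.one_sub_inv_two, inv_inv]

lemma sum_e2_abs_le (s : Finset ℤ) (j : ℤ) : ∑ k ∈ s, e2 (-|k - j|) ≤ 4 := by
  calc ∑ k ∈ s, e2 (-|k - j|) ≤ ∑' k : ℤ, e2 (-|k - j|) := ENNReal.sum_le_tsum s
    _ = ∑' k : ℤ, e2 (-|k|) := (Equiv.subRight j).tsum_eq (fun k => e2 (-|k|))
    _ = ∑' n : ℕ, e2 (-|(n : ℤ)|) + ∑' n : ℕ, e2 (-|-((n : ℤ) + 1)|) :=
        tsum_of_nat_of_neg_add_one ENNReal.summable ENNReal.summable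
    _ ≤ ∑' n : ℕ, (2⁻¹ : ℝ≥0∞) ^ n + ∑' n : ℕ, (2⁻¹ : ℝ≥0∞) ^ n := by
        gcongr with n n
        · rw [abs_of_nonneg (by positivity), e2_neg_natCast]
        · rw [abs_neg, abs_of_nonneg (by positivity), ← e2_neg_natCast]
          rw [e2, e2]
          apply ENNReal.ofReal_le_ofReal
          exact zpow_le_zpow_right₀ one_le_two (by omega)
    _ = 4 := by rw [tsum_two_inv_pow]; norm_num

/-- Local square function estimate, on sets where the maximal function is bounded. -/
lemma LPKer.local_sq {ψ : ℝ → ℂ} {D : ℝ} (h : LPKer ψ D) {F : ℝ → ℂ} (hF : Measurable F)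
    {B : ℝ≥0} (hB : ∀ x, ‖F x‖ₑ ≤ B) (k0 K : ℤ) (x0 : ℝ) (lam : ℝ≥0) (V : ℤ → Set ℝ)
    (hVm : ∀ k, MeasurableSet (V k)) (hVc : ∀ k, V k ⊆ cell k0 x0)
    (hV : ∀ k, ∀ x ∈ V k, mx k (fun y => ‖F y‖ₑ) x ≤ lam)
    (h0 : mx k0 (fun y => ‖F y‖ₑ) x0 ≤ lam) :
    ∑ k ∈ Finset.Icc k0 K, ∫⁻ x in V k, ‖cv k ψ F x‖ₑ ^ 2 ≤
      120000 * ENNReal.ofReal D ^ 2 * lam ^ 2 * e2 (-k0) := by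
  classical
  have hD := h.nonneg
  set W : ℝ → ℝ≥0∞ := fun y => ‖F y‖ₑ with hW
  set S := tri k0 x0 with hS
  have hSm : MeasurableSet S := measurableSet_tri k0 x0
  set F1 : ℝ → ℂ := S.indicator F with hF1
  set F2 : ℝ → ℂ := Sᶜ.indicator F with hF2
  have hF1m : Measurable F1 := hF.indicator hSm
  have hF2m : Measurable F2 := hF.indicator hSm.compl
  have hF1W : ∀ y, ‖F1 y‖ₑ ≤ W y := fun y => enorm_indicator_le_enorm_self _ _
  have hF2W : ∀ y, ‖F2 y‖ₑ ≤ W y := fun y => enorm_indicator_le_enorm_self _ _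
  have hF1l : ∫⁻ y, ‖F1 y‖ₑ ≤ lam * e2 (-k0) := by
    calc ∫⁻ y, ‖F1 y‖ₑ = ∫⁻ y in S, W y := by
          rw [← lintegral_indicator hSm]
          congr 1; funext y
          by_cases hy : y ∈ S <;> simp [hF1, hW, hy]
      _ = e2 (-k0) * av k0 W x0 := lintegral_tri _ _ _
      _ ≤ e2 (-k0) * lam := by gcongr; exact (av_le_mx le_rfl W x0).trans h0
      _ = _ := mul_comm _ _
  set P : ℤ → ℝ → Prop := fun j y => lam < e2 j * ∫⁻ z in cell j y, ‖F1 z‖ₑ with hP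
  have hPc : ∀ i j x y, i ≤ j → dq j y = dq j x → (P i y ↔ P i x) := by
    intro i j x y hij hxy
    simp only [hP, cell_congr (dq_eq_of_le hij hxy)]
  set A : ℤ → Set ℝ := fun j => {y | (j < K → P j y) ∧ ∀ i, k0 ≤ i → i < j → ¬ P i y} with hA
  have hAc : ∀ j x y, dq j y = dq j x → (y ∈ A j ↔ x ∈ A j) := by
    intro j x y hxy
    simp only [hA, mem_ofPred_eq]
    rw [hPc j j x y le_rfl hxy]
    refine and_congr Iff.rfl
      (forall_congr' fun i => forall_congr' fun _ => forall_congr' fun hi => ?_)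
    rw [hPc i j x y hi.le hxy]
  have hAm : ∀ j, MeasurableSet (A j) := by
    intro j
    have : Measurable (fun y => y ∈ A j) :=
      measurable_of_dq (j := j) fun x y hxy => propext (hAc j x y hxy)
    exact measurableSet_setOfPred.2 this
  have hAu : ∀ i j y, k0 ≤ i → i < j → j ≤ K → y ∈ A i → y ∉ A j := by
    intro i j y hi hij hj hyi hyj
    exact hyj.2 i hi hij (hyi.1 (by omega))
  have hAe : k0 ≤ K → ∀ y, ∃ j ∈ Finset.Icc k0 K, y ∈ A j := by
    intro hK y
    by_cases hex : ∃ i : ℕ, k0 + i < K ∧ P (k0 + i) y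
    · have hs := Nat.find_spec hex
      refine ⟨k0 + Nat.find hex, Finset.mem_Icc.2 ⟨by omega, hs.1.le⟩, fun _ => hs.2, ?_⟩
      intro i hi hi' hPi
      have := Nat.find_min hex (m := (i - k0).toNat) (by omega)
      rw [show k0 + ((i - k0).toNat : ℤ) = i by omega] at this
      exact this ⟨by omega, hPi⟩
    · push Not at hex
      refine ⟨K, Finset.mem_Icc.2 ⟨hK, le_rfl⟩, fun h => absurd h (lt_irrefl _), ?_⟩
      intro i hi hi'
      have := hex (i - k0).toNat
      rw [show k0 + ((i - k0).toNat : ℤ) = i by omega] at this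
      exact this hi'
  have hce : ∀ j, k0 ≤ j → ∀ y ∈ A j, ‖ce j F1 y‖ₑ ≤ S.indicator (fun _ => 2 * (lam : ℝ≥0∞)) y := by
    intro j hj y hy
    by_cases hyS : y ∈ S
    · rw [indicator_of_mem hyS]
      refine (enorm_ce_le j F1 y).trans ?_
      rcases hj.eq_or_lt with rfl | hlt
      · calc e2 k0 * ∫⁻ z in cell k0 y, ‖F1 z‖ₑ ≤ e2 k0 * ∫⁻ z, ‖F1 z‖ₑ := by
              gcongr; exact Measure.restrict_le_self
          _ ≤ e2 k0 * (lam * e2 (-k0)) := by gcongr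
          _ = lam := by rw [mul_left_comm, e2_mul_neg, mul_one]
          _ ≤ 2 * lam := by rw [two_mul]; exact le_self_add
      · have hn : ¬ P (j - 1) y := hy.2 _ (by omega) (by omega)
        simp only [hP, not_lt] at hn
        calc e2 j * ∫⁻ z in cell j y, ‖F1 z‖ₑ
            ≤ (2 * e2 (j - 1)) * ∫⁻ z in cell (j - 1) y, ‖F1 z‖ₑ := by
              have : e2 j = 2 * e2 (j - 1) := by
                rw [show (j : ℤ) = 1 + (j - 1) by ring, e2_add]
                simp [e2]
              rw [this]
              gcongr
              intro z hz
              exact dq_eq_of_le (by omega) hz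
          _ = 2 * (e2 (j - 1) * ∫⁻ z in cell (j - 1) y, ‖F1 z‖ₑ) := by ring
          _ ≤ 2 * lam := by gcongr
    · have : ce j F1 y = 0 := by
        rw [ce, setIntegral_congr_fun (g := fun _ => (0 : ℂ)) (measurableSet_cell j y), integral_zero,
          mul_zero]
        intro z hz
        have hz' : dq k0 z = dq k0 y := dq_eq_of_le hj hz
        have : z ∉ S := by
          simp only [hS, tri, mem_ofPred_eq, hz'] at hyS ⊢
          exact hyS
        simp [hF1, this]
      simp [this]
  rcases lt_or_ge K k0 with hK | hK
  · rw [Finset.Icc_eq_empty (by omega)]; simp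
  set G : ℝ → ℂ := fun y => ∑ j ∈ Finset.Icc k0 K, (A j).indicator (ce j F1) y with hG
  set b : ℤ → ℝ → ℂ := fun j => (A j).indicator (fun y => F1 y - ce j F1 y) with hb
  have hone : ∀ y, ∃ j ∈ Finset.Icc k0 K, y ∈ A j ∧ ∀ i ∈ Finset.Icc k0 K, i ≠ j → y ∉ A i := by
    intro y
    obtain ⟨j, hj, hy⟩ := hAe hK y
    refine ⟨j, hj, hy, fun i hi hij hyi => ?_⟩
    rw [Finset.mem_Icc] at hi hj
    rcases lt_or_gt_of_ne hij with hl | hl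
    · exact hAu i j y hi.1 hl hj.2 hyi hy
    · exact hAu j i y hj.1 hl hi.2 hy hyi
  have hGb : ∀ y, ∃ j ∈ Finset.Icc k0 K, y ∈ A j ∧ G y = ce j F1 y ∧
      ∀ i ∈ Finset.Icc k0 K, i ≠ j → b i y = 0 := by
    intro y
    obtain ⟨j, hj, hy, hu⟩ := hone y
    refine ⟨j, hj, hy, ?_, fun i hi hij => ?_⟩
    · simp only [hG]
      rw [Finset.sum_eq_single_of_mem j hj, indicator_of_mem hy]
      intro i hi hij
      rw [indicator_of_notMem (hu i hi hij)]
    · simp only [hb]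
      rw [indicator_of_notMem (hu i hi hij)]
  have hGS : ∀ y, ‖G y‖ₑ ≤ S.indicator (fun _ => 2 * (lam : ℝ≥0∞)) y := by
    intro y
    obtain ⟨j, hj, hy, hGy, -⟩ := hGb y
    rw [hGy]
    exact hce j (Finset.mem_Icc.1 hj).1 y hy
  have hG2 : ∀ y, ‖G y‖ₑ ≤ 2 * (lam : ℝ≥0∞) := fun y =>
    (hGS y).trans (indicator_le_self' (by simp) y)
  have hsum : ∀ y, F1 y = G y + ∑ j ∈ Finset.Icc k0 K, b j y := by
    intro y
    obtain ⟨j, hj, hy, hGy, hbz⟩ := hGb y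
    rw [Finset.sum_eq_single_of_mem j hj hbz, hGy]
    simp only [hb]
    rw [indicator_of_mem hy]
    ring
  have hGm : Measurable G :=
    Finset.measurable_sum _ fun j _ => (measurable_ce j F1).indicator (hAm j)
  have hbm : ∀ j, Measurable (b j) := fun j =>
    (hF1m.sub (measurable_ce j F1)).indicator (hAm j)
  have hceB : ∀ j y, ‖ce j F1 y‖ₑ ≤ B := by
    intro j y
    refine (enorm_ce_le j F1 y).trans ?_
    calc e2 j * ∫⁻ z in cell j y, ‖F1 z‖ₑ ≤ e2 j * ∫⁻ _ in cell j y, (B : ℝ≥0∞) := by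
          gcongr with z; exact (hF1W z).trans (hB z)
      _ = B := by
          rw [setLIntegral_const, volume_cell, mul_left_comm, e2_mul_neg, mul_one]
  have hbB : ∀ j y, ‖b j y‖ₑ ≤ (2 * B : ℝ≥0) := by
    intro j y
    refine (enorm_indicator_le_enorm_self _ _).trans ((enorm_sub_le).trans ?_)
    push_cast
    rw [two_mul]
    exact add_le_add ((hF1W y).trans (hB y)) (hceB j y)
  have hSl : ∫⁻ y, S.indicator (fun _ => 2 * (lam : ℝ≥0∞)) y = 6 * lam * e2 (-k0) := by
    rw [lintegral_indicator hSm, setLIntegral_const, volume_tri]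
    ring
  have hbl : ∑ j ∈ Finset.Icc k0 K, ∫⁻ y, ‖b j y‖ₑ ≤ 7 * lam * e2 (-k0) := by
    rw [← lintegral_finsetSum _ fun j _ => (hbm j).enorm]
    calc ∫⁻ y, ∑ j ∈ Finset.Icc k0 K, ‖b j y‖ₑ
        ≤ ∫⁻ y, (‖F1 y‖ₑ + S.indicator (fun _ => 2 * (lam : ℝ≥0∞)) y) := by
          refine lintegral_mono fun y => ?_
          obtain ⟨j, hj, hy, hGy, hbz⟩ := hGb y
          show ∑ j ∈ Finset.Icc k0 K, ‖b j y‖ₑ ≤ _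
          rw [Finset.sum_eq_single_of_mem j hj fun i hi hij => by rw [hbz i hi hij, enorm_zero]]
          simp only [hb]
          rw [indicator_of_mem hy]
          exact enorm_sub_le.trans (add_le_add le_rfl (hce j (Finset.mem_Icc.1 hj).1 y hy))
      _ ≤ lam * e2 (-k0) + 6 * lam * e2 (-k0) := by
          rw [lintegral_add_left hF1m.enorm, hSl]
          gcongr
      _ = _ := by ring
  have hbi : ∀ j ∈ Finset.Icc k0 K, Integrable (b j) := by
    intro j hj
    refine ⟨(hbm j).aestronglyMeasurable, ?_⟩
    rw [HasFiniteIntegral]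
    refine ((Finset.single_le_sum (f := fun j => ∫⁻ y, ‖b j y‖ₑ) (fun _ _ => zero_le) hj).trans
      hbl).trans_lt ?_
    finiteness [e2_ne_top (-k0)]
  have hF1i : Integrable F1 := by
    refine ⟨hF1m.aestronglyMeasurable, ?_⟩
    rw [HasFiniteIntegral]
    refine hF1l.trans_lt ?_
    finiteness [e2_ne_top (-k0)]
  have hb0 : ∀ j x, ∫ y in cell j x, b j y = 0 := by
    intro j x
    by_cases hx : x ∈ A j
    · have : ∫ y in cell j x, b j y = ∫ y in cell j x, (F1 y - ce j F1 y) := by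
        refine setIntegral_congr_fun (measurableSet_cell j x) fun y hy => ?_
        simp only [hb]
        rw [indicator_of_mem ((hAc j x y hy).2 hx)]
      rw [this, integral_sub hF1i.integrableOn, setIntegral_cell_ce, sub_self]
      refine Measure.integrableOn_of_bounded (M := B) ?_ (measurable_ce j F1).aestronglyMeasurable ?_
      · rw [volume_cell]; exact e2_ne_top _
      · refine Eventually.of_forall fun y => ?_
        have := hceB j y
        rw [← ofReal_norm, ← ENNReal.ofReal_coe_nnreal] at this
        exact (ENNReal.ofReal_le_ofReal_iff B.coe_nonneg).1 this
    · rw [setIntegral_congr_fun (g := fun _ => (0 : ℂ)) (measurableSet_cell j x), integral_zero]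
      intro y hy
      simp only [hb]
      rw [indicator_of_notMem (fun h' => hx ((hAc j x y hy).1 h'))]
  have hkj : ∀ k ∈ Finset.Icc k0 K, ∀ j ∈ Finset.Icc k0 K, ∫⁻ x in V k, ‖cv k ψ (b j) x‖ₑ ≤
      ENNReal.ofReal (12 * D) * e2 (-|k - j|) * ∫⁻ y, ‖b j y‖ₑ := by
    intro k hk j hj
    rw [Finset.mem_Icc] at hk hj
    rcases le_or_gt k j with hle | hlt
    · refine (setLIntegral_le_lintegral _ _).trans
        ((h.lintegral_cv_le_of_cancel k j (hbm j) (hbi j (Finset.mem_Icc.2 hj)) (hb0 j)).trans ?_)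
      rw [abs_of_nonpos (by omega), neg_neg]
      gcongr
      linarith
    · rw [abs_of_pos (by omega), neg_sub]
      refine h.setLIntegral_cv_le_of_separated k j (hbm j) (hVm k) fun x hx y hy => ?_
      by_contra hne
      have hyA : y ∈ A j := by
        by_contra hn
        exact hne (indicator_of_notMem hn _)
      have hPj : P j y := hyA.1 (by omega)
      have hsub : cell j y ⊆ tri j x := by
        intro z hz
        have hz' : dq j z = dq j y := hz
        simp only [tri, mem_ofPred_eq, hz'] at hy ⊢
        exact hy
      have : e2 j * ∫⁻ z in cell j y, ‖F1 z‖ₑ ≤ lam := by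
        calc e2 j * ∫⁻ z in cell j y, ‖F1 z‖ₑ ≤ e2 j * ∫⁻ z in tri j x, W z := by
              gcongr with z; exact hF1W z
          _ ≤ mx k W x := av_le_mx hlt.le W x
          _ ≤ lam := hV k x hx
      exact absurd hPj (not_lt.2 this)
  set Bf : ℝ → ℂ := fun y => ∑ j ∈ Finset.Icc k0 K, b j y with hBf
  have hBfm : Measurable Bf := Finset.measurable_sum _ fun j _ => hbm j
  have hBf1 : ∀ y, ‖Bf y‖ₑ ≤ W y + 2 * lam := by
    intro y
    have : Bf y = F1 y - G y := by rw [hsum y]; ring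
    rw [this]
    exact enorm_sub_le.trans (add_le_add (hF1W y) (hG2 y))
  have hBfB : ∀ y, ‖Bf y‖ₑ ≤ (B + 2 * lam : ℝ≥0) := by
    intro y
    refine (hBf1 y).trans ?_
    push_cast
    gcongr
    exact hB y
  have hBfs : ∀ k x, cv k ψ Bf x = ∑ j ∈ Finset.Icc k0 K, cv k ψ (b j) x := fun k x =>
    cv_sum h.cont h.bound k _ hbm hbB x
  have hsup : ∀ k, ∀ x ∈ V k, ‖cv k ψ Bf x‖ₑ ≤ ENNReal.ofReal (35 * D) * lam := by
    intro k x hx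
    have hm2 : Measurable fun y => ‖sc k ψ (x - y)‖ₑ := by
      have hs := (continuous_sc h.cont k).measurable
      fun_prop
    calc ‖cv k ψ Bf x‖ₑ ≤ ∫⁻ y, ‖sc k ψ (x - y)‖ₑ * ‖Bf y‖ₑ := enorm_cv_le k ψ Bf x
      _ ≤ ∫⁻ y, (‖sc k ψ (x - y)‖ₑ * W y + ‖sc k ψ (x - y)‖ₑ * (2 * lam)) := by
          gcongr with y
          rw [← mul_add]
          gcongr
          exact hBf1 y
      _ = (∫⁻ y, ‖sc k ψ (x - y)‖ₑ * W y) + ∫⁻ y, ‖sc k ψ (x - y)‖ₑ * (2 * lam) :=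
          lintegral_add_left (show Measurable fun y => ‖sc k ψ (x - y)‖ₑ * W y from
            hm2.mul hF.enorm) _
      _ ≤ ENNReal.ofReal (5 * D) * lam + ENNReal.ofReal (5 * D) * (3 * (2 * lam)) := by
          gcongr
          · exact (lintegral_sc_le h.bound k W x).trans (by gcongr; exact hV k x hx)
          · exact (lintegral_sc_le h.bound k (fun _ => 2 * (lam : ℝ≥0∞)) x).trans
              (by gcongr; exact mx_le_of_le (fun _ => le_rfl) k x)
      _ = _ := by
          rw [show 35 * D = 5 * D * 7 by ring, ENNReal.ofReal_mul (p := 5 * D) (by positivity),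
            ENNReal.ofReal_ofNat]
          ring
  have hT1 : ∑ k ∈ Finset.Icc k0 K, ∫⁻ x in V k, ‖cv k ψ F2 x‖ₑ ^ 2 ≤
      64 * ENNReal.ofReal D ^ 2 * lam ^ 2 * e2 (-k0) := by
    calc ∑ k ∈ Finset.Icc k0 K, ∫⁻ x in V k, ‖cv k ψ F2 x‖ₑ ^ 2
        ≤ ∑ k ∈ Finset.Icc k0 K,
            (16 * ENNReal.ofReal D ^ 2 * lam ^ 2 * e2 (-k0)) * e2 (-|k - k0|) := by
          refine Finset.sum_le_sum fun k hk => ?_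
          rw [Finset.mem_Icc] at hk
          have hpt : ∀ x ∈ V k, ‖cv k ψ F2 x‖ₑ ^ 2 ≤
              16 * ENNReal.ofReal D ^ 2 * lam ^ 2 * e2 (-|k - k0|) := by
            intro x hx
            have hxS : S = tri k0 x := (tri_congr (hVc k hx)).symm
            have hmxx : mx k0 W x = mx k0 W x0 := mx_congr (hVc k hx) W
            have : ‖cv k ψ F2 x‖ₑ ≤ ENNReal.ofReal (4 * D) * e2 (k0 - k) * lam := by
              calc ‖cv k ψ F2 x‖ₑ ≤ ∫⁻ y, ‖sc k ψ (x - y)‖ₑ * ‖F2 y‖ₑ := enorm_cv_le k ψ F2 x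
                _ = ∫⁻ y in (tri k0 x)ᶜ, ‖sc k ψ (x - y)‖ₑ * W y := by
                    rw [← lintegral_indicator (measurableSet_tri k0 x).compl, ← hxS]
                    congr 1; funext y
                    by_cases hy : y ∈ S <;> simp [hF2, hW, hy]
                _ ≤ ENNReal.ofReal (4 * D) * e2 (k0 - k) * mx k0 W x :=
                    lintegral_compl_tri_sc_le h.bound k0 k W x
                _ ≤ _ := by rw [hmxx]; gcongr
            have he : e2 (k0 - k) ≤ 1 := by
              rw [← e2_zero, e2, e2]
              exact ENNReal.ofReal_le_ofReal (zpow_le_zpow_right₀ one_le_two (by omega))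
            calc ‖cv k ψ F2 x‖ₑ ^ 2 ≤ (ENNReal.ofReal (4 * D) * e2 (k0 - k) * lam) ^ 2 := by gcongr
              _ = 16 * ENNReal.ofReal D ^ 2 * lam ^ 2 * (e2 (k0 - k) * e2 (k0 - k)) := by
                  rw [ENNReal.ofReal_mul (by norm_num), ENNReal.ofReal_ofNat]
                  ring
              _ ≤ 16 * ENNReal.ofReal D ^ 2 * lam ^ 2 * (e2 (k0 - k) * 1) := by gcongr
              _ = _ := by rw [mul_one, abs_of_nonneg (by omega), neg_sub]
          calc ∫⁻ x in V k, ‖cv k ψ F2 x‖ₑ ^ 2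
              ≤ ∫⁻ _ in V k, 16 * ENNReal.ofReal D ^ 2 * lam ^ 2 * e2 (-|k - k0|) :=
                setLIntegral_mono' (hVm k) hpt
            _ = 16 * ENNReal.ofReal D ^ 2 * lam ^ 2 * e2 (-|k - k0|) * volume (V k) :=
                setLIntegral_const _ _
            _ ≤ 16 * ENNReal.ofReal D ^ 2 * lam ^ 2 * e2 (-|k - k0|) * e2 (-k0) := by
                gcongr
                exact (measure_mono (hVc k)).trans (volume_cell k0 x0).le
            _ = _ := by ring
      _ ≤ (16 * ENNReal.ofReal D ^ 2 * lam ^ 2 * e2 (-k0)) * 4 := by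
          rw [← Finset.mul_sum]; gcongr; exact sum_e2_abs_le _ _
      _ = _ := by ring
  have hGsq : ∫⁻ y, ‖G y‖ₑ ^ 2 ≤ 12 * lam ^ 2 * e2 (-k0) := by
    calc ∫⁻ y, ‖G y‖ₑ ^ 2 ≤ ∫⁻ y, S.indicator (fun _ => 2 * (lam : ℝ≥0∞)) y * (2 * lam) := by
          gcongr with y
          rw [pow_two]
          exact mul_le_mul' (hGS y) (hG2 y)
      _ = 6 * lam * e2 (-k0) * (2 * lam) := by
          rw [lintegral_mul_const' _ _ (by finiteness), hSl]
      _ = _ := by ring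
  have hT2 : ∑ k ∈ Finset.Icc k0 K, ∫⁻ x in V k, ‖cv k ψ G x‖ₑ ^ 2 ≤
      12 * ENNReal.ofReal D ^ 2 * lam ^ 2 * e2 (-k0) := by
    have hGi : Integrable G := by
      refine ⟨hGm.aestronglyMeasurable, ?_⟩
      rw [HasFiniteIntegral]
      refine ((lintegral_mono hGS).trans hSl.le).trans_lt ?_
      finiteness [e2_ne_top (-k0)]
    have hGL2 : MemLp G 2 := by
      refine ⟨hGm.aestronglyMeasurable, ?_⟩
      rw [eLpNorm_lt_top_iff_lintegral_rpow_enorm_lt_top two_ne_zero (by norm_num)]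
      simp only [ENNReal.toReal_ofNat, ENNReal.rpow_ofNat]
      refine hGsq.trans_lt ?_
      finiteness [e2_ne_top (-k0)]
    calc ∑ k ∈ Finset.Icc k0 K, ∫⁻ x in V k, ‖cv k ψ G x‖ₑ ^ 2
        ≤ ∑ k ∈ Finset.Icc k0 K, ∫⁻ x, ‖cv k ψ G x‖ₑ ^ 2 :=
          Finset.sum_le_sum fun k _ => setLIntegral_le_lintegral _ _
      _ ≤ ENNReal.ofReal D ^ 2 * ∫⁻ x, ‖G x‖ₑ ^ 2 := h.sq G hGi hGL2 _
      _ ≤ ENNReal.ofReal D ^ 2 * (12 * lam ^ 2 * e2 (-k0)) := by gcongr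
      _ = _ := by ring
  have hT3 : ∑ k ∈ Finset.Icc k0 K, ∫⁻ x in V k, ‖cv k ψ Bf x‖ₑ ^ 2 ≤
      11760 * ENNReal.ofReal D ^ 2 * lam ^ 2 * e2 (-k0) := by
    calc ∑ k ∈ Finset.Icc k0 K, ∫⁻ x in V k, ‖cv k ψ Bf x‖ₑ ^ 2
        ≤ ∑ k ∈ Finset.Icc k0 K, ∑ j ∈ Finset.Icc k0 K, ENNReal.ofReal (35 * D) * lam *
            (ENNReal.ofReal (12 * D) * e2 (-|k - j|) * ∫⁻ y, ‖b j y‖ₑ) := by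
          refine Finset.sum_le_sum fun k hk => ?_
          calc ∫⁻ x in V k, ‖cv k ψ Bf x‖ₑ ^ 2
              ≤ ∫⁻ x in V k, ENNReal.ofReal (35 * D) * lam *
                  ∑ j ∈ Finset.Icc k0 K, ‖cv k ψ (b j) x‖ₑ := by
                refine setLIntegral_mono' (hVm k) fun x hx => ?_
                rw [pow_two]
                refine mul_le_mul' (hsup k x hx) ?_
                rw [hBfs]
                exact enorm_sum_le _ _
            _ = ENNReal.ofReal (35 * D) * lam *
                  ∑ j ∈ Finset.Icc k0 K, ∫⁻ x in V k, ‖cv k ψ (b j) x‖ₑ := by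
                rw [lintegral_const_mul' _ _ (by finiteness),
                  lintegral_finsetSum _ fun j _ => (measurable_cv h.cont (hbm j) k).enorm]
            _ ≤ _ := by
                rw [← Finset.mul_sum]
                gcongr with j hj
                exact hkj k hk j hj
      _ = ∑ j ∈ Finset.Icc k0 K, ENNReal.ofReal (35 * D) * lam * ENNReal.ofReal (12 * D) *
            (∫⁻ y, ‖b j y‖ₑ) * ∑ k ∈ Finset.Icc k0 K, e2 (-|k - j|) := by
          rw [Finset.sum_comm]
          refine Finset.sum_congr rfl fun j _ => ?_
          rw [Finset.mul_sum]
          refine Finset.sum_congr rfl fun k _ => ?_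
          ring
      _ ≤ ∑ j ∈ Finset.Icc k0 K, ENNReal.ofReal (35 * D) * lam * ENNReal.ofReal (12 * D) *
            (∫⁻ y, ‖b j y‖ₑ) * 4 := by
          gcongr
          exact sum_e2_abs_le _ _
      _ ≤ ENNReal.ofReal (35 * D) * lam * ENNReal.ofReal (12 * D) * (7 * lam * e2 (-k0)) * 4 := by
          rw [← Finset.sum_mul, ← Finset.mul_sum]
          gcongr
      _ = _ := by
          rw [ENNReal.ofReal_mul (by norm_num), ENNReal.ofReal_mul (by norm_num),
            ENNReal.ofReal_ofNat, ENNReal.ofReal_ofNat]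
          ring
  have hdec : ∀ k x, cv k ψ F x = cv k ψ F2 x + cv k ψ G x + cv k ψ Bf x := by
    intro k x
    have hGB : ∀ y, ‖G y‖ₑ ≤ (2 * lam : ℝ≥0) := by
      intro y; push_cast; exact hG2 y
    have hF2B : ∀ y, ‖F2 y‖ₑ ≤ B := fun y => (hF2W y).trans (hB y)
    have hFG : ∀ y, ‖F2 y + G y‖ₑ ≤ (B + 2 * lam : ℝ≥0) := by
      intro y
      push_cast
      exact (enorm_add_le _ _).trans (add_le_add (hF2B y) (hG2 y))
    rw [← cv_add h.cont h.bound k hF2m hGm hF2B hGB x,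
      ← cv_add (F := fun y => F2 y + G y) h.cont h.bound k (hF2m.add hGm) hBfm hFG hBfB x]
    congr 1
    funext y
    rw [add_assoc, ← hsum y, add_comm]
    exact (congrFun (indicator_self_add_compl S F) y).symm
  calc ∑ k ∈ Finset.Icc k0 K, ∫⁻ x in V k, ‖cv k ψ F x‖ₑ ^ 2
      ≤ ∑ k ∈ Finset.Icc k0 K, ∫⁻ x in V k, 9 * (‖cv k ψ F2 x‖ₑ ^ 2 + ‖cv k ψ G x‖ₑ ^ 2 +
          ‖cv k ψ Bf x‖ₑ ^ 2) := by
        gcongr with k hk x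
        rw [hdec k x]
        refine le_trans ?_ (add3_sq_le _ _ _)
        gcongr
        exact (enorm_add_le _ _).trans (add_le_add (enorm_add_le _ _) le_rfl)
    _ = 9 * ((∑ k ∈ Finset.Icc k0 K, ∫⁻ x in V k, ‖cv k ψ F2 x‖ₑ ^ 2) +
          (∑ k ∈ Finset.Icc k0 K, ∫⁻ x in V k, ‖cv k ψ G x‖ₑ ^ 2) +
          ∑ k ∈ Finset.Icc k0 K, ∫⁻ x in V k, ‖cv k ψ Bf x‖ₑ ^ 2) := by
        rw [← Finset.sum_add_distrib, ← Finset.sum_add_distrib, Finset.mul_sum]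
        refine Finset.sum_congr rfl fun k _ => ?_
        have m1 : Measurable fun x => ‖cv k ψ F2 x‖ₑ ^ 2 :=
          (measurable_cv h.cont hF2m k).enorm.pow_const 2
        have m2 : Measurable fun x => ‖cv k ψ G x‖ₑ ^ 2 :=
          (measurable_cv h.cont hGm k).enorm.pow_const 2
        have m3 : Measurable fun x => ‖cv k ψ F2 x‖ₑ ^ 2 + ‖cv k ψ G x‖ₑ ^ 2 := m1.add m2
        rw [lintegral_const_mul' _ _ (by norm_num), lintegral_add_left m3, lintegral_add_left m1]
    _ ≤ 9 * (64 * ENNReal.ofReal D ^ 2 * lam ^ 2 * e2 (-k0) +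
          12 * ENNReal.ofReal D ^ 2 * lam ^ 2 * e2 (-k0) +
          11760 * ENNReal.ofReal D ^ 2 * lam ^ 2 * e2 (-k0)) := by gcongr
    _ = 106524 * ENNReal.ofReal D ^ 2 * lam ^ 2 * e2 (-k0) := by ring
    _ ≤ _ := by gcongr; norm_num

lemma lintegral_biUnion_finset_le {ι : Type*} (s : Finset ι) (A : ι → Set ℝ) (f : ℝ → ℝ≥0∞) :
    ∫⁻ x in ⋃ i ∈ s, A i, f x ≤ ∑ i ∈ s, ∫⁻ x in A i, f x := by
  classical
  induction s using Finset.induction_on with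
  | empty => simp
  | insert i s hi ih =>
    rw [Finset.set_biUnion_insert, Finset.sum_insert hi]
    exact (lintegral_union_le _ _ _).trans (by gcongr)

/-- Global square function estimate, on sets where the maximal function is bounded. -/
lemma LPKer.global_sq {ψ : ℝ → ℂ} {D : ℝ} (h : LPKer ψ D) {F : ℝ → ℂ} (hF : Measurable F)
    {B : ℝ≥0} (hB : ∀ x, ‖F x‖ₑ ≤ B) (K0 K : ℤ) (lam : ℝ≥0) (U : ℤ → Set ℝ)
    (hUc : ∀ k x y, dq k y = dq k x → (y ∈ U k ↔ x ∈ U k))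
    (hU : ∀ k, ∀ x ∈ U k, mx k (fun y => ‖F y‖ₑ) x ≤ lam) {S : Set ℝ}
    (hS : ∀ k ∈ Finset.Icc K0 K, U k ⊆ S) :
    ∑ k ∈ Finset.Icc K0 K, ∫⁻ x in U k, ‖cv k ψ F x‖ₑ ^ 2 ≤
      120000 * ENNReal.ofReal D ^ 2 * lam ^ 2 * volume S := by
  classical
  have hdm : ∀ (j : ℤ) (A : Set ℝ), (∀ x y, dq j y = dq j x → (y ∈ A ↔ x ∈ A)) →
      MeasurableSet A := by
    intro j A hA
    have : Measurable (fun y => y ∈ A) :=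
      measurable_of_dq (j := j) fun x y hxy => propext (hA x y hxy)
    exact measurableSet_setOfPred.2 this
  have hUm : ∀ k, MeasurableSet (U k) := fun k => hdm k _ (hUc k)
  set V : ℤ → Set ℝ := fun j => {x | x ∈ U j ∧ ∀ i, K0 ≤ i → i < j → x ∉ U i} with hV
  have hVc : ∀ j x y, dq j y = dq j x → (y ∈ V j ↔ x ∈ V j) := by
    intro j x y hxy
    simp only [hV, mem_ofPred_eq]
    rw [hUc j x y hxy]
    refine and_congr Iff.rfl
      (forall_congr' fun i => forall_congr' fun _ => forall_congr' fun hi => ?_)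
    rw [hUc i x y (dq_eq_of_le hi.le hxy)]
  have hVm : ∀ j, MeasurableSet (V j) := fun j => hdm j _ (hVc j)
  have hVd : ((Finset.Icc K0 K : Finset ℤ) : Set ℤ).PairwiseDisjoint V := by
    intro i hi j hj hij
    rw [Function.onFun, Set.disjoint_left]
    intro x hxi hxj
    rw [Finset.mem_coe, Finset.mem_Icc] at hi hj
    rcases lt_or_gt_of_ne hij with hl | hl
    · exact hxj.2 i hi.1 hl hxi.1
    · exact hxi.2 j hj.1 hl hxj.1
  have hUV : ∀ k ∈ Finset.Icc K0 K, ∀ x ∈ U k, ∃ j ∈ Finset.Icc K0 k, x ∈ V j := by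
    intro k hk x hx
    rw [Finset.mem_Icc] at hk
    have hex : ∃ i : ℕ, x ∈ U (K0 + i) :=
      ⟨(k - K0).toNat, by rwa [show K0 + ((k - K0).toNat : ℤ) = k by omega]⟩
    have hle : Nat.find hex ≤ (k - K0).toNat :=
      Nat.find_min' hex (by rwa [show K0 + ((k - K0).toNat : ℤ) = k by omega])
    refine ⟨K0 + Nat.find hex, Finset.mem_Icc.2 ⟨by omega, by omega⟩, Nat.find_spec hex, ?_⟩
    intro i hi hi' hxi
    refine Nat.find_min hex (m := (i - K0).toNat) (by omega) ?_
    rwa [show K0 + ((i - K0).toNat : ℤ) = i by omega]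
  set Q : ℤ → ℤ → Set ℝ := fun j n => {x | dq j x = n} with hQ
  have hQm : ∀ j n, MeasurableSet (Q j n) := fun j n =>
    measurable_dq j (measurableSet_singleton n)
  have hQd : ∀ j, Pairwise (Function.onFun Disjoint (Q j)) := by
    intro j m n hmn
    rw [Function.onFun, Set.disjoint_left]
    intro y hy hy'
    simp only [hQ, mem_ofPred_eq] at hy hy'
    exact hmn (hy ▸ hy')
  have hloc : ∀ j ∈ Finset.Icc K0 K, ∀ n, ∑ k ∈ Finset.Icc j K,
      ∫⁻ x in U k ∩ (V j ∩ Q j n), ‖cv k ψ F x‖ₑ ^ 2 ≤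
        120000 * ENNReal.ofReal D ^ 2 * lam ^ 2 * volume (V j ∩ Q j n) := by
    intro j hj n
    rcases (V j ∩ Q j n).eq_empty_or_nonempty with he | ⟨x0, hx0⟩
    · simp [he]
    have hQc : Q j n = cell j x0 := by
      ext y
      have : dq j x0 = n := hx0.2
      simp [hQ, cell, this]
    have hVQ : V j ∩ Q j n = cell j x0 := by
      rw [hQc]
      refine inter_eq_right.2 fun y hy => (hVc j x0 y hy).2 hx0.1
    rw [hVQ, volume_cell]
    exact h.local_sq hF hB j K x0 lam (fun k => U k ∩ cell j x0)
      (fun k => (hUm k).inter (measurableSet_cell _ _)) (fun k => inter_subset_right)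
      (fun k x hx => hU k x hx.1) (hU j x0 hx0.1.1)
  calc ∑ k ∈ Finset.Icc K0 K, ∫⁻ x in U k, ‖cv k ψ F x‖ₑ ^ 2
      ≤ ∑ k ∈ Finset.Icc K0 K, ∑ j ∈ Finset.Icc K0 k, ∑' n,
          ∫⁻ x in U k ∩ (V j ∩ Q j n), ‖cv k ψ F x‖ₑ ^ 2 := by
        refine Finset.sum_le_sum fun k hk => ?_
        have e1 : U k ⊆ ⋃ j ∈ Finset.Icc K0 k, ⋃ n, U k ∩ (V j ∩ Q j n) := by
          intro x hx
          obtain ⟨j, hj, hxj⟩ := hUV k hk x hx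
          simp only [mem_iUnion]
          exact ⟨j, hj, dq j x, hx, hxj, rfl⟩
        refine (lintegral_mono_set e1).trans ?_
        refine (lintegral_biUnion_finset_le _ _ _).trans ?_
        exact Finset.sum_le_sum fun j _ => lintegral_iUnion_le _ _
    _ = ∑ j ∈ Finset.Icc K0 K, ∑ k ∈ Finset.Icc j K, ∑' n,
          ∫⁻ x in U k ∩ (V j ∩ Q j n), ‖cv k ψ F x‖ₑ ^ 2 := by
        refine Finset.sum_comm' fun k j => ?_
        simp only [Finset.mem_Icc]
        omega
    _ = ∑ j ∈ Finset.Icc K0 K, ∑' n, ∑ k ∈ Finset.Icc j K,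
          ∫⁻ x in U k ∩ (V j ∩ Q j n), ‖cv k ψ F x‖ₑ ^ 2 := by
        refine Finset.sum_congr rfl fun j _ => ?_
        rw [Summable.tsum_finsetSum fun _ _ => ENNReal.summable]
    _ ≤ ∑ j ∈ Finset.Icc K0 K, ∑' n,
          120000 * ENNReal.ofReal D ^ 2 * lam ^ 2 * volume (V j ∩ Q j n) := by
        refine Finset.sum_le_sum fun j hj => ENNReal.tsum_le_tsum fun n => hloc j hj n
    _ = 120000 * ENNReal.ofReal D ^ 2 * lam ^ 2 * ∑ j ∈ Finset.Icc K0 K, volume (V j) := by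
        rw [Finset.mul_sum]
        refine Finset.sum_congr rfl fun j _ => ?_
        rw [ENNReal.tsum_mul_left, ← measure_iUnion
          (fun m n hmn => ((hQd j hmn).mono inter_subset_right inter_subset_right))
          (fun n => (hVm j).inter (hQm j n))]
        congr 2
        rw [← inter_iUnion]
        refine inter_eq_left.2 fun x _ => mem_iUnion.2 ⟨dq j x, rfl⟩
    _ ≤ _ := by
        gcongr
        rw [← measure_biUnion_finset hVd fun j _ => hVm j]
        exact measure_mono (iUnion₂_subset fun j hj x hx => hS j hj hx.1)

lemma exists_e2_le {m : ℝ≥0∞} (h0 : m ≠ 0) (ht : m ≠ ∞) : ∃ a : ℤ, e2 a ≤ m ∧ m < e2 (a + 1) := by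
  obtain ⟨a, ha⟩ := ENNReal.exists_mem_Ico_zpow h0 ht (y := 2) (by norm_num) (by norm_num)
  have he : ∀ k : ℤ, e2 k = 2 ^ k := by
    intro k
    obtain ⟨n, rfl | rfl⟩ := k.eq_nat_or_neg
    · rw [e2, zpow_natCast, zpow_natCast, ENNReal.ofReal_pow (by norm_num), ENNReal.ofReal_ofNat]
    · rw [e2_neg_natCast, ENNReal.zpow_neg, zpow_natCast, ENNReal.inv_pow]
  refine ⟨a, ?_, ?_⟩ <;> rw [he]
  exacts [ha.1, ha.2]

/-- Sum of the powers of two below a given number. -/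
lemma tsum_e2_le (m : ℝ≥0∞) : ∑' a : ℤ, (if e2 a ≤ m then e2 a else 0) ≤ 4 * m := by
  rcases eq_or_ne m 0 with rfl | h0
  · simp [e2_ne_zero]
  rcases eq_or_ne m ∞ with rfl | ht
  · simp
  obtain ⟨A, hA, hA'⟩ := exists_e2_le h0 ht
  have hmono : ∀ a b : ℤ, e2 a < e2 b → a < b := by
    intro a b hab
    by_contra! hba
    exact absurd hab (not_lt.2 (ENNReal.ofReal_le_ofReal (zpow_le_zpow_right₀ one_le_two hba)))
  rw [ENNReal.tsum_eq_iSup_sum]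
  refine iSup_le fun s => ?_
  calc ∑ a ∈ s, (if e2 a ≤ m then e2 a else 0) ≤ ∑ a ∈ s, e2 A * e2 (-|a - A|) := by
        refine Finset.sum_le_sum fun a _ => ?_
        split_ifs with h
        · have := hmono a (A + 1) (h.trans_lt hA')
          rw [← e2_add, abs_of_nonpos (by omega)]
          apply le_of_eq
          congr 1
          ring
        · exact zero_le
    _ ≤ e2 A * 4 := by rw [← Finset.mul_sum]; gcongr; exact sum_e2_abs_le s A
    _ ≤ 4 * m := by rw [mul_comm]; gcongr

/-- The trilinear square function estimate. -/
lemma sum_lintegral_cv_mul_cv_le {ψ₁ ψ₂ : ℝ → ℂ} {D₁ D₂ : ℝ} (h₁ : LPKer ψ₁ D₁)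
    (h₂ : LPKer ψ₂ D₂) (hD₁ : 0 < D₁) (hD₂ : 0 < D₂) {F G : ℝ → ℂ} {w : ℝ → ℝ≥0∞}
    (hF : Measurable F) (hG : Measurable G) (hw : Measurable w) {B : ℝ≥0}
    (hFB : ∀ x, ‖F x‖ₑ ≤ B) (hGB : ∀ x, ‖G x‖ₑ ≤ B) (hwB : ∀ x, w x ≤ B)
    {D₃ : ℝ≥0∞} (hD₃ : D₃ ≠ ∞) {X : ℤ → ℝ → ℝ≥0∞} (hX : ∀ k x, X k x ≤ D₃ * mx k w x)
    (K0 K : ℤ) :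
    ∑ k ∈ Finset.Icc K0 K, ∫⁻ x, ‖cv k ψ₁ F x‖ₑ * ‖cv k ψ₂ G x‖ₑ * X k x ≤
      200000000 * (ENNReal.ofReal D₁ * ENNReal.ofReal D₂ * D₃) *
        ∫⁻ x, Mx (fun y => ‖F y‖ₑ) x * Mx (fun y => ‖G y‖ₑ) x * Mx w x := by
  classical
  set f : ℝ → ℝ≥0∞ := fun y => ‖F y‖ₑ with hf
  set g : ℝ → ℝ≥0∞ := fun y => ‖G y‖ₑ with hg
  have hfm : Measurable f := hF.enorm
  have hgm : Measurable g := hG.enorm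
  set E : ℤ → (ℝ → ℝ≥0∞) → ℤ → Set ℝ := fun k u a => {x | e2 a ≤ mx k u x ∧ mx k u x < e2 (a + 1)}
    with hE
  have hEm : ∀ k u a, Measurable u → MeasurableSet (E k u a) := fun k u a hu =>
    (measurableSet_le measurable_const (measurable_mx hu k)).inter
      (measurableSet_lt (measurable_mx hu k) measurable_const)
  have hEc : ∀ k u a x y, dq k y = dq k x → (y ∈ E k u a ↔ x ∈ E k u a) := by
    intro k u a x y hxy
    simp only [hE, mem_ofPred_eq, mx_congr hxy]
  set U : ℤ × ℤ × ℤ → ℤ → Set ℝ := fun i k => E k f i.1 ∩ (E k g i.2.1 ∩ E k w i.2.2) with hU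
  have hUm : ∀ i k, MeasurableSet (U i k) := fun i k =>
    (hEm k f _ hfm).inter ((hEm k g _ hgm).inter (hEm k w _ hw))
  have hUc : ∀ i k x y, dq k y = dq k x → (y ∈ U i k ↔ x ∈ U i k) := by
    intro i k x y hxy
    simp only [hU, mem_inter_iff, hEc k _ _ x y hxy]
  set S : ℤ × ℤ × ℤ → Set ℝ := fun i => {x | e2 i.1 ≤ Mx f x ∧ e2 i.2.1 ≤ Mx g x ∧ e2 i.2.2 ≤ Mx w x}
    with hS
  have hSm : ∀ i, MeasurableSet (S i) := fun i =>
    (measurableSet_le measurable_const (measurable_Mx hfm)).inter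
      ((measurableSet_le measurable_const (measurable_Mx hgm)).inter
        (measurableSet_le measurable_const (measurable_Mx hw)))
  have hUS : ∀ i k, U i k ⊆ S i := fun i k x hx =>
    ⟨hx.1.1.trans (mx_le_Mx k f x), hx.2.1.1.trans (mx_le_Mx k g x),
      hx.2.2.1.trans (mx_le_Mx k w x)⟩
  have he2 : ∀ a : ℤ, e2 (a + 1) = 2 * e2 a := by
    intro a
    rw [add_comm, e2_add]
    simp [e2]
  have hd₁ : ENNReal.ofReal D₁ ≠ 0 := by simpa using hD₁
  have hd₂ : ENNReal.ofReal D₂ ≠ 0 := by simpa using hD₂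
  have hlev : ∀ i : ℤ × ℤ × ℤ, ∑ k ∈ Finset.Icc K0 K,
      ∫⁻ x in U i k, ‖cv k ψ₁ F x‖ₑ * ‖cv k ψ₂ G x‖ₑ * X k x ≤
        1920000 * (ENNReal.ofReal D₁ * ENNReal.ofReal D₂ * D₃) *
          (e2 i.1 * e2 i.2.1 * e2 i.2.2 * volume (S i)) := by
    rintro ⟨a, b, c⟩
    have hcoe : ∀ a : ℤ, (((2 : ℝ) ^ (a + 1)).toNNReal : ℝ≥0∞) = 2 * e2 a := fun a => he2 a
    have s₁ := h₁.global_sq hF hFB K0 K ((2 : ℝ) ^ (a + 1)).toNNReal (U (a, b, c))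
      (hUc (a, b, c)) (fun k x hx => hx.1.2.le) (fun k _ => hUS (a, b, c) k)
    have s₂ := h₂.global_sq hG hGB K0 K ((2 : ℝ) ^ (b + 1)).toNNReal (U (a, b, c))
      (hUc (a, b, c)) (fun k x hx => hx.2.1.2.le) (fun k _ => hUS (a, b, c) k)
    rw [hcoe] at s₁ s₂
    set p := ENNReal.ofReal D₂ * e2 b with hp
    set q := ENNReal.ofReal D₁ * e2 a with hq
    have hpq0 : p * q ≠ 0 := mul_ne_zero (mul_ne_zero hd₂ (e2_ne_zero b)) (mul_ne_zero hd₁ (e2_ne_zero a))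
    have hpqt : p * q ≠ ∞ := by
      finiteness [e2_ne_top a, e2_ne_top b]
    have key : p * q * ∑ k ∈ Finset.Icc K0 K,
        ∫⁻ x in U (a, b, c) k, ‖cv k ψ₁ F x‖ₑ * ‖cv k ψ₂ G x‖ₑ ≤
          p * q * (960000 * (p * q) * volume (S (a, b, c))) := by
      calc p * q * ∑ k ∈ Finset.Icc K0 K,
            ∫⁻ x in U (a, b, c) k, ‖cv k ψ₁ F x‖ₑ * ‖cv k ψ₂ G x‖ₑ
          = ∑ k ∈ Finset.Icc K0 K,
            ∫⁻ x in U (a, b, c) k, (p * ‖cv k ψ₁ F x‖ₑ) * (q * ‖cv k ψ₂ G x‖ₑ) := by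
            rw [Finset.mul_sum]
            refine Finset.sum_congr rfl fun k _ => ?_
            rw [← lintegral_const_mul' _ _ hpqt]
            congr 1; funext x; ring
        _ ≤ ∑ k ∈ Finset.Icc K0 K, ∫⁻ x in U (a, b, c) k,
              (p ^ 2 * ‖cv k ψ₁ F x‖ₑ ^ 2 + q ^ 2 * ‖cv k ψ₂ G x‖ₑ ^ 2) := by
            gcongr with k _ x
            rw [← mul_pow, ← mul_pow]
            rcases le_total (p * ‖cv k ψ₁ F x‖ₑ) (q * ‖cv k ψ₂ G x‖ₑ) with hl | hl
            · refine le_trans ?_ le_add_self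
              rw [pow_two]; gcongr
            · refine le_trans ?_ le_self_add
              rw [pow_two]; gcongr
        _ = p ^ 2 * (∑ k ∈ Finset.Icc K0 K, ∫⁻ x in U (a, b, c) k, ‖cv k ψ₁ F x‖ₑ ^ 2) +
            q ^ 2 * ∑ k ∈ Finset.Icc K0 K, ∫⁻ x in U (a, b, c) k, ‖cv k ψ₂ G x‖ₑ ^ 2 := by
            rw [Finset.mul_sum, Finset.mul_sum, ← Finset.sum_add_distrib]
            refine Finset.sum_congr rfl fun k _ => ?_
            have m1 : Measurable fun x => p ^ 2 * ‖cv k ψ₁ F x‖ₑ ^ 2 :=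
              ((measurable_cv h₁.cont hF k).enorm.pow_const 2).const_mul _
            rw [lintegral_add_left m1, lintegral_const_mul' _ _ (by finiteness [e2_ne_top b]),
              lintegral_const_mul' _ _ (by finiteness [e2_ne_top a])]
        _ ≤ p ^ 2 * (120000 * ENNReal.ofReal D₁ ^ 2 * (2 * e2 a) ^ 2 * volume (S (a, b, c))) +
            q ^ 2 * (120000 * ENNReal.ofReal D₂ ^ 2 * (2 * e2 b) ^ 2 * volume (S (a, b, c))) := by
            gcongr
        _ = _ := by rw [hp, hq]; ring
    rw [ENNReal.mul_le_mul_iff_right hpq0 hpqt] at key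
    calc ∑ k ∈ Finset.Icc K0 K,
          ∫⁻ x in U (a, b, c) k, ‖cv k ψ₁ F x‖ₑ * ‖cv k ψ₂ G x‖ₑ * X k x
        ≤ ∑ k ∈ Finset.Icc K0 K,
          ∫⁻ x in U (a, b, c) k, ‖cv k ψ₁ F x‖ₑ * ‖cv k ψ₂ G x‖ₑ * (D₃ * (2 * e2 c)) := by
          refine Finset.sum_le_sum fun k _ => setLIntegral_mono' (hUm _ k) fun x hx => ?_
          gcongr
          refine (hX k x).trans ?_
          gcongr
          rw [← he2]
          exact hx.2.2.2.le
      _ = (∑ k ∈ Finset.Icc K0 K,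
          ∫⁻ x in U (a, b, c) k, ‖cv k ψ₁ F x‖ₑ * ‖cv k ψ₂ G x‖ₑ) * (D₃ * (2 * e2 c)) := by
          rw [Finset.sum_mul]
          refine Finset.sum_congr rfl fun k _ => ?_
          rw [lintegral_mul_const' _ _ (by finiteness [e2_ne_top c])]
      _ ≤ (960000 * (p * q) * volume (S (a, b, c))) * (D₃ * (2 * e2 c)) := by gcongr
      _ = _ := by rw [hp, hq]; ring
  have hcov : ∀ k x, ‖cv k ψ₁ F x‖ₑ * ‖cv k ψ₂ G x‖ₑ * X k x ≠ 0 → ∃ i, x ∈ U i k := by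
    intro k x hne
    have hft : ∀ u : ℝ → ℝ≥0∞, (∀ y, u y ≤ B) → mx k u x ≠ 0 → ∃ a, x ∈ E k u a := fun u hu h0 =>
      exists_e2_le h0 ((mx_le_of_le hu k x).trans_lt (by finiteness)).ne
    have n1 : mx k f x ≠ 0 := by
      intro h0
      have := enorm_cv_le_mx h₁.bound k F x
      rw [← hf, h0, mul_zero, nonpos_iff_eq_zero] at this
      simp [this] at hne
    have n2 : mx k g x ≠ 0 := by
      intro h0
      have := enorm_cv_le_mx h₂.bound k G x
      rw [← hg, h0, mul_zero, nonpos_iff_eq_zero] at this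
      simp [this] at hne
    have n3 : mx k w x ≠ 0 := by
      intro h0
      have := hX k x
      rw [h0, mul_zero, nonpos_iff_eq_zero] at this
      simp [this] at hne
    obtain ⟨a, ha⟩ := hft f hFB n1
    obtain ⟨b, hb⟩ := hft g hGB n2
    obtain ⟨c, hc⟩ := hft w hwB n3
    exact ⟨(a, b, c), ha, hb, hc⟩
  calc ∑ k ∈ Finset.Icc K0 K, ∫⁻ x, ‖cv k ψ₁ F x‖ₑ * ‖cv k ψ₂ G x‖ₑ * X k x
      ≤ ∑ k ∈ Finset.Icc K0 K, ∑' i, ∫⁻ x in U i k, ‖cv k ψ₁ F x‖ₑ * ‖cv k ψ₂ G x‖ₑ * X k x := by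
        refine Finset.sum_le_sum fun k _ => ?_
        have hUUm : MeasurableSet (⋃ i, U i k) := MeasurableSet.iUnion fun i => hUm i k
        rw [← lintegral_add_compl _ hUUm]
        have hz : ∫⁻ x in (⋃ i, U i k)ᶜ, ‖cv k ψ₁ F x‖ₑ * ‖cv k ψ₂ G x‖ₑ * X k x = 0 := by
          rw [setLIntegral_congr_fun (g := fun _ => 0) hUUm.compl, lintegral_zero]
          intro x hx
          by_contra hne
          exact hx (mem_iUnion.2 (hcov k x hne))
        rw [hz, add_zero]
        exact lintegral_iUnion_le _ _
    _ = ∑' i, ∑ k ∈ Finset.Icc K0 K, ∫⁻ x in U i k, ‖cv k ψ₁ F x‖ₑ * ‖cv k ψ₂ G x‖ₑ * X k x :=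
        (Summable.tsum_finsetSum fun _ _ => ENNReal.summable).symm
    _ ≤ ∑' i : ℤ × ℤ × ℤ, 1920000 * (ENNReal.ofReal D₁ * ENNReal.ofReal D₂ * D₃) *
          (e2 i.1 * e2 i.2.1 * e2 i.2.2 * volume (S i)) := ENNReal.tsum_le_tsum hlev
    _ = 1920000 * (ENNReal.ofReal D₁ * ENNReal.ofReal D₂ * D₃) *
          ∫⁻ x, (∑' a : ℤ, (if e2 a ≤ Mx f x then e2 a else 0)) *
            (∑' b : ℤ, (if e2 b ≤ Mx g x then e2 b else 0)) *
            ∑' c : ℤ, (if e2 c ≤ Mx w x then e2 c else 0) := by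
        rw [ENNReal.tsum_mul_left]
        congr 1
        have : ∀ x, (∑' a : ℤ, (if e2 a ≤ Mx f x then e2 a else 0)) *
            (∑' b : ℤ, (if e2 b ≤ Mx g x then e2 b else 0)) *
            ∑' c : ℤ, (if e2 c ≤ Mx w x then e2 c else 0) =
            ∑' i : ℤ × ℤ × ℤ, (S i).indicator (fun _ => e2 i.1 * e2 i.2.1 * e2 i.2.2) x := by
          intro x
          rw [ENNReal.tsum_prod', mul_assoc, ← ENNReal.tsum_mul_right]
          refine tsum_congr fun a => ?_
          rw [ENNReal.tsum_prod', ← ENNReal.tsum_mul_right, ← ENNReal.tsum_mul_left]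
          refine tsum_congr fun b => ?_
          rw [← ENNReal.tsum_mul_left, ← ENNReal.tsum_mul_left]
          refine tsum_congr fun c => ?_
          by_cases h1 : e2 a ≤ Mx f x <;> by_cases h2 : e2 b ≤ Mx g x <;>
            by_cases h3 : e2 c ≤ Mx w x <;> simp [h1, h2, h3, hS, indicator, mul_assoc]
        simp only [this]
        rw [lintegral_tsum fun i => (measurable_const.indicator (hSm i)).aemeasurable]
        refine tsum_congr fun i => ?_
        rw [lintegral_indicator (hSm i), setLIntegral_const]
    _ ≤ 1920000 * (ENNReal.ofReal D₁ * ENNReal.ofReal D₂ * D₃) *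
          ∫⁻ x, (4 * Mx f x) * (4 * Mx g x) * (4 * Mx w x) := by
        gcongr <;> exact tsum_e2_le _
    _ = 1920000 * (ENNReal.ofReal D₁ * ENNReal.ofReal D₂ * D₃) *
          (64 * ∫⁻ x, Mx f x * Mx g x * Mx w x) := by
        rw [← lintegral_const_mul' (64 : ℝ≥0∞) _ (by norm_num)]
        congr 2
        funext x
        ring
    _ = 122880000 * (ENNReal.ofReal D₁ * ENNReal.ofReal D₂ * D₃) *
          ∫⁻ x, Mx f x * Mx g x * Mx w x := by ring
    _ ≤ _ := by gcongr; norm_num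

/-! ### Weighted inequalities for the maximal function -/

lemma lintegral_mul_av {v u : ℝ → ℝ≥0∞} (hv : Measurable v) (hu : Measurable u) (k : ℤ) :
    ∫⁻ x, v x * av k u x = ∫⁻ y, u y * av k v y := by
  have hT : MeasurableSet {p : ℝ × ℝ | |dq k p.2 - dq k p.1| ≤ 1} := by
    have h1 : Measurable fun p : ℝ × ℝ => (dq k p.2, dq k p.1) :=
      ((measurable_dq k).comp measurable_snd).prodMk ((measurable_dq k).comp measurable_fst)
    exact h1 (MeasurableSet.of_discrete (s := {n : ℤ × ℤ | |n.1 - n.2| ≤ 1}))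
  have e : ∀ (v u : ℝ → ℝ≥0∞), Measurable u → ∀ x, v x * av k u x =
      ∫⁻ y, e2 k * {p : ℝ × ℝ | |dq k p.2 - dq k p.1| ≤ 1}.indicator
        (fun p => v p.1 * u p.2) (x, y) := by
    intro v u hu x
    rw [lintegral_const_mul' _ _ (e2_ne_top k), av, ← lintegral_indicator (measurableSet_tri k x),
      mul_left_comm, ← lintegral_const_mul _ (hu.indicator (measurableSet_tri k x))]
    congr 2
    funext y
    by_cases h : |dq k y - dq k x| ≤ 1 <;> simp [indicator, tri, h]
  simp only [e v u hu, e u v hv]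
  rw [lintegral_lintegral_swap]
  · refine lintegral_congr fun y => lintegral_congr fun x => ?_
    congr 1
    simp only [indicator, mem_ofPred_eq, abs_sub_comm (dq k y), mul_comm]
  · exact (((hv.comp measurable_fst).mul (hu.comp measurable_snd)).indicator hT).const_mul _
      |>.aemeasurable

/-- The average of `w` over dyadic intervals. -/
def ca (k : ℤ) (w : ℝ → ℝ≥0∞) (x : ℝ) : ℝ≥0∞ := e2 k * ∫⁻ y in cell k x, w y

lemma ca_congr {k : ℤ} {x y : ℝ} (h : dq k y = dq k x) (w : ℝ → ℝ≥0∞) : ca k w y = ca k w x := by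
  rw [ca, ca, cell_congr h]

lemma lintegral_mul_ca {v w : ℝ → ℝ≥0∞} (hw : Measurable w) (k : ℤ)
    (hv : ∀ x y, dq k y = dq k x → v y = v x) :
    ∫⁻ x, v x * ca k w x = ∫⁻ y, v y * w y := by
  have hvm : Measurable v := measurable_of_dq hv
  have hT : MeasurableSet {p : ℝ × ℝ | dq k p.2 = dq k p.1} := by
    have h1 : Measurable fun p : ℝ × ℝ => (dq k p.2, dq k p.1) :=
      ((measurable_dq k).comp measurable_snd).prodMk ((measurable_dq k).comp measurable_fst)
    exact h1 (MeasurableSet.of_discrete (s := {n : ℤ × ℤ | n.1 = n.2}))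
  have e : ∀ x, v x * ca k w x =
      ∫⁻ y, e2 k * {p : ℝ × ℝ | dq k p.2 = dq k p.1}.indicator
        (fun p => v p.1 * w p.2) (x, y) := by
    intro x
    rw [lintegral_const_mul' _ _ (e2_ne_top k), ca, ← lintegral_indicator (measurableSet_cell k x),
      mul_left_comm, ← lintegral_const_mul _ (hw.indicator (measurableSet_cell k x))]
    congr 2
    funext y
    by_cases h : dq k y = dq k x <;> simp [indicator, cell, h]
  simp only [e]
  rw [lintegral_lintegral_swap]
  · refine lintegral_congr fun y => ?_
    rw [lintegral_const_mul' _ _ (e2_ne_top k)]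
    have : ∀ x, {p : ℝ × ℝ | dq k p.2 = dq k p.1}.indicator (fun p => v p.1 * w p.2) (x, y) =
        (cell k y).indicator (fun _ => v y * w y) x := by
      intro x
      by_cases h : dq k y = dq k x
      · simp [indicator, cell, h, hv x y h]
      · simp [indicator, cell, h, show ¬ dq k x = dq k y from fun h' => h h'.symm]
    simp only [this]
    rw [lintegral_indicator (measurableSet_cell k y), setLIntegral_const, volume_cell, mul_left_comm,
      e2_mul_neg, mul_one]
  · exact (((hvm.comp measurable_fst).mul (hw.comp measurable_snd)).indicator hT).const_mul _
      |>.aemeasurable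

lemma exists_ca_of_av {k : ℤ} {w : ℝ → ℝ≥0∞} {x : ℝ} {l : ℝ≥0∞} (h : 3 * l < av k w x) :
    ∃ y ∈ tri k x, l < ca k w y := by
  by_contra! hc
  have hlr : ∀ n : ℤ, |n - dq k x| ≤ 1 → e2 k * ∫⁻ y in {y | dq k y = n}, w y ≤ l := by
    intro n hn
    have h1 : dq k ((n : ℝ) * 2 ^ (-k)) = n := by
      have : (2 : ℝ) ^ k * ((n : ℝ) * 2 ^ (-k)) = n := by
        rw [zpow_neg]; field_simp
      rw [dq, this, Int.floor_intCast]
    have := hc ((n : ℝ) * 2 ^ (-k)) (by simpa only [tri, mem_ofPred_eq, h1])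
    rwa [ca, cell, h1] at this
  refine absurd h (not_lt.2 ?_)
  have hsub : tri k x ⊆ ({y | dq k y = dq k x - 1} ∪ {y | dq k y = dq k x}) ∪
      {y | dq k y = dq k x + 1} := by
    intro y hy
    simp only [tri, mem_ofPred_eq, abs_le] at hy
    simp only [mem_union, mem_ofPred_eq]
    omega
  calc av k w x ≤ e2 k * ((∫⁻ y in {y | dq k y = dq k x - 1}, w y) +
        (∫⁻ y in {y | dq k y = dq k x}, w y) + ∫⁻ y in {y | dq k y = dq k x + 1}, w y) := by
        rw [av]
        gcongr
        refine (lintegral_mono_set hsub).trans ((lintegral_union_le _ _ _).trans ?_)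
        gcongr
        exact lintegral_union_le _ _ _
    _ ≤ l + l + l := by
        rw [mul_add, mul_add]
        gcongr <;> refine hlr _ ?_ <;> simp
    _ = 3 * l := by ring

/-- The weighted weak-type inequality for the maximal function. -/
lemma weak_type {v w : ℝ → ℝ≥0∞} (hv : Measurable v) (hw : Measurable w) {l : ℝ≥0∞} (hl' : l ≠ ∞) :
    l * ∫⁻ x in {x | 3 * l < Mx w x}, v x ≤ ∫⁻ x, w x * Mx v x := by
  classical
  -- truncation of the scales
  set A : ℕ → Set ℝ := fun N => {x | ∃ k : ℤ, -(N : ℤ) ≤ k ∧ 3 * l < av k w x} with hA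
  have hAm : ∀ N, MeasurableSet (A N) := by
    intro N
    have : A N = ⋃ k : ℤ, ⋃ _ : -(N : ℤ) ≤ k, {x | 3 * l < av k w x} := by
      ext x; simp [hA]
    rw [this]
    exact MeasurableSet.iUnion fun k => MeasurableSet.iUnion fun _ =>
      measurableSet_lt measurable_const (measurable_av hw k)
  have hmono : Monotone A := by
    rintro m n hmn x ⟨k, hk, h⟩
    exact ⟨k, by omega, h⟩
  have hU : {x | 3 * l < Mx w x} = ⋃ N, A N := by
    ext x
    simp only [mem_ofPred_eq, Mx, lt_iSup_iff, mem_iUnion, hA]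
    constructor
    · rintro ⟨k, hk⟩
      exact ⟨k.natAbs, k, by omega, hk⟩
    · rintro ⟨N, k, _, hk⟩
      exact ⟨k, hk⟩
  rw [hU, setLIntegral_iUnion_of_directed _ hmono.directed_le, ENNReal.mul_iSup]
  refine iSup_le fun N => ?_
  -- stopping intervals
  set S : ℤ → Set ℝ := fun k => {y | -(N : ℤ) ≤ k ∧ l < ca k w y ∧
    ∀ j, -(N : ℤ) ≤ j → j < k → ca j w y ≤ l} with hS
  have hSdq : ∀ k x y, dq k y = dq k x → x ∈ S k → y ∈ S k := by
    rintro k x y h ⟨h1, h2, h3⟩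
    refine ⟨h1, by rwa [ca_congr h], fun j hj hjk => ?_⟩
    rw [ca_congr (dq_eq_of_le hjk.le h)]
    exact h3 j hj hjk
  have hSdisj : ∀ y i k, y ∈ S i → y ∈ S k → i = k := by
    rintro y i k ⟨h1, h2, h3⟩ ⟨h1', h2', h3'⟩
    by_contra hne
    rcases lt_or_gt_of_ne hne with h | h
    · exact absurd h2 (not_lt.2 (h3' i h1 h))
    · exact absurd h2' (not_lt.2 (h3 k h1' h))
  have hSind : ∀ k x y, dq k y = dq k x →
      (S k).indicator (1 : ℝ → ℝ≥0∞) y = (S k).indicator 1 x := by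
    intro k x y h
    by_cases hx : x ∈ S k
    · rw [indicator_of_mem hx, indicator_of_mem (hSdq k x y h hx), Pi.one_apply, Pi.one_apply]
    · rw [indicator_of_notMem hx, indicator_of_notMem fun hy => hx (hSdq k y x h.symm hy)]
  have hSm : ∀ k, Measurable ((S k).indicator (1 : ℝ → ℝ≥0∞)) := fun k =>
    measurable_of_dq (hSind k)
  have hcov : ∀ x ∈ A N, 1 ≤ ∑' k, av k ((S k).indicator 1) x := by
    rintro x ⟨k₀, hk₀, h⟩
    obtain ⟨y, hy, hly⟩ := exists_ca_of_av h
    have hex : ∃ i : ℕ, l < ca (-(N : ℤ) + i) w y :=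
      ⟨(k₀ + N).toNat, by rwa [show -(N : ℤ) + ((k₀ + N).toNat : ℤ) = k₀ by omega]⟩
    set k : ℤ := -(N : ℤ) + (Nat.find hex : ℕ) with hk
    have hyS : y ∈ S k := by
      refine ⟨by omega, Nat.find_spec hex, fun j hj hjk => ?_⟩
      have := Nat.find_min hex (m := (j + N).toNat) (by omega)
      rw [show -(N : ℤ) + ((j + N).toNat : ℤ) = j by omega] at this
      exact not_lt.1 this
    have hkk : k ≤ k₀ := by
      have := Nat.find_min' hex (m := (k₀ + N).toNat)
        (by rwa [show -(N : ℤ) + ((k₀ + N).toNat : ℤ) = k₀ by omega])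
      omega
    have hcell : cell k y ⊆ tri k x := by
      intro z hz
      have := tri_subset_of_le hkk x hy
      simp only [tri, cell, mem_ofPred_eq] at this hz ⊢
      rwa [hz]
    refine le_trans ?_ (ENNReal.le_tsum k)
    calc 1 = e2 k * ∫⁻ _ in cell k y, 1 := by
          rw [setLIntegral_const, one_mul, volume_cell, e2_mul_neg]
      _ = e2 k * ∫⁻ z in cell k y, (S k).indicator 1 z := by
          congr 1
          refine setLIntegral_congr_fun (measurableSet_cell k y) fun z hz => ?_
          rw [indicator_of_mem (hSdq k y z hz hyS), Pi.one_apply]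
      _ ≤ av k ((S k).indicator 1) x := by
          rw [av]
          gcongr
  calc l * ∫⁻ x in A N, v x ≤ l * ∫⁻ x in A N, v x * ∑' k, av k ((S k).indicator 1) x := by
        gcongr 1
        refine setLIntegral_mono' (hAm N) fun x hx => ?_
        exact le_mul_of_one_le_right zero_le (hcov x hx)
    _ ≤ l * ∫⁻ x, v x * ∑' k, av k ((S k).indicator 1) x := by
        gcongr 1
        exact setLIntegral_le_lintegral _ _
    _ = ∑' k, l * ∫⁻ x, (S k).indicator 1 x * av k v x := by
        rw [ENNReal.tsum_mul_left]
        congr 1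
        simp only [← ENNReal.tsum_mul_left]
        rw [lintegral_tsum (f := fun k x => v x * av k ((S k).indicator 1) x)
          fun k => (hv.mul (measurable_av (hSm k) k)).aemeasurable]
        exact tsum_congr fun k => lintegral_mul_av hv (hSm k) k
    _ ≤ ∑' k, ∫⁻ x, (S k).indicator 1 x * (w x * Mx v x) := by
        refine ENNReal.tsum_le_tsum fun k => ?_
        calc l * ∫⁻ x, (S k).indicator 1 x * av k v x
            = ∫⁻ x, l * ((S k).indicator 1 x * av k v x) := (lintegral_const_mul' _ _ hl').symm
          _ ≤ ∫⁻ x, ((S k).indicator 1 x * av k v x) * ca k w x := by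
              refine lintegral_mono fun x => ?_
              by_cases hx : x ∈ S k
              · rw [mul_comm l]
                gcongr
                exact hx.2.1.le
              · simp [hx]
          _ = ∫⁻ x, ((S k).indicator 1 x * av k v x) * w x :=
              lintegral_mul_ca hw k fun x y h => by rw [hSind k x y h, av_congr h]
          _ ≤ _ := by
              refine lintegral_mono fun x => ?_
              rw [mul_assoc, mul_comm (w x)]
              gcongr
              exact le_iSup (fun k => av k v x) k
    _ = ∫⁻ x, ∑' k, (S k).indicator 1 x * (w x * Mx v x) := by
        rw [lintegral_tsum (f := fun k x => (S k).indicator 1 x * (w x * Mx v x)) fun k =>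
          ((hSm k).mul (hw.mul (measurable_Mx hv))).aemeasurable]
    _ ≤ ∫⁻ x, w x * Mx v x := by
        gcongr with x
        rw [ENNReal.tsum_mul_right]
        refine mul_le_of_le_one_left zero_le ?_
        by_cases hx : ∃ k, x ∈ S k
        · obtain ⟨k, hk⟩ := hx
          rw [tsum_eq_single k fun j hj => indicator_of_notMem (fun h => hj (hSdisj x j k h hk)) _]
          exact indicator_le_self' (fun _ _ => zero_le) x
        · push Not at hx
          simp [hx]

lemma e2_eq_zpow (k : ℤ) : e2 k = 2 ^ k := by
  obtain ⟨n, rfl | rfl⟩ := k.eq_nat_or_neg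
  · rw [e2, zpow_natCast, zpow_natCast, ENNReal.ofReal_pow (by norm_num), ENNReal.ofReal_ofNat]
  · rw [e2_neg_natCast, ENNReal.zpow_neg, zpow_natCast, ENNReal.inv_pow]

lemma tsum_e2_rpow_le {s : ℝ} (hs : 0 < s) : ∃ C : ℝ≥0∞, C ≠ ∞ ∧ ∀ m : ℝ≥0∞,
    ∑' a : ℤ, (if e2 a < m then e2 a ^ s else 0) ≤ C * m ^ s := by
  have hlt : (2 : ℝ≥0∞)⁻¹ ^ s < 1 := by
    refine ENNReal.rpow_lt_one ?_ hs
    rw [ENNReal.inv_lt_one]; norm_num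
  refine ⟨(1 - (2 : ℝ≥0∞)⁻¹ ^ s)⁻¹, ?_, fun m => ?_⟩
  · rw [ENNReal.inv_ne_top]
    exact (tsub_pos_of_lt hlt).ne'
  rcases eq_or_ne m 0 with rfl | h0
  · simp
  rcases eq_or_ne m ∞ with rfl | ht
  · rw [ENNReal.top_rpow_of_pos hs, ENNReal.mul_top]
    · exact le_top
    · rw [ENNReal.inv_ne_zero]
      exact ne_top_of_le_ne_top ENNReal.one_ne_top tsub_le_self
  obtain ⟨A, hA, hA'⟩ := exists_e2_le h0 ht
  rw [← (Equiv.subLeft A).tsum_eq]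
  simp only [Equiv.subLeft_apply]
  have hinj : Function.Injective ((↑) : ℕ → ℤ) := Nat.cast_injective
  rw [← hinj.tsum_eq]
  · calc ∑' n : ℕ, (if e2 (A - n) < m then e2 (A - n) ^ s else 0)
        ≤ ∑' n : ℕ, e2 A ^ s * ((2 : ℝ≥0∞)⁻¹ ^ s) ^ n := by
          refine ENNReal.tsum_le_tsum fun n => ?_
          split_ifs
          · rw [sub_eq_add_neg, e2_add, e2_neg_natCast, ENNReal.mul_rpow_of_nonneg _ _ hs.le,
              ← ENNReal.rpow_natCast_mul, ← ENNReal.rpow_mul_natCast, mul_comm s]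
          · exact zero_le
      _ = (1 - (2 : ℝ≥0∞)⁻¹ ^ s)⁻¹ * e2 A ^ s := by
          rw [ENNReal.tsum_mul_left, ENNReal.tsum_geometric, mul_comm]
      _ ≤ _ := by gcongr
  · intro b hb
    by_contra hn
    refine hb ?_
    have hb0 : b < 0 := by
      by_contra! h
      exact hn ⟨b.toNat, by simp [h]⟩
    refine if_neg ?_
    rw [not_lt]
    refine hA'.le.trans (ENNReal.ofReal_le_ofReal (zpow_le_zpow_right₀ one_le_two (by omega)))

lemma rpow_le_tsum_e2 {q : ℝ} (hq : 0 < q) (m : ℝ≥0∞) :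
    m ^ q ≤ 24 ^ q * ∑' a : ℤ, (if 6 * e2 a < m then e2 a ^ q else 0) := by
  rcases eq_or_ne m 0 with rfl | h0
  · simp [hq]
  rcases eq_or_ne m ∞ with rfl | ht
  · have : ∑' a : ℤ, (if 6 * e2 a < ∞ then e2 a ^ q else 0) = ∞ := by
      rw [eq_top_iff]
      calc (∞ : ℝ≥0∞) = ∑' _ : ℕ, 1 := (ENNReal.tsum_const_eq_top_of_ne_zero one_ne_zero).symm
        _ ≤ ∑' n : ℕ, (if 6 * e2 n < ∞ then e2 n ^ q else 0) := by
            refine ENNReal.tsum_le_tsum fun n => ?_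
            rw [if_pos (by finiteness [e2_ne_top n])]
            refine ENNReal.one_le_rpow ?_ hq
            rw [e2_eq_zpow, zpow_natCast]
            exact one_le_pow₀ one_le_two
        _ ≤ _ := ENNReal.tsum_comp_le_tsum_of_injective (f := ((↑) : ℕ → ℤ)) Nat.cast_injective
            fun a : ℤ => if 6 * e2 a < ∞ then e2 a ^ q else 0
    rw [this, ENNReal.mul_top]
    · exact le_top
    · exact (ENNReal.rpow_pos (by norm_num) (by norm_num)).ne'
  obtain ⟨A, hA, hA'⟩ := exists_e2_le (m := m / 12) (by simp [h0]) (by finiteness)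
  refine le_trans ?_ (mul_le_mul_right (ENNReal.le_tsum A) _)
  rw [ENNReal.le_div_iff_mul_le (by norm_num) (by norm_num)] at hA
  rw [ENNReal.div_lt_iff (by norm_num) (by norm_num), e2_add, e2_eq_zpow 1, zpow_one] at hA'
  rw [if_pos, ← ENNReal.mul_rpow_of_nonneg _ _ hq.le]
  · gcongr
    refine hA'.le.trans_eq ?_
    rw [mul_assoc, mul_comm]; norm_num
  · refine lt_of_lt_of_le ?_ hA
    rw [mul_comm]
    exact ENNReal.mul_lt_mul_right (e2_ne_zero A) (e2_ne_top A) (by norm_num)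

lemma Mx_indicator_of_lt {w : ℝ → ℝ≥0∞} {l : ℝ≥0∞} {x : ℝ} (hw : Measurable w)
    (h : 6 * l < Mx w x) :
    3 * l < Mx ({y | l < w y}.indicator w) x := by
  obtain ⟨k, hk⟩ := lt_iSup_iff.1 h
  refine lt_of_not_ge fun hle => absurd hk (not_lt.2 ?_)
  calc av k w x ≤ e2 k * ∫⁻ y in tri k x, ({y | l < w y}.indicator w y + l) := by
        rw [av]
        gcongr with y
        by_cases hy : l < w y
        · simp [hy]
        · simpa [hy] using not_lt.1 hy
    _ = av k ({y | l < w y}.indicator w) x + 3 * l := by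
        rw [lintegral_add_left (hw.indicator (measurableSet_lt measurable_const hw)),
          setLIntegral_const, volume_tri, mul_add, av]
        congr 1
        calc e2 k * (l * (3 * e2 (-k))) = (e2 k * e2 (-k)) * (3 * l) := by ring
          _ = _ := by rw [e2_mul_neg, one_mul]
    _ ≤ 3 * l + 3 * l := by
        gcongr
        exact (le_iSup (fun k => av k _ x) k).trans hle
    _ = 6 * l := by ring

/-- The weighted strong-type inequality for the maximal function. -/
lemma strong_type {q : ℝ} (hq : 1 < q) : ∃ C : ℝ≥0∞, C ≠ ∞ ∧ ∀ v w : ℝ → ℝ≥0∞,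
    Measurable v → Measurable w → ∫⁻ x, Mx w x ^ q * v x ≤ C * ∫⁻ x, w x ^ q * Mx v x := by
  have hq0 : 0 < q := by linarith
  obtain ⟨C, hC, hsum⟩ := tsum_e2_rpow_le (s := q - 1) (by linarith)
  refine ⟨24 ^ q * C, by finiteness, fun v w hv hw => ?_⟩
  have hMw := measurable_Mx hw
  have hms : ∀ a : ℤ, MeasurableSet {x | 6 * e2 a < Mx w x} := fun a =>
    measurableSet_lt measurable_const hMw
  have hmw : ∀ a : ℤ, MeasurableSet {x | e2 a < w x} := fun a =>
    measurableSet_lt measurable_const hw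
  calc ∫⁻ x, Mx w x ^ q * v x
      ≤ ∫⁻ x, 24 ^ q * ∑' a : ℤ, {x | 6 * e2 a < Mx w x}.indicator (fun x => e2 a ^ q * v x) x := by
        refine lintegral_mono fun x => ?_
        refine (mul_le_mul_left (rpow_le_tsum_e2 hq0 _) _).trans_eq ?_
        rw [mul_assoc, ← ENNReal.tsum_mul_right]
        congr 1
        refine tsum_congr fun a => ?_
        by_cases h : 6 * e2 a < Mx w x <;> simp [h]
    _ = 24 ^ q * ∑' a : ℤ, e2 a ^ q * ∫⁻ x in {x | 6 * e2 a < Mx w x}, v x := by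
        rw [lintegral_const_mul' _ _ (by finiteness), lintegral_tsum fun a =>
          ((hv.const_mul _).indicator (hms a)).aemeasurable]
        congr 1
        refine tsum_congr fun a => ?_
        rw [lintegral_indicator (hms a), lintegral_const_mul _ hv]
    _ ≤ 24 ^ q * ∑' a : ℤ, e2 a ^ (q - 1) *
          ∫⁻ x, {x | e2 a < w x}.indicator w x * Mx v x := by
        refine mul_le_mul_right (ENNReal.tsum_le_tsum fun a => ?_) _
        calc e2 a ^ q * ∫⁻ x in {x | 6 * e2 a < Mx w x}, v x
            ≤ e2 a ^ q * ∫⁻ x in {x | 3 * e2 a < Mx ({x | e2 a < w x}.indicator w) x}, v x := by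
              gcongr 1
              exact lintegral_mono_set fun x hx => Mx_indicator_of_lt hw hx
          _ = e2 a ^ (q - 1) * (e2 a *
                ∫⁻ x in {x | 3 * e2 a < Mx ({x | e2 a < w x}.indicator w) x}, v x) := by
              rw [← mul_assoc]
              congr 1
              conv_rhs => rw [← ENNReal.rpow_one (e2 a), ← ENNReal.rpow_mul, one_mul,
                ← ENNReal.rpow_add _ _ (e2_ne_zero a) (e2_ne_top a)]
              congr 1; ring
          _ ≤ _ := by
              gcongr
              exact weak_type hv (hw.indicator (hmw a)) (e2_ne_top a)
    _ = 24 ^ q * ∫⁻ x, (∑' a : ℤ, (if e2 a < w x then e2 a ^ (q - 1) else 0)) * w x * Mx v x := by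
        congr 1
        have : ∀ x, (∑' a : ℤ, (if e2 a < w x then e2 a ^ (q - 1) else 0)) * w x * Mx v x =
            ∑' a : ℤ, e2 a ^ (q - 1) * ({x | e2 a < w x}.indicator w x * Mx v x) := by
          intro x
          rw [mul_assoc, ← ENNReal.tsum_mul_right]
          refine tsum_congr fun a => ?_
          by_cases h : e2 a < w x <;> simp [h]
        simp only [this]
        rw [lintegral_tsum (f := fun a x => e2 a ^ (q - 1) *
          ({x | e2 a < w x}.indicator w x * Mx v x)) fun a =>
          (((hw.indicator (hmw a)).mul (measurable_Mx hv)).const_mul _).aemeasurable]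
        refine tsum_congr fun a => ?_
        rw [lintegral_const_mul' _ _ (by finiteness [e2_ne_top a, e2_ne_zero a])]
    _ ≤ 24 ^ q * ∫⁻ x, C * (w x ^ q * Mx v x) := by
        refine mul_le_mul_right (lintegral_mono fun x => ?_) _
        rw [← mul_assoc]
        refine mul_le_mul_left ?_ _
        refine (mul_le_mul_left (hsum _) _).trans_eq ?_
        rw [mul_assoc]
        congr 1
        conv_lhs => rw [← ENNReal.rpow_one (w x), ← ENNReal.rpow_mul, one_mul,
          ← ENNReal.rpow_add_of_nonneg _ _ (by linarith) (by linarith)]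
        congr 1; ring
    _ = _ := by rw [lintegral_const_mul' _ _ hC, mul_assoc]

lemma Mx_one_le (x : ℝ) : Mx (fun _ => 1) x ≤ 3 :=
  iSup_le fun k => (av_le_of_le (fun _ => le_rfl) k x).trans_eq (mul_one _)

lemma lintegral_Mx_rpow_le {q : ℝ} (hq : 1 < q) : ∃ C : ℝ≥0∞, C ≠ ∞ ∧ ∀ w : ℝ → ℝ≥0∞,
    Measurable w → ∫⁻ x, Mx w x ^ q ≤ C * ∫⁻ x, w x ^ q := by
  obtain ⟨C, hC, h⟩ := strong_type hq
  refine ⟨C * 3, by finiteness, fun w hw => ?_⟩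
  have := h (fun _ => 1) w measurable_const hw
  simp only [mul_one] at this
  refine this.trans ?_
  rw [mul_assoc, ← lintegral_const_mul' (3 : ℝ≥0∞) _ (by norm_num)]
  refine mul_le_mul_right (lintegral_mono fun x => ?_) _
  rw [mul_comm]
  exact mul_le_mul_left (Mx_one_le x) _

/-! ### The Fefferman–Stein inequality in mixed norms -/

lemma le_rpow_of_le_mul_rpow {A K : ℝ≥0∞} {r r' : ℝ} (h : r.HolderConjugate r') (hA : A ≠ ∞)
    (hAK : A ≤ K * A ^ (1 / r')) : A ≤ K ^ r := by
  rcases eq_or_ne A 0 with rfl | h0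
  · exact zero_le
  have h1 : A ^ (1 / r) * A ^ (1 / r') = A := by
    rw [← ENNReal.rpow_add _ _ h0 hA, one_div, one_div, h.inv_add_inv_eq_one, ENNReal.rpow_one]
  have hp : A ^ (1 / r') ≠ 0 := (ENNReal.rpow_pos (pos_iff_ne_zero.2 h0) hA).ne'
  have ht : A ^ (1 / r') ≠ ∞ := ENNReal.rpow_ne_top_of_nonneg (by
    rw [one_div]; exact (inv_pos.2 h.symm.pos).le) hA
  have h2 : A ^ (1 / r) ≤ K := by
    rw [← ENNReal.mul_le_mul_iff_left hp ht, h1]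
    exact hAK
  calc A = (A ^ (1 / r)) ^ r := by
        rw [← ENNReal.rpow_mul, one_div, inv_mul_cancel₀ h.pos.ne', ENNReal.rpow_one]
    _ ≤ K ^ r := ENNReal.rpow_le_rpow h2 h.pos.le

lemma exists_measurable_lt_lintegral {f : ℝ → ℝ≥0∞} {L : ℝ≥0∞} (hL : L < ∫⁻ x, f x) :
    ∃ g : ℝ → ℝ≥0∞, Measurable g ∧ (∀ x, g x ≤ f x) ∧ ∫⁻ x, g x ≠ ∞ ∧ L < ∫⁻ x, g x := by
  simp_rw [lintegral_eq_nnreal, lt_iSup_iff] at hL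
  obtain ⟨g₀, hg₀, hL⟩ := hL
  have hL' : L < ∫⁻ x, (g₀ x : ℝ≥0∞) := by
    rwa [← SimpleFunc.lintegral_eq_lintegral, SimpleFunc.coe_map] at hL
  obtain ⟨g, hg, hgt, hlt⟩ := SimpleFunc.exists_lt_lintegral_simpleFunc_of_lt_lintegral hL'
  exact ⟨fun x => g x, g.measurable.coe_nnreal_ennreal,
    fun x => (ENNReal.coe_le_coe.2 (hg x)).trans (hg₀ x), hgt.ne, hlt⟩

lemma measurable_slice_right {w : ℝ → ℝ → ℝ≥0∞} (hw : Measurable fun z : ℝ × ℝ => w z.1 z.2)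
    (x : ℝ) : Measurable (w x) := by
  have := Measurable.comp (g := fun z : ℝ × ℝ => w z.1 z.2) hw
    (measurable_const.prodMk measurable_id : Measurable fun t : ℝ => (x, t))
  simpa only [Function.comp_def] using this

lemma measurable_slice_left {w : ℝ → ℝ → ℝ≥0∞} (hw : Measurable fun z : ℝ × ℝ => w z.1 z.2)
    (t : ℝ) : Measurable fun x => w x t := by
  have := Measurable.comp (g := fun z : ℝ × ℝ => w z.1 z.2) hw
    (measurable_id.prodMk measurable_const : Measurable fun x : ℝ => (x, t))
  simpa only [Function.comp_def, id] using this

lemma mixed_Mx_of_lt {p q : ℝ} (hq : 1 < q) (hqp : q < p) : ∃ C : ℝ≥0∞, C ≠ ∞ ∧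
    ∀ (μ : Measure ℝ) [SFinite μ] (w : ℝ → ℝ → ℝ≥0∞), Measurable (fun z : ℝ × ℝ => w z.1 z.2) →
      ∫⁻ x, (∫⁻ t, Mx (fun y => w y t) x ^ q ∂μ) ^ (p / q) ≤
        C * ∫⁻ x, (∫⁻ t, w x t ^ q ∂μ) ^ (p / q) := by
  have hq0 : 0 < q := by linarith
  set r := p / q with hr
  have hr1 : 1 < r := by rwa [hr, one_lt_div hq0]
  set r' := r.conjExponent with hr'
  have hh : r.HolderConjugate r' := Real.HolderConjugate.conjExponent hr1
  obtain ⟨C, hC, h1⟩ := strong_type hq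
  obtain ⟨C', hC', h2⟩ := lintegral_Mx_rpow_le hh.symm.lt
  have hr'0 : 0 ≤ 1 / r' := by rw [one_div]; exact (inv_pos.2 hh.symm.pos).le
  refine ⟨(C * C' ^ (1 / r')) ^ r, by finiteness [hh.pos.le], fun μ _ w hw => ?_⟩
  have hM := measurable_Mx_prod hw
  set W : ℝ → ℝ≥0∞ := fun x => ∫⁻ t, w x t ^ q ∂μ with hW
  have hWm : Measurable W := Measurable.lintegral_prod_right' (hw.pow_const q)
  have hZm : Measurable fun x => ∫⁻ t, Mx (fun y => w y t) x ^ q ∂μ :=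
    Measurable.lintegral_prod_right' (hM.pow_const q)
  refine le_of_not_gt fun hlt => ?_
  obtain ⟨g, hgm, hg, hgt, hlg⟩ := exists_measurable_lt_lintegral hlt
  refine absurd hlg (not_lt.2 ?_)
  have hvm : Measurable fun x => g x ^ (1 / r') := hgm.pow_const _
  have key : ∫⁻ x, g x ≤ C * C' ^ (1 / r') * (∫⁻ x, W x ^ r) ^ (1 / r) * (∫⁻ x, g x) ^ (1 / r') := by
    calc ∫⁻ x, g x ≤ ∫⁻ x, (∫⁻ t, Mx (fun y => w y t) x ^ q ∂μ) * g x ^ (1 / r') := by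
          refine lintegral_mono fun x => ?_
          rcases eq_or_ne (g x) 0 with h0 | h0
          · simp [h0]
          have hgx : g x ^ (1 / r) ≤ ∫⁻ t, Mx (fun y => w y t) x ^ q ∂μ := by
            refine (ENNReal.rpow_le_rpow (hg x) (one_div_pos.2 hh.pos).le).trans_eq ?_
            rw [← ENNReal.rpow_mul, mul_one_div_cancel hh.pos.ne', ENNReal.rpow_one]
          refine le_trans (le_of_eq ?_) (mul_le_mul_left hgx _)
          rw [← ENNReal.rpow_add_of_nonneg _ _ (one_div_pos.2 hh.pos).le hr'0, one_div, one_div,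
            hh.inv_add_inv_eq_one, ENNReal.rpow_one]
      _ = ∫⁻ t, (∫⁻ x, Mx (fun y => w y t) x ^ q * g x ^ (1 / r')) ∂μ := by
          rw [← lintegral_lintegral_swap]
          · refine lintegral_congr fun x => ?_
            rw [lintegral_mul_const]
            exact measurable_slice_right (w := fun x t => Mx (fun y => w y t) x ^ q)
              (hM.pow_const q) x
          · exact ((hM.pow_const q).mul (hvm.comp measurable_fst)).aemeasurable
      _ ≤ ∫⁻ t, (C * ∫⁻ x, w x t ^ q * Mx (fun x => g x ^ (1 / r')) x) ∂μ :=
          lintegral_mono fun t => h1 _ _ hvm (measurable_slice_left hw t)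
      _ = C * ∫⁻ x, W x * Mx (fun x => g x ^ (1 / r')) x := by
          rw [lintegral_const_mul' _ _ hC, ← lintegral_lintegral_swap]
          · congr 1
            refine lintegral_congr fun x => ?_
            rw [lintegral_mul_const _ ((measurable_slice_right hw x).pow_const q)]
          · exact ((hw.pow_const q).mul ((measurable_Mx hvm).comp measurable_fst)).aemeasurable
      _ ≤ C * ((∫⁻ x, W x ^ r) ^ (1 / r) *
            (∫⁻ x, Mx (fun x => g x ^ (1 / r')) x ^ r') ^ (1 / r')) := by
          gcongr
          exact ENNReal.lintegral_mul_le_Lp_mul_Lq _ hh hWm.aemeasurable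
            (measurable_Mx hvm).aemeasurable
      _ ≤ C * ((∫⁻ x, W x ^ r) ^ (1 / r) * (C' * ∫⁻ x, (g x ^ (1 / r')) ^ r') ^ (1 / r')) := by
          gcongr
          exact h2 _ hvm
      _ = _ := by
          simp_rw [← ENNReal.rpow_mul, one_div_mul_cancel hh.symm.pos.ne', ENNReal.rpow_one]
          rw [ENNReal.mul_rpow_of_nonneg _ _ hr'0]
          ring
  refine (le_rpow_of_le_mul_rpow hh hgt key).trans_eq ?_
  rw [ENNReal.mul_rpow_of_nonneg _ _ hh.pos.le, ← ENNReal.rpow_mul _ (1 / r),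
    one_div_mul_cancel hh.pos.ne', ENNReal.rpow_one]

lemma av_le_rpow_mul_rpow {u v w : ℝ → ℝ≥0∞} (hu : Measurable u) (hv : Measurable v) {a b : ℝ}
    (ha : 0 ≤ a) (hb : 0 ≤ b) (hab : a + b = 1) (h : ∀ᵐ x, w x ≤ u x ^ a * v x ^ b) (k : ℤ)
    (x : ℝ) : av k w x ≤ av k u x ^ a * av k v x ^ b := by
  calc av k w x ≤ e2 k * ∫⁻ y in tri k x, u y ^ a * v y ^ b := by
        rw [av]
        gcongr 1
        exact lintegral_mono_ae (ae_restrict_of_ae h)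
    _ ≤ e2 k * ((∫⁻ y in tri k x, u y) ^ a * (∫⁻ y in tri k x, v y) ^ b) := by
        gcongr 1
        exact ENNReal.lintegral_mul_norm_pow_le hu.aemeasurable hv.aemeasurable ha hb hab
    _ = e2 k ^ a * e2 k ^ b * ((∫⁻ y in tri k x, u y) ^ a * (∫⁻ y in tri k x, v y) ^ b) := by
        rw [← ENNReal.rpow_add_of_nonneg _ _ ha hb, hab, ENNReal.rpow_one]
    _ = _ := by
        rw [av, av, ENNReal.mul_rpow_of_nonneg _ _ ha, ENNReal.mul_rpow_of_nonneg _ _ hb]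
        ring

lemma Mx_le_rpow_mul_rpow {u v w : ℝ → ℝ≥0∞} (hu : Measurable u) (hv : Measurable v) {a b : ℝ}
    (ha : 0 ≤ a) (hb : 0 ≤ b) (hab : a + b = 1) (h : ∀ᵐ x, w x ≤ u x ^ a * v x ^ b) (x : ℝ) :
    Mx w x ≤ Mx u x ^ a * Mx v x ^ b :=
  iSup_le fun k => (av_le_rpow_mul_rpow hu hv ha hb hab h k x).trans <| by
    gcongr
    exacts [le_iSup (fun k => av k u x) k, le_iSup (fun k => av k v x) k]


lemma ae_ae_swap_of_measurable {μ : Measure ℝ} [SFinite μ] {u v : ℝ → ℝ → ℝ≥0∞}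
    (hu : Measurable fun z : ℝ × ℝ => u z.1 z.2) (hv : Measurable fun z : ℝ × ℝ => v z.1 z.2)
    (h : ∀ᵐ x, ∀ᵐ t ∂μ, u x t ≤ v x t) : ∀ᵐ t ∂μ, ∀ᵐ x, u x t ≤ v x t :=
  (Measure.ae_ae_comm (p := fun x t => u x t ≤ v x t) (measurableSet_le hu hv)).1 h

lemma mixed_Mx_of_le {p q : ℝ} (hp : 1 < p) (hpq : p ≤ q) : ∃ C : ℝ≥0∞, C ≠ ∞ ∧
    ∀ (μ : Measure ℝ) [SFinite μ] (w : ℝ → ℝ → ℝ≥0∞), Measurable (fun z : ℝ × ℝ => w z.1 z.2) →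
      ∫⁻ x, (∫⁻ t, Mx (fun y => w y t) x ^ q ∂μ) ^ (p / q) ≤
        C * ∫⁻ x, (∫⁻ t, w x t ^ q ∂μ) ^ (p / q) := by
  have hp0 : 0 < p := by linarith
  have hq0 : 0 < q := by linarith
  obtain ⟨C, hC, h1⟩ := lintegral_Mx_rpow_le hp
  refine ⟨C + 1, by finiteness, fun μ _ w hw => ?_⟩
  set I := ∫⁻ x, (∫⁻ t, w x t ^ q ∂μ) ^ (p / q) with hI
  rcases eq_or_ne I ∞ with hIt | hIt
  · rw [hIt, ENNReal.mul_top (by simp)]; exact le_top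
  set θ := p / q with hθ
  have hθ0 : 0 < θ := div_pos hp0 hq0
  have hθ1 : θ ≤ 1 := (div_le_one hq0).2 hpq
  have hθq : θ * q = p := div_mul_cancel₀ _ hq0.ne'
  set N : ℝ → ℝ≥0∞ := fun x => (∫⁻ t, w x t ^ q ∂μ) ^ (1 / q) with hN
  have hNm : Measurable N := (Measurable.lintegral_prod_right' (hw.pow_const q)).pow_const _
  have hNp : ∀ x, N x ^ p = (∫⁻ t, w x t ^ q ∂μ) ^ θ := fun x => by
    rw [hN, ← ENNReal.rpow_mul, hθ]; congr 1; ring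
  have hNq : ∀ x, N x ^ q = ∫⁻ t, w x t ^ q ∂μ := fun x => by
    rw [hN, ← ENNReal.rpow_mul, one_div_mul_cancel hq0.ne', ENNReal.rpow_one]
  have hNI : ∫⁻ x, N x ^ p = I := lintegral_congr hNp
  clear_value N
  have hNt : ∀ᵐ x, N x ≠ ∞ := by
    filter_upwards [ae_lt_top (hNm.pow_const p) (hNI.trans_ne hIt)] with x hx h
    simp [h, hp0] at hx
  set b : ℝ → ℝ → ℝ≥0∞ := fun x t => w x t ^ (1 / θ) * N x ^ (1 - 1 / θ) with hb
  have hbm : Measurable fun z : ℝ × ℝ => b z.1 z.2 :=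
    (hw.pow_const _).mul ((hNm.comp measurable_fst).pow_const _)
  have hw0 : ∀ x, N x = 0 → ∀ᵐ t ∂μ, w x t = 0 := by
    intro x hx
    have := hNq x
    rw [hx, ENNReal.zero_rpow_of_pos hq0, eq_comm,
      lintegral_eq_zero_iff ((measurable_slice_right hw x).pow_const q)] at this
    filter_upwards [this] with t ht
    simpa [hq0.le.not_gt, hq0] using ht
  have hfac : ∀ᵐ t ∂μ, ∀ᵐ x, w x t ≤ N x ^ (1 - θ) * b x t ^ θ := by
    refine ae_ae_swap_of_measurable hw
      (v := fun x t => N x ^ (1 - θ) * b x t ^ θ)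
      (((hNm.comp measurable_fst).pow_const _).mul (hbm.pow_const _)) ?_
    filter_upwards [hNt] with x hx
    rcases eq_or_ne (N x) 0 with h0 | h0
    · filter_upwards [hw0 x h0] with t ht
      simp [ht]
    · refine Eventually.of_forall fun t => le_of_eq ?_
      rw [hb, ENNReal.mul_rpow_of_nonneg _ _ hθ0.le, ← ENNReal.rpow_mul, ← ENNReal.rpow_mul,
        one_div_mul_cancel hθ0.ne', ENNReal.rpow_one, mul_left_comm,
        ← ENNReal.rpow_add _ _ h0 hx, show 1 - θ + (1 - 1 / θ) * θ = 0 by field_simp; ring,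
        ENNReal.rpow_zero, mul_one]
  have hbN : ∀ᵐ x, ∫⁻ t, b x t ^ p ∂μ ≤ N x ^ p := by
    filter_upwards [hNt] with x hx
    rcases eq_or_ne (N x) 0 with h0 | h0
    · have : ∫⁻ t, b x t ^ p ∂μ = ∫⁻ _, 0 ∂μ := by
        refine lintegral_congr_ae ?_
        filter_upwards [hw0 x h0] with t ht
        simp [hb, ht, hθ0, hp0]
      rw [this, lintegral_zero]; exact zero_le
    · have hpw : ∀ t, b x t ^ p = w x t ^ q * N x ^ (p - q) := by
        intro t
        rw [hb, ENNReal.mul_rpow_of_nonneg _ _ hp0.le, ← ENNReal.rpow_mul, ← ENNReal.rpow_mul]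
        have e1 : 1 / θ * p = q := by rw [← hθq]; field_simp
        rw [sub_mul, e1, one_mul]
      simp only [hpw]
      rw [lintegral_mul_const _ ((measurable_slice_right hw x).pow_const q), ← hNq,
        ← ENNReal.rpow_add _ _ h0 hx, add_sub_cancel]
  set Mb : ℝ → ℝ → ℝ≥0∞ := fun x t => Mx (fun y => b y t) x with hMb
  have hMbm : Measurable fun z : ℝ × ℝ => Mb z.1 z.2 := measurable_Mx_prod hbm
  have hMfac : ∀ᵐ t ∂μ, ∀ x, Mx (fun y => w y t) x ≤ Mx N x ^ (1 - θ) * Mb x t ^ θ := by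
    filter_upwards [hfac] with t ht x
    exact Mx_le_rpow_mul_rpow hNm (measurable_slice_left hbm t) (by linarith) hθ0.le (by ring) ht x
  calc ∫⁻ x, (∫⁻ t, Mx (fun y => w y t) x ^ q ∂μ) ^ θ
      ≤ ∫⁻ x, (Mx N x ^ p) ^ (1 - θ) * (∫⁻ t, Mb x t ^ p ∂μ) ^ θ := by
        refine lintegral_mono fun x => ?_
        calc (∫⁻ t, Mx (fun y => w y t) x ^ q ∂μ) ^ θ
            ≤ (∫⁻ t, (Mx N x ^ (1 - θ)) ^ q * Mb x t ^ p ∂μ) ^ θ := by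
              refine ENNReal.rpow_le_rpow (lintegral_mono_ae ?_) hθ0.le
              filter_upwards [hMfac] with t ht
              refine (ENNReal.rpow_le_rpow (ht x) hq0.le).trans_eq ?_
              rw [ENNReal.mul_rpow_of_nonneg _ _ hq0.le, ← ENNReal.rpow_mul (Mb x t), hθq]
          _ = _ := by
              rw [lintegral_const_mul _ ((measurable_slice_right hMbm x).pow_const p),
                ENNReal.mul_rpow_of_nonneg _ _ hθ0.le]
              congr 1
              rw [← ENNReal.rpow_mul, ← ENNReal.rpow_mul, ← ENNReal.rpow_mul, ← hθq]
              congr 1; ring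
    _ ≤ (∫⁻ x, Mx N x ^ p) ^ (1 - θ) * (∫⁻ x, ∫⁻ t, Mb x t ^ p ∂μ) ^ θ :=
        ENNReal.lintegral_mul_norm_pow_le ((measurable_Mx hNm).pow_const p).aemeasurable
          (Measurable.lintegral_prod_right' (hMbm.pow_const p)).aemeasurable (by linarith) hθ0.le
          (by ring)
    _ ≤ (C * I) ^ (1 - θ) * (C * I) ^ θ := by
        have e1 : ∫⁻ x, Mx N x ^ p ≤ C * I := hNI ▸ h1 N hNm
        have e2 : ∫⁻ x, ∫⁻ t, Mb x t ^ p ∂μ ≤ C * I := by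
          rw [lintegral_lintegral_swap (hMbm.pow_const p).aemeasurable]
          calc ∫⁻ t, (∫⁻ x, Mb x t ^ p) ∂μ ≤ ∫⁻ t, (C * ∫⁻ x, b x t ^ p) ∂μ :=
                lintegral_mono fun t => h1 _ (measurable_slice_left hbm t)
            _ = C * ∫⁻ x, ∫⁻ t, b x t ^ p ∂μ := by
                rw [lintegral_const_mul' _ _ hC, ← lintegral_lintegral_swap
                  (hbm.pow_const p).aemeasurable]
            _ ≤ C * I := by
                rw [← hNI]
                gcongr 1
                exact lintegral_mono_ae hbN
        have := sub_nonneg.2 hθ1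
        gcongr
    _ = C * I := by
        rw [← ENNReal.rpow_add_of_nonneg _ _ (by linarith) hθ0.le, sub_add_cancel,
          ENNReal.rpow_one]
    _ ≤ (C + 1) * I := by gcongr; exact le_self_add

lemma measurable_eLpNorm_slice {μ : Measure ℝ} [SFinite μ] {w : ℝ → ℝ → ℝ≥0∞}
    (hw : Measurable fun z : ℝ × ℝ => w z.1 z.2) (q : ℝ≥0∞) :
    Measurable fun x => eLpNorm (w x) q μ := by
  rcases eq_or_ne q 0 with rfl | h0
  · simp
  rcases eq_or_ne q ∞ with rfl | ht
  · simp only [eLpNorm_exponent_top]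
    refine measurable_of_Ioi fun c => ?_
    have : (fun x => eLpNormEssSup (w x) μ) ⁻¹' Ioi c =
        {x | 0 < μ (Prod.mk x ⁻¹' {z : ℝ × ℝ | c < w z.1 z.2})} := by
      ext x
      simp only [mem_preimage, mem_Ioi, mem_ofPred_eq, preimage_ofPred_eq]
      rw [← not_iff_not, not_lt, not_lt, nonpos_iff_eq_zero]
      constructor
      · intro h
        rw [← compl_mem_ae_iff]
        filter_upwards [ae_le_eLpNormEssSup (f := w x) (μ := μ)] with t ht
        simpa using ht.trans h
      · intro h
        refine eLpNormEssSup_le_of_ae_enorm_bound ?_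
        rw [← compl_mem_ae_iff] at h
        filter_upwards [h] with t ht
        simpa using ht
    rw [this]
    exact measurable_measure_prodMk_left (measurableSet_lt measurable_const hw)
      |> measurableSet_lt measurable_const
  · simp only [eLpNorm_eq_lintegral_rpow_enorm_toReal h0 ht, enorm_eq_self]
    exact (Measurable.lintegral_prod_right' (hw.pow_const _)).pow_const _

/-- The Fefferman–Stein inequality for the dyadic maximal function in mixed norms. -/
lemma mixed_Mx_le {p : ℝ} {q : ℝ≥0∞} (hp : 1 < p) (hq : 1 < q) : ∃ C : ℝ≥0∞, C ≠ ∞ ∧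
    ∀ (μ : Measure ℝ) [SFinite μ] (w : ℝ → ℝ → ℝ≥0∞), Measurable (fun z : ℝ × ℝ => w z.1 z.2) →
      ∫⁻ x, eLpNorm (fun t => Mx (fun y => w y t) x) q μ ^ p ≤
        C * ∫⁻ x, eLpNorm (w x) q μ ^ p := by
  rcases eq_or_ne q ∞ with rfl | ht
  · obtain ⟨C, hC, h1⟩ := lintegral_Mx_rpow_le hp
    refine ⟨C, hC, fun μ _ w hw => ?_⟩
    have hNm := measurable_eLpNorm_slice (μ := μ) hw ∞
    refine (lintegral_mono fun x => ENNReal.rpow_le_rpow ?_ (by linarith)).trans (h1 _ hNm)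
    have h2 : ∀ᵐ t ∂μ, ∀ᵐ y, w y t ≤ eLpNorm (w y) ∞ μ :=
      ae_ae_swap_of_measurable hw (v := fun y _ => eLpNorm (w y) ∞ μ)
        (hNm.comp measurable_fst) (Eventually.of_forall fun y => by
          simpa using ae_le_eLpNormEssSup (f := w y) (μ := μ))
    rw [eLpNorm_exponent_top]
    refine eLpNormEssSup_le_of_ae_enorm_bound ?_
    filter_upwards [h2] with t h
    rw [enorm_eq_self]
    refine iSup_mono fun k => ?_
    rw [av, av]
    gcongr 1
    exact lintegral_mono_ae (ae_restrict_of_ae h)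
  · have hq1 : 1 < q.toReal := by
      rwa [← ENNReal.toReal_one, ENNReal.toReal_lt_toReal ENNReal.one_ne_top ht]
    have hq0 : q ≠ 0 := (zero_lt_one.trans hq).ne'
    have e : ∀ (μ : Measure ℝ) (w : ℝ → ℝ≥0∞), eLpNorm w q μ ^ p =
        (∫⁻ t, w t ^ q.toReal ∂μ) ^ (p / q.toReal) := by
      intro μ w
      rw [eLpNorm_eq_lintegral_rpow_enorm_toReal hq0 ht, ← ENNReal.rpow_mul]
      simp only [enorm_eq_self]
      congr 1; ring
    simp only [e]
    rcases le_or_gt p q.toReal with h | h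
    exacts [mixed_Mx_of_le hp h, mixed_Mx_of_lt hq1 h]

/-! ### Duality and Hölder's inequality in mixed norms -/

/-- `v` is bounded, supported in a strip `|x| ≤ B`, and vanishes where `U` is large. -/
def IsTestFor (U v : ℝ → ℝ → ℝ≥0∞) : Prop :=
  Measurable (fun z : ℝ × ℝ => v z.1 z.2) ∧
    ∃ B : ℝ≥0, ∀ x t, v x t ≤ B ∧ (B < |x| → v x t = 0) ∧ (B < U x t → v x t = 0)

lemma mixed_duality_trunc {p q p' q' : ℝ} (hp : p.HolderConjugate p') (hq : q.HolderConjugate q')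
    {μ : Measure ℝ} [IsFiniteMeasure μ] {U : ℝ → ℝ → ℝ≥0∞}
    (hU : Measurable fun z : ℝ × ℝ => U z.1 z.2) {K : ℝ≥0∞}
    (h : ∀ v, IsTestFor U v → ∫⁻ x, ∫⁻ t, U x t * v x t ∂μ ≤
      K * (∫⁻ x, (∫⁻ t, v x t ^ q' ∂μ) ^ (p' / q')) ^ (1 / p')) (n : ℕ) :
    ∫⁻ x, (∫⁻ t, {z : ℝ × ℝ | |z.1| ≤ n ∧ U z.1 z.2 ≤ n}.indicator
      (fun z => U z.1 z.2) (x, t) ^ q ∂μ) ^ (p / q) ≤ K ^ p := by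
  have hp0 := hp.pos
  have hq0 := hq.pos
  have hp'0 := hp.symm.pos
  have hq'0 := hq.symm.pos
  have hEm : MeasurableSet {z : ℝ × ℝ | |z.1| ≤ n ∧ U z.1 z.2 ≤ n} :=
    (measurableSet_le (measurable_fst.abs) measurable_const).inter
      (measurableSet_le hU measurable_const)
  obtain ⟨V, hV⟩ : ∃ V : ℝ → ℝ → ℝ≥0∞, ∀ x t, {z : ℝ × ℝ | |z.1| ≤ n ∧ U z.1 z.2 ≤ n}.indicator
      (fun z => U z.1 z.2) (x, t) = V x t := ⟨_, fun _ _ => rfl⟩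
  simp only [hV]
  have hVm : Measurable fun z : ℝ × ℝ => V z.1 z.2 := by
    simp only [← hV]; exact hU.indicator hEm
  have hVn : ∀ x t, V x t ≤ n := fun x t => by
    by_cases hz : (x, t) ∈ {z : ℝ × ℝ | |z.1| ≤ n ∧ U z.1 z.2 ≤ n}
    · rw [← hV, indicator_of_mem hz]; exact hz.2
    · rw [← hV, indicator_of_notMem hz]; exact zero_le
  have hV0 : ∀ x t : ℝ, ((n : ℝ) < |x| ∨ (n : ℝ≥0∞) < U x t) → V x t = 0 := fun x t hz => by
    rw [← hV]
    refine indicator_of_notMem ?_ _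
    rintro ⟨h1, h2⟩
    rcases hz with hz | hz
    exacts [absurd hz (not_lt.2 h1), absurd hz (not_lt.2 h2)]
  have hUV : ∀ x t, U x t * V x t ^ (q - 1) = V x t ^ q := fun x t => by
    by_cases hz : (x, t) ∈ {z : ℝ × ℝ | |z.1| ≤ n ∧ U z.1 z.2 ≤ n}
    · have : V x t = U x t := (hV x t).symm.trans (indicator_of_mem hz _)
      rw [this]
      conv_lhs => rw [← ENNReal.rpow_one (U x t), ← ENNReal.rpow_mul, one_mul,
        ← ENNReal.rpow_add_of_nonneg _ _ zero_le_one (by linarith [hq.lt])]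
      congr 1; ring
    · have : V x t = 0 := (hV x t).symm.trans (indicator_of_notMem hz _)
      rw [this, ENNReal.zero_rpow_of_pos (by linarith [hq.lt]), ENNReal.zero_rpow_of_pos hq0,
        mul_zero]
  set N : ℝ → ℝ≥0∞ := fun x => (∫⁻ t, V x t ^ q ∂μ) ^ (1 / q) with hN
  have hNm : Measurable N := (Measurable.lintegral_prod_right' (hVm.pow_const q)).pow_const _
  have hNq : ∀ x, ∫⁻ t, V x t ^ q ∂μ = N x ^ q := fun x => by
    rw [hN, ← ENNReal.rpow_mul, one_div_mul_cancel hq0.ne', ENNReal.rpow_one]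
  have hNb : ∀ x, N x ^ q ≤ (n : ℝ≥0∞) ^ q * μ univ := fun x => by
    rw [← hNq, ← lintegral_const]
    exact lintegral_mono fun t => ENNReal.rpow_le_rpow (hVn x t) hq0.le
  have hNt : ∀ x, N x ≠ ∞ := fun x hx => by
    have := hNb x
    rw [hx, ENNReal.top_rpow_of_pos hq0, top_le_iff] at this
    exact absurd this (by finiteness)
  have hN0 : ∀ x : ℝ, (n : ℝ) < |x| → N x = 0 := fun x hx => by
    rw [← ENNReal.rpow_eq_zero_iff_of_pos hq0, ← hNq]
    simp [hV0 x _ (Or.inl hx), hq0]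
  clear_value N
  have step : ∀ m : ℕ, ∫⁻ x, {x | N x ^ (p - q) ≤ m}.indicator (fun x => N x ^ p) x ≤ K ^ p := by
    intro m
    have hBm : MeasurableSet {x | N x ^ (p - q) ≤ m} :=
      measurableSet_le (hNm.pow_const _) measurable_const
    set c : ℝ → ℝ≥0∞ := {x | N x ^ (p - q) ≤ m}.indicator fun x => N x ^ (p - q) with hc
    have hcm : Measurable c := (hNm.pow_const _).indicator hBm
    have hcle : ∀ x, c x ≤ m := fun x => by
      by_cases hx : x ∈ {x | N x ^ (p - q) ≤ m}
      · rw [hc, indicator_of_mem hx]; exact hx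
      · rw [hc, indicator_of_notMem hx]; exact zero_le
    have e1 : ∀ x, c x * N x ^ q = {x | N x ^ (p - q) ≤ m}.indicator (fun x => N x ^ p) x := by
      intro x
      by_cases hx : x ∈ {x | N x ^ (p - q) ≤ m}
      · rw [hc, indicator_of_mem hx, indicator_of_mem hx]
        rcases eq_or_ne (N x) 0 with h0 | h0
        · simp [h0, hp0, hq0]
        · rw [← ENNReal.rpow_add _ _ h0 (hNt x), sub_add_cancel]
      · rw [hc, indicator_of_notMem hx, indicator_of_notMem hx, zero_mul]
    have e2 : ∀ x, c x ^ p' * (N x ^ q) ^ (p' / q') =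
        {x | N x ^ (p - q) ≤ m}.indicator (fun x => N x ^ p) x := by
      intro x
      by_cases hx : x ∈ {x | N x ^ (p - q) ≤ m}
      · rw [hc, indicator_of_mem hx, indicator_of_mem hx]
        rcases eq_or_ne (N x) 0 with h0 | h0
        · simp [h0, hp0, hq0, hp'0, hq'0]
        · rw [← ENNReal.rpow_mul, ← ENNReal.rpow_mul, ← ENNReal.rpow_add _ _ h0 (hNt x)]
          congr 1
          have h1 := hp.sub_one_mul_conj
          have h2 : q / q' = q - 1 := by
            rw [div_eq_iff hq'0.ne', hq.sub_one_mul_conj]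
          calc (p - q) * p' + q * (p' / q') = (p - q + q / q') * p' := by ring
            _ = (p - 1) * p' := by rw [h2]; ring
            _ = p := h1
      · rw [hc, indicator_of_notMem hx, indicator_of_notMem hx, ENNReal.zero_rpow_of_pos hp'0,
          zero_mul]
    set A := ∫⁻ x, {x | N x ^ (p - q) ≤ m}.indicator (fun x => N x ^ p) x with hA
    have hAt : A ≠ ∞ := by
      have : A ≤ ∫⁻ x, (Icc (-(n : ℝ)) n).indicator
          (fun _ => ((n : ℝ≥0∞) ^ q * μ univ) ^ (p / q)) x := by
        refine lintegral_mono fun x => ?_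
        refine (indicator_le_self' (fun _ _ => zero_le) x).trans ?_
        by_cases hx : x ∈ Icc (-(n : ℝ)) n
        · rw [indicator_of_mem hx]
          calc N x ^ p = (N x ^ q) ^ (p / q) := by
                rw [← ENNReal.rpow_mul, mul_div_cancel₀ _ hq0.ne']
            _ ≤ _ := ENNReal.rpow_le_rpow (hNb x) (by positivity)
        · rw [hN0 x (by rw [← not_le, abs_le]; exact hx), ENNReal.zero_rpow_of_pos hp0]
          exact zero_le
      refine ne_top_of_le_ne_top ?_ this
      rw [lintegral_indicator measurableSet_Icc, setLIntegral_const, Real.volume_Icc]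
      have : 0 ≤ p / q := by positivity
      finiteness
    have hv : IsTestFor U fun x t => c x * V x t ^ (q - 1) := by
      have hq1 : 0 < q - 1 := by linarith [hq.lt]
      refine ⟨(hcm.comp measurable_fst).mul (hVm.pow_const _),
        (n : ℝ≥0) + m * (n : ℝ≥0) ^ (q - 1), fun x t => ⟨?_, fun hx => ?_, fun hx => ?_⟩⟩
      · refine le_trans ?_ (ENNReal.coe_le_coe.2 (self_le_add_left _ _))
        rw [ENNReal.coe_mul, ENNReal.coe_rpow_of_nonneg _ hq1.le, ENNReal.coe_natCast,
          ENNReal.coe_natCast]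
        exact mul_le_mul' (hcle x) (ENNReal.rpow_le_rpow (hVn x t) hq1.le)
      · change c x * V x t ^ (q - 1) = 0
        rw [hV0 x t (Or.inl (lt_of_le_of_lt ?_ hx)), ENNReal.zero_rpow_of_pos hq1, mul_zero]
        push_cast
        exact le_add_of_nonneg_right (by positivity)
      · change c x * V x t ^ (q - 1) = 0
        rw [hV0 x t (Or.inr (lt_of_le_of_lt ?_ hx)), ENNReal.zero_rpow_of_pos hq1, mul_zero]
        push_cast
        exact le_self_add
    refine le_rpow_of_le_mul_rpow hp hAt ?_
    have := h _ hv
    have f1 : ∀ x, ∫⁻ t, U x t * (c x * V x t ^ (q - 1)) ∂μ =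
        {x | N x ^ (p - q) ≤ m}.indicator (fun x => N x ^ p) x := by
      intro x
      simp only [mul_left_comm (U x _), hUV]
      rw [lintegral_const_mul _ ((measurable_slice_right hVm x).pow_const q), hNq, e1]
    have f2 : ∀ x, (∫⁻ t, (c x * V x t ^ (q - 1)) ^ q' ∂μ) ^ (p' / q') =
        {x | N x ^ (p - q) ≤ m}.indicator (fun x => N x ^ p) x := by
      intro x
      simp only [ENNReal.mul_rpow_of_nonneg _ _ hq'0.le, ← ENNReal.rpow_mul (V x _),
        hq.sub_one_mul_conj]
      rw [lintegral_const_mul _ ((measurable_slice_right hVm x).pow_const q), hNq,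
        ENNReal.mul_rpow_of_nonneg _ _ (by positivity), ← ENNReal.rpow_mul (c x),
        mul_div_cancel₀ _ hq'0.ne', e2]
    simpa only [f1, f2] using this
  have hfin : ∀ x, (∫⁻ t, V x t ^ q ∂μ) ^ (p / q) =
      ⨆ m : ℕ, {x | N x ^ (p - q) ≤ m}.indicator (fun x => N x ^ p) x := by
    intro x
    rw [hNq, ← ENNReal.rpow_mul, mul_div_cancel₀ _ hq0.ne']
    refine le_antisymm ?_ (iSup_le fun m => indicator_le_self' (fun _ _ => zero_le) x)
    rcases eq_or_ne (N x) 0 with h0 | h0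
    · simp [h0, hp0]
    · obtain ⟨m, hm⟩ := ENNReal.exists_nat_gt
        (ENNReal.rpow_ne_top_of_ne_zero h0 (hNt x) (y := p - q))
      refine le_iSup_of_le m ?_
      rw [indicator_of_mem]
      exact hm.le
  simp only [hfin]
  rw [lintegral_iSup]
  · exact iSup_le step
  · exact fun m => (hNm.pow_const p).indicator
      (measurableSet_le (hNm.pow_const _) measurable_const)
  · intro a b hab x
    refine indicator_le_indicator_of_subset (fun y hy => ?_) (fun _ => zero_le) x
    exact le_trans (show N y ^ (p - q) ≤ a from hy) (by exact_mod_cast hab)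

lemma mixed_duality {p q p' q' : ℝ} (hp : p.HolderConjugate p') (hq : q.HolderConjugate q')
    {μ : Measure ℝ} [IsFiniteMeasure μ] {U : ℝ → ℝ → ℝ≥0∞}
    (hU : Measurable fun z : ℝ × ℝ => U z.1 z.2) (hUt : ∀ x t, U x t ≠ ∞) {K : ℝ≥0∞}
    (h : ∀ v, IsTestFor U v → ∫⁻ x, ∫⁻ t, U x t * v x t ∂μ ≤
      K * (∫⁻ x, (∫⁻ t, v x t ^ q' ∂μ) ^ (p' / q')) ^ (1 / p')) :
    ∫⁻ x, (∫⁻ t, U x t ^ q ∂μ) ^ (p / q) ≤ K ^ p := by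
  have hp0 := hp.pos
  have hq0 := hq.pos
  set E : ℕ → Set (ℝ × ℝ) := fun n => {z : ℝ × ℝ | |z.1| ≤ n ∧ U z.1 z.2 ≤ n} with hE
  have hEm : ∀ n, MeasurableSet (E n) := fun n =>
    (measurableSet_le (measurable_fst.abs) measurable_const).inter
      (measurableSet_le hU measurable_const)
  have hEmono : Monotone E := fun a b hab z hz =>
    ⟨hz.1.trans (by exact_mod_cast hab), hz.2.trans (by exact_mod_cast hab)⟩
  have hVm : ∀ n, Measurable ((E n).indicator fun z : ℝ × ℝ => U z.1 z.2) := fun n =>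
    hU.indicator (hEm n)
  have hVmono : Monotone fun n => (E n).indicator fun z : ℝ × ℝ => U z.1 z.2 :=
    fun a b hab z => indicator_le_indicator_of_subset (hEmono hab) (fun _ => zero_le) z
  have hUV : ∀ x t, U x t ^ q = ⨆ n : ℕ, (E n).indicator (fun z => U z.1 z.2) (x, t) ^ q := by
    intro x t
    refine le_antisymm ?_ (iSup_le fun n => ENNReal.rpow_le_rpow
      (indicator_le_self' (fun _ _ => zero_le) (x, t)) hq0.le)
    obtain ⟨n, hn⟩ := ENNReal.exists_nat_gt (hUt x t)
    obtain ⟨m, hm⟩ := exists_nat_ge |x|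
    refine le_iSup_of_le (max n m) ?_
    rw [indicator_of_mem]
    exact ⟨hm.trans (by exact_mod_cast le_max_right n m),
      hn.le.trans (by exact_mod_cast le_max_left n m)⟩
  have hin : ∀ x, (∫⁻ t, U x t ^ q ∂μ) ^ (p / q) =
      ⨆ n : ℕ, (∫⁻ t, (E n).indicator (fun z => U z.1 z.2) (x, t) ^ q ∂μ) ^ (p / q) := by
    intro x
    simp only [hUV]
    rw [lintegral_iSup]
    · exact (ENNReal.orderIsoRpow (p / q) (by positivity)).map_iSup _
    · exact fun n => ((hVm n).comp measurable_prodMk_left).pow_const q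
    · exact fun a b hab t => ENNReal.rpow_le_rpow (hVmono hab (x, t)) hq0.le
  simp only [hin]
  rw [lintegral_iSup]
  · exact iSup_le fun n => mixed_duality_trunc hp hq hU h n
  · exact fun n => (Measurable.lintegral_prod_right' ((hVm n).pow_const q)).pow_const _
  · exact fun a b hab x => ENNReal.rpow_le_rpow (lintegral_mono fun t =>
      ENNReal.rpow_le_rpow (hVmono hab (x, t)) hq0.le) (by positivity)

lemma lintegral_mul_mul_le_eLpNorm {α : Type*} [MeasurableSpace α] (μ : Measure α)
    {q₁ q₂ : ℝ≥0∞} {q' : ℝ} (hq₁ : 1 < q₁) (hq₂ : 1 < q₂) (hq₂t : q₂ ≠ ∞)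
    (hq' : 1 < q') (hsum : 1 / q₁ + 1 / q₂ + ENNReal.ofReal (1 / q') = 1)
    {a b c : α → ℝ≥0∞} (ha : Measurable a) (hb : Measurable b) (hc : Measurable c) :
    ∫⁻ t, a t * b t * c t ∂μ ≤
      eLpNorm a q₁ μ * eLpNorm b q₂ μ * (∫⁻ t, c t ^ q' ∂μ) ^ (1 / q') := by
  have hq'0 : 0 < q' := by linarith
  have h2pos : 0 < q₂.toReal := ENNReal.toReal_pos (by positivity) hq₂t
  have eb : eLpNorm b q₂ μ = (∫⁻ t, b t ^ q₂.toReal ∂μ) ^ (1 / q₂.toReal) := by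
    rw [eLpNorm_eq_lintegral_rpow_enorm_toReal (by positivity) hq₂t]; simp
  have e2 : ENNReal.ofReal (1 / q₂.toReal) = 1 / q₂ := by
    rw [one_div, one_div, ENNReal.ofReal_inv_of_pos h2pos, ENNReal.ofReal_toReal hq₂t]
  rcases eq_or_ne q₁ ∞ with rfl | h1t
  · have hc2 : q₂.toReal.HolderConjugate q' := by
      rw [Real.holderConjugate_iff]
      refine ⟨?_, ?_⟩
      · rw [← ENNReal.toReal_one]; exact (ENNReal.toReal_lt_toReal (by simp) hq₂t).2 hq₂
      · rw [ENNReal.div_top, zero_add, ← e2, ← ENNReal.ofReal_add (by positivity) (by positivity),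
          ENNReal.ofReal_eq_one] at hsum
        simpa using hsum
    rw [eLpNorm_exponent_top, eb, mul_assoc]
    refine le_trans ?_ (mul_le_mul_right (ENNReal.lintegral_mul_le_Lp_mul_Lq μ hc2
      hb.aemeasurable hc.aemeasurable) _)
    rw [← lintegral_const_mul _ (hb.mul hc)]
    refine lintegral_mono_ae ?_
    filter_upwards [ae_le_eLpNormEssSup (f := a) (μ := μ)] with t ht
    rw [mul_assoc]
    exact mul_le_mul_left ht _
  · have h1pos : 0 < q₁.toReal := ENNReal.toReal_pos (by positivity) h1t
    have ea : eLpNorm a q₁ μ = (∫⁻ t, a t ^ q₁.toReal ∂μ) ^ (1 / q₁.toReal) := by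
      rw [eLpNorm_eq_lintegral_rpow_enorm_toReal (by positivity) h1t]; simp
    have e1 : ENNReal.ofReal (1 / q₁.toReal) = 1 / q₁ := by
      rw [one_div, one_div, ENNReal.ofReal_inv_of_pos h1pos, ENNReal.ofReal_toReal h1t]
    have hs : 1 / q₁.toReal + 1 / q₂.toReal + 1 / q' = 1 := by
      rwa [← e1, ← e2, ← ENNReal.ofReal_add (by positivity) (by positivity),
        ← ENNReal.ofReal_add (by positivity) (by positivity), ENNReal.ofReal_eq_one] at hsum
    set r := q'.conjExponent with hr
    have hcr : r.HolderConjugate q' := (Real.HolderConjugate.conjExponent hq').symm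
    have hrr : 1 / r = 1 / q₁.toReal + 1 / q₂.toReal := by
      have := hcr.inv_add_inv_eq_one
      rw [one_div] at *
      simp only [one_div] at *
      linarith
    rw [ea, eb]
    refine (ENNReal.lintegral_mul_le_Lp_mul_Lq μ hcr (ha.mul hb).aemeasurable
      hc.aemeasurable).trans (mul_le_mul_left ?_ _)
    refine ENNReal.lintegral_Lp_mul_le_Lq_mul_Lr hcr.pos ?_ hrr μ ha.aemeasurable hb.aemeasurable
    have : 0 < 1 / q₂.toReal := by positivity
    exact lt_of_one_div_lt_one_div h1pos (by linarith)

/-- Bounded measurable functions of compact support. -/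
def IsBddTest (h : ℝ → ℂ) : Prop :=
  Measurable h ∧ ∃ B : ℝ, ∀ x, ‖h x‖ ≤ B ∧ (B < |x| → h x = 0)

lemma exists_isBddTest_lintegral_le {u : ℝ → ℂ} (hu : Measurable u) {v : ℝ → ℝ≥0∞}
    (hv : Measurable v) {B : ℝ≥0}
    (hB : ∀ x, v x ≤ B ∧ (B < |x| → v x = 0) ∧ (B < ‖u x‖ₑ → v x = 0)) :
    ∃ h : ℝ → ℂ, IsBddTest h ∧ (∀ x, ‖h x‖ₑ ≤ v x) ∧
      ∫⁻ x, ‖u x‖ₑ * v x ≤ ‖∫ x, u x * h x‖ₑ := by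
  have hvt : ∀ x, v x ≠ ∞ := fun x => ne_top_of_le_ne_top ENNReal.coe_ne_top (hB x).1
  have hvr : ∀ x, (v x).toReal ≤ B := fun x => ENNReal.toReal_le_coe_of_le_coe (hB x).1
  set s : ℝ → ℂ := fun x => (‖u x‖ : ℂ)⁻¹ * (starRingEnd ℂ) (u x) with hs
  have hs1 : ∀ x, ‖s x‖ ≤ 1 := fun x => by
    simp only [hs, norm_mul, norm_inv, Complex.norm_real, norm_norm, RCLike.norm_conj]
    exact inv_mul_le_one
  have hus : ∀ x, u x * s x = (‖u x‖ : ℂ) := fun x => by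
    rcases eq_or_ne (u x) 0 with h0 | h0
    · simp [h0]
    · have : (‖u x‖ : ℂ) ≠ 0 := by simpa using h0
      rw [hs]
      simp only
      rw [mul_left_comm, Complex.mul_conj, Complex.normSq_eq_norm_sq]
      push_cast
      field_simp
  have hsm : Measurable s :=
    (Complex.measurable_ofReal.comp hu.norm).inv.mul (Complex.continuous_conj.measurable.comp hu)
  refine ⟨fun x => s x * ((v x).toReal : ℂ), ⟨hsm.mul
    (Complex.measurable_ofReal.comp hv.ennreal_toReal), B, fun x => ⟨?_, fun hx => ?_⟩⟩,
    fun x => ?_, ?_⟩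
  · rw [norm_mul, Complex.norm_real, Real.norm_of_nonneg ENNReal.toReal_nonneg]
    calc ‖s x‖ * (v x).toReal ≤ 1 * B := by
          gcongr
          exacts [hs1 x, hvr x]
      _ = B := one_mul _
  · simp [(hB x).2.1 hx]
  · rw [enorm_mul, ← ofReal_norm (((v x).toReal : ℝ) : ℂ), Complex.norm_real,
      Real.norm_of_nonneg ENNReal.toReal_nonneg, ENNReal.ofReal_toReal (hvt x)]
    refine mul_le_of_le_one_left' ?_
    rw [← ofReal_norm]
    exact ENNReal.ofReal_le_one.2 (hs1 x)
  · have e : ∀ x, u x * (s x * ((v x).toReal : ℂ)) = ((‖u x‖ * (v x).toReal : ℝ) : ℂ) :=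
      fun x => by rw [← mul_assoc, hus]; push_cast; rfl
    simp only [e]
    have hi : Integrable fun x => ‖u x‖ * (v x).toReal := by
      refine Integrable.mono' (g := (Icc (-(B : ℝ)) B).indicator fun _ => (B : ℝ) * B)
        ((integrable_indicator_iff measurableSet_Icc).2 (integrableOn_const (by simp)))
        (hu.norm.mul hv.ennreal_toReal).aestronglyMeasurable (Eventually.of_forall fun x => ?_)
      rw [Real.norm_of_nonneg (by positivity)]
      by_cases hx : x ∈ Icc (-(B : ℝ)) B
      · rw [indicator_of_mem hx]
        by_cases hb : (B : ℝ≥0∞) < ‖u x‖ₑ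
        · simp only [(hB x).2.2 hb, ENNReal.toReal_zero, mul_zero]
          positivity
        · have : ‖u x‖ ≤ B := by
            rw [not_lt, enorm_le_coe] at hb
            exact_mod_cast hb
          gcongr
          exact hvr x
      · rw [indicator_of_notMem hx, (hB x).2.1 (by rw [← not_le, abs_le]; exact hx)]
        simp
    rw [integral_complex_ofReal, ← ofReal_norm, Complex.norm_real, Real.norm_of_nonneg
      (integral_nonneg fun x => by positivity), ofReal_integral_eq_lintegral_ofReal hi
      (Eventually.of_forall fun x => by positivity)]
    refine lintegral_mono fun x => ?_
    rw [ENNReal.ofReal_mul (norm_nonneg _), ENNReal.ofReal_toReal (hvt x), ofReal_norm]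

lemma eLpNorm_Mx_le {p q : ℝ≥0∞} (hp : 1 < p) (hpt : p ≠ ∞) (hq : 1 < q) :
    ∃ C : ℝ≥0∞, C ≠ ∞ ∧ ∀ (μ : Measure ℝ) [SFinite μ] (w : ℝ → ℝ → ℝ≥0∞),
      Measurable (fun z : ℝ × ℝ => w z.1 z.2) →
      eLpNorm (fun x => eLpNorm (fun t => Mx (fun y => w y t) x) q μ) p volume ≤
        C * eLpNorm (fun x => eLpNorm (w x) q μ) p volume := by
  have hp0 : 0 < p.toReal := ENNReal.toReal_pos (by positivity) hpt
  have hp1 : 1 < p.toReal := by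
    rw [← ENNReal.toReal_one]; exact (ENNReal.toReal_lt_toReal (by simp) hpt).2 hp
  obtain ⟨C, hC, h⟩ := mixed_Mx_le hp1 hq
  refine ⟨C ^ (1 / p.toReal), by finiteness, fun μ _ w hw => ?_⟩
  simp only [eLpNorm_eq_lintegral_rpow_enorm_toReal (f := fun x => eLpNorm _ q μ)
    (by positivity : p ≠ 0) hpt, enorm_eq_self]
  rw [← ENNReal.mul_rpow_of_nonneg _ _ (by positivity)]
  exact ENNReal.rpow_le_rpow (h μ w hw) (by positivity)

lemma Mx_mono {w w' : ℝ → ℝ≥0∞} (h : ∀ x, w x ≤ w' x) (x : ℝ) : Mx w x ≤ Mx w' x :=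
  iSup_mono fun k => by
    unfold av
    gcongr
    exact h _

/-- A trilinear maximal bound against test functions implies a mixed norm bound. -/
lemma mixed_trilinear {p q p₁ q₁ p₂ q₂ : ℝ≥0∞}
    (hp : 1 < p) (hpt : p ≠ ∞) (hq : 1 < q) (hqt : q ≠ ∞)
    (hp₁ : 1 < p₁) (hp₁t : p₁ ≠ ∞) (hq₁ : 1 < q₁)
    (hp₂ : 1 < p₂) (hp₂t : p₂ ≠ ∞) (hq₂ : 1 < q₂) (hq₂t : q₂ ≠ ∞)
    (hpsum : 1 / p₁ + 1 / p₂ = 1 / p) (hqsum : 1 / q₁ + 1 / q₂ = 1 / q) :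
    ∃ C : ℝ≥0∞, C ≠ ∞ ∧ ∀ (μ : Measure ℝ) [IsFiniteMeasure μ] (u : ℝ → ℝ → ℂ)
      (G F : ℝ → ℝ → ℝ≥0∞) (K : ℝ≥0∞), Measurable (fun z : ℝ × ℝ => u z.1 z.2) →
      Measurable (fun z : ℝ × ℝ => G z.1 z.2) → Measurable (fun z : ℝ × ℝ => F z.1 z.2) →
      (∀ t, ∀ h : ℝ → ℂ, IsBddTest h → ‖∫ x, u x t * h x‖ₑ ≤
        K * ∫⁻ x, Mx (fun y => G y t) x * Mx (fun y => F y t) x * Mx (fun y => ‖h y‖ₑ) x) →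
      eLpNorm (fun x => eLpNorm (u x) q μ) p volume ≤
        C * K * eLpNorm (fun x => eLpNorm (G x) q₁ μ) p₁ volume *
          eLpNorm (fun x => eLpNorm (F x) q₂ μ) p₂ volume := by
  have toR : ∀ {r : ℝ≥0∞}, 1 < r → r ≠ ∞ → 1 < r.toReal := fun {r} h h' => by
    rw [← ENNReal.toReal_one]; exact (ENNReal.toReal_lt_toReal (by simp) h').2 h
  have conj : ∀ {r : ℝ≥0∞}, 1 < r → r ≠ ∞ →
      1 / r + ENNReal.ofReal (1 / r.toReal.conjExponent) = 1 := fun {r} h h' => by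
    have hc := Real.HolderConjugate.conjExponent (toR h h')
    have e : 1 / r = ENNReal.ofReal (r.toReal⁻¹) := by
      rw [ENNReal.ofReal_inv_of_pos hc.pos, ENNReal.ofReal_toReal h', one_div]
    rw [e, one_div, ← ENNReal.ofReal_add (by have := hc.pos; positivity)
      (by have := hc.symm.pos; positivity), hc.inv_add_inv_eq_one, ENNReal.ofReal_one]
  have hpc := Real.HolderConjugate.conjExponent (toR hp hpt)
  have hqc := Real.HolderConjugate.conjExponent (toR hq hqt)
  set p' := p.toReal.conjExponent
  set q' := q.toReal.conjExponent
  have hp' : 1 < p' := hpc.symm.lt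
  have hq' : 1 < q' := hqc.symm.lt
  have hpc' : 1 / p₁ + 1 / p₂ + ENNReal.ofReal (1 / p') = 1 := by rw [hpsum]; exact conj hp hpt
  have hqc' : 1 / q₁ + 1 / q₂ + ENNReal.ofReal (1 / q') = 1 := by rw [hqsum]; exact conj hq hqt
  obtain ⟨C₁, hC₁, H₁⟩ := eLpNorm_Mx_le hp₁ hp₁t hq₁
  obtain ⟨C₂, hC₂, H₂⟩ := eLpNorm_Mx_le hp₂ hp₂t hq₂
  obtain ⟨C₃, hC₃, H₃⟩ := mixed_Mx_le (q := ENNReal.ofReal q') hp'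
    (by rw [← ENNReal.ofReal_one]; exact ENNReal.ofReal_lt_ofReal_iff_of_nonneg zero_le_one |>.2 hq')
  have hq'0 : 0 < q' := by linarith
  have hp'0 : 0 < p' := by linarith
  have eq' : ∀ (μ : Measure ℝ) (c : ℝ → ℝ≥0∞), eLpNorm c (ENNReal.ofReal q') μ =
      (∫⁻ t, c t ^ q' ∂μ) ^ (1 / q') := fun μ c => by
    rw [eLpNorm_eq_lintegral_rpow_enorm_toReal (by simpa using hq'0) ENNReal.ofReal_ne_top,
      ENNReal.toReal_ofReal hq'0.le]
    simp
  refine ⟨C₁ * C₂ * C₃ ^ (1 / p'), by finiteness, fun μ _ u G F K hu hG hF hyp => ?_⟩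
  have hMm : ∀ {w : ℝ → ℝ → ℝ≥0∞}, Measurable (fun z : ℝ × ℝ => w z.1 z.2) →
      Measurable (fun z : ℝ × ℝ => Mx (fun y => w y z.2) z.1) := fun hw => measurable_Mx_prod hw
  set NG := eLpNorm (fun x => eLpNorm (G x) q₁ μ) p₁ volume
  set NF := eLpNorm (fun x => eLpNorm (F x) q₂ μ) p₂ volume
  have hp0 := hpc.pos
  have main := mixed_duality hpc hqc (μ := μ) (U := fun x t => ‖u x t‖ₑ) hu.enorm
    (fun _ _ => enorm_ne_top) (K := C₁ * C₂ * C₃ ^ (1 / p') * K * NG * NF) ?_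
  · have e1 : ∀ x, eLpNorm (u x) q μ = (∫⁻ t, ‖u x t‖ₑ ^ q.toReal ∂μ) ^ (1 / q.toReal) :=
      fun x => eLpNorm_eq_lintegral_rpow_enorm_toReal (by positivity) hqt
    rw [eLpNorm_eq_lintegral_rpow_enorm_toReal (by positivity) hpt]
    simp only [enorm_eq_self, e1, ← ENNReal.rpow_mul]
    rw [one_div p.toReal, ENNReal.rpow_inv_le_iff hp0]
    simpa only [one_div_mul_eq_div] using main
  rintro v ⟨hvm, B, hB⟩
  have hMv := hMm hvm
  have hMG := hMm hG
  have hMF := hMm hF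
  have hM3 : Measurable (Function.uncurry fun x t => Mx (fun y => G y t) x *
      Mx (fun y => F y t) x * Mx (fun y => v y t) x) := (hMG.mul hMF).mul hMv
  have hM3' : Measurable fun t => ∫⁻ x, Mx (fun y => G y t) x *
      Mx (fun y => F y t) x * Mx (fun y => v y t) x := hM3.lintegral_prod_left'
  have s1 : ∫⁻ x, ∫⁻ t, ‖u x t‖ₑ * v x t ∂μ ≤ K * ∫⁻ x, ∫⁻ t, Mx (fun y => G y t) x *
      Mx (fun y => F y t) x * Mx (fun y => v y t) x ∂μ := by
    rw [lintegral_lintegral_swap (hu.enorm.mul hvm).aemeasurable,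
      lintegral_lintegral_swap hM3.aemeasurable,
      ← lintegral_const_mul _ hM3']
    refine lintegral_mono fun t => ?_
    obtain ⟨h, hh, hhv, hle⟩ := exists_isBddTest_lintegral_le (u := fun x => u x t)
      (v := fun x => v x t) (hu.comp measurable_prodMk_right) (hvm.comp measurable_prodMk_right)
      (B := B) (fun x => hB x t)
    refine (hle.trans (hyp t h hh)).trans ?_
    refine mul_le_mul_right (lintegral_mono fun x => mul_le_mul_right (Mx_mono hhv x) _) _
  refine s1.trans ?_
  have s2 : ∫⁻ x, ∫⁻ t, Mx (fun y => G y t) x * Mx (fun y => F y t) x * Mx (fun y => v y t) x ∂μ ≤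
      ∫⁻ x, eLpNorm (fun t => Mx (fun y => G y t) x) q₁ μ *
        eLpNorm (fun t => Mx (fun y => F y t) x) q₂ μ *
        eLpNorm (fun t => Mx (fun y => v y t) x) (ENNReal.ofReal q') μ := by
    refine lintegral_mono fun x => ?_
    rw [eq']
    exact lintegral_mul_mul_le_eLpNorm μ hq₁ hq₂ hq₂t hq' hqc'
      (measurable_slice_right (w := fun x t => Mx (fun y => G y t) x) hMG x)
      (measurable_slice_right (w := fun x t => Mx (fun y => F y t) x) hMF x)
      (measurable_slice_right (w := fun x t => Mx (fun y => v y t) x) hMv x)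
  have s3 := s2.trans (lintegral_mul_mul_le_eLpNorm volume hp₁ hp₂ hp₂t hp' hpc'
    (measurable_eLpNorm_slice (w := fun x t => Mx (fun y => G y t) x) hMG q₁)
    (measurable_eLpNorm_slice (w := fun x t => Mx (fun y => F y t) x) hMF q₂)
    (measurable_eLpNorm_slice (w := fun x t => Mx (fun y => v y t) x) hMv _))
  have s4 : (∫⁻ x, eLpNorm (fun t => Mx (fun y => v y t) x) (ENNReal.ofReal q') μ ^ p') ^ (1 / p') ≤
      C₃ ^ (1 / p') * (∫⁻ x, (∫⁻ t, v x t ^ q' ∂μ) ^ (p' / q')) ^ (1 / p') := by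
    rw [← ENNReal.mul_rpow_of_nonneg _ _ (by positivity)]
    refine ENNReal.rpow_le_rpow ((H₃ μ v hvm).trans_eq ?_) (by positivity)
    simp only [eq', ← ENNReal.rpow_mul, one_div_mul_eq_div]
  calc _ ≤ K * ((C₁ * NG) * (C₂ * NF) * (C₃ ^ (1 / p') *
        (∫⁻ x, (∫⁻ t, v x t ^ q' ∂μ) ^ (p' / q')) ^ (1 / p'))) :=
        mul_le_mul_right (s3.trans (mul_le_mul' (mul_le_mul' (H₁ μ G hG) (H₂ μ F hF)) s4)) _
    _ = _ := by ring

lemma fourier_eq_char (f : ℝ → ℂ) (ξ : ℝ) : 𝓕 f ξ = ∫ x, (𝐞 (-(x * ξ)) : ℂ) * f x := by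
  simp only [Real.fourier_real_eq, Circle.smul_def, smul_eq_mul]

lemma fourierInv_eq_char (f : ℝ → ℂ) (ξ : ℝ) : 𝓕⁻ f ξ = ∫ x, (𝐞 (x * ξ) : ℂ) * f x := by
  rw [Real.fourierInv_eq_fourier_neg, fourier_eq_char]
  simp

lemma continuous_char {X : Type*} [TopologicalSpace X] {θ : X → ℝ} (hθ : Continuous θ) :
    Continuous fun x => (𝐞 (θ x) : ℂ) :=
  continuous_subtype_val.comp (Real.continuous_fourierChar.comp hθ)

lemma integrable_char_mul {α : Type*} [MeasurableSpace α] {μ : Measure α} {θ : α → ℝ}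
    (hθ : Measurable θ) {f : α → ℂ} (hf : Integrable f μ) :
    Integrable (fun x => (𝐞 (θ x) : ℂ) * f x) μ :=
  hf.mono (((continuous_char continuous_id).measurable.comp hθ).aestronglyMeasurable.mul
    hf.aestronglyMeasurable) (Eventually.of_forall fun x => by
      rw [norm_mul, Circle.norm_coe, one_mul])

lemma char_add (a b : ℝ) : (𝐞 (a + b) : ℂ) = 𝐞 a * 𝐞 b := by
  rw [AddChar.map_add_eq_mul, Circle.coe_mul]

/-! ### Low-pass kernels -/

/-- Continuous kernels whose rescalings are controlled by the maximal function at their scale. -/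
structure LowKer (φ : ℝ → ℂ) (D : ℝ) : Prop where
  cont : Continuous φ
  bdd : ∀ x, ‖φ x‖ ≤ D
  low : ∀ w : ℝ → ℝ≥0∞, Measurable w → ∀ (k : ℤ) (x : ℝ),
    ∫⁻ y, ‖sc k φ (x - y)‖ₑ * w y ≤ ENNReal.ofReal D * mx k w x

lemma LowKer.nonneg {φ : ℝ → ℂ} {D : ℝ} (h : LowKer φ D) : 0 ≤ D :=
  (norm_nonneg _).trans (h.bdd 0)

lemma LowKer.of_bound {ψ : ℝ → ℂ} {D : ℝ} (hc : Continuous ψ)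
    (hψ : ∀ x, ‖ψ x‖ ≤ D / (1 + |x|) ^ 2) : LowKer ψ (5 * D) := by
  have hD : 0 ≤ D := by
    have := (norm_nonneg _).trans (hψ 0)
    simpa using this
  refine ⟨hc, fun x => (hψ x).trans ?_, fun w _ k x => lintegral_sc_le hψ k w x⟩
  refine (div_le_self hD ?_).trans (by linarith)
  have := abs_nonneg x
  nlinarith

lemma LowKer.mono {φ : ℝ → ℂ} {D D' : ℝ} (h : LowKer φ D) (hD : D ≤ D') : LowKer φ D' :=
  ⟨h.cont, fun x => (h.bdd x).trans hD, fun w hw k x => (h.low w hw k x).trans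
    (mul_le_mul_left (ENNReal.ofReal_le_ofReal hD) _)⟩

lemma sc_const_mul (k : ℤ) (c : ℂ) (φ : ℝ → ℂ) (x : ℝ) :
    sc k (fun y => c * φ y) x = c * sc k φ x := by
  simp only [sc]; ring

lemma sc_sc (k l : ℤ) (φ : ℝ → ℂ) : sc k (sc l φ) = sc (k + l) φ := by
  ext x
  simp only [sc, zpow_add₀ (two_ne_zero' ℝ)]
  push_cast
  rw [show (2 : ℝ) ^ l * (2 ^ k * x) = 2 ^ k * 2 ^ l * x by ring]
  ring

lemma LowKer.const_mul {φ : ℝ → ℂ} {D : ℝ} (h : LowKer φ D) (c : ℂ) :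
    LowKer (fun x => c * φ x) (‖c‖ * D) := by
  refine ⟨continuous_const.mul h.cont, fun x => ?_, fun w hw k x => ?_⟩
  · rw [norm_mul]; exact mul_le_mul_of_nonneg_left (h.bdd x) (norm_nonneg _)
  · simp only [sc_const_mul, enorm_mul, mul_assoc]
    rw [lintegral_const_mul' _ _ enorm_ne_top, ENNReal.ofReal_mul (norm_nonneg _), ofReal_norm,
      mul_assoc]
    exact mul_le_mul_right (h.low w hw k x) _

lemma LowKer.sc_neg {φ : ℝ → ℂ} {D : ℝ} (h : LowKer φ D) {l : ℤ} (hl : l ≤ 0) :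
    LowKer (sc l φ) D := by
  refine ⟨continuous_sc h.cont l, fun x => ?_, fun w hw k x => ?_⟩
  · rw [sc, norm_mul, Complex.norm_real, Real.norm_of_nonneg (by positivity)]
    calc _ ≤ 1 * D := mul_le_mul (zpow_le_one_of_nonpos₀ one_le_two hl) (h.bdd _)
            (norm_nonneg _) zero_le_one
      _ = D := one_mul D
  · rw [sc_sc]
    exact (h.low w hw _ x).trans (mul_le_mul_right (mx_mono (by omega) w x) _)

lemma LowKer.lintegral_le {φ : ℝ → ℂ} {D : ℝ} (h : LowKer φ D) :
    ∫⁻ x, ‖φ x‖ₑ ≤ ENNReal.ofReal (3 * D) := by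
  have h1 := (h.low (fun _ => 1) measurable_const 0 0).trans
    (mul_le_mul_right (mx_le_of_le (B := 1) (fun _ => le_rfl) 0 0) _)
  have e : ∀ y, ‖sc 0 φ (0 - y)‖ₑ * 1 = ‖φ (0 - y)‖ₑ := fun y => by simp [sc]
  simp only [e] at h1
  rw [lintegral_sub_left_eq_self (fun y => ‖φ y‖ₑ) 0] at h1
  rw [ENNReal.ofReal_mul (by norm_num), mul_comm]
  simpa using h1

lemma LowKer.integrable {φ : ℝ → ℂ} {D : ℝ} (h : LowKer φ D) : Integrable φ :=
  ⟨h.cont.aestronglyMeasurable, lt_of_le_of_lt h.lintegral_le ENNReal.ofReal_lt_top⟩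

lemma LowKer.integral_norm_le {φ : ℝ → ℂ} {D : ℝ} (h : LowKer φ D) :
    ∫ x, ‖φ x‖ ≤ 3 * D := by
  rw [integral_norm_eq_lintegral_enorm h.cont.aestronglyMeasurable]
  exact ENNReal.toReal_le_of_le_ofReal (by linarith [h.nonneg]) h.lintegral_le

lemma LowKer.norm_fourier_le {φ : ℝ → ℂ} {D : ℝ} (h : LowKer φ D) (ξ : ℝ) :
    ‖𝓕 φ ξ‖ ≤ 3 * D := by
  refine le_trans ?_ h.integral_norm_le
  exact VectorFourier.norm_fourierIntegral_le_integral_norm _ _ _ φ ξ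

lemma LowKer.tsum {κ : ℕ → ℝ → ℂ} {D : ℕ → ℝ} (h : ∀ n, LowKer (κ n) (D n)) (hD : Summable D) :
    LowKer (fun x => ∑' n, κ n x) (∑' n, D n) ∧
      ∀ ξ, HasSum (fun n => 𝓕 (κ n) ξ) (𝓕 (fun x => ∑' n, κ n x) ξ) := by
  have hs : ∀ x, Summable fun n => ‖κ n x‖ := fun x =>
    Summable.of_nonneg_of_le (fun _ => norm_nonneg _) (fun n => (h n).bdd x) hD
  have hle : ∀ x, ‖∑' n, κ n x‖ₑ ≤ ∑' n, ‖κ n x‖ₑ := fun x => enorm_tsum_le_tsum_enorm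
  refine ⟨⟨continuous_tsum (fun n => (h n).cont) hD fun n x => (h n).bdd x, fun x => ?_,
    fun w hw k x => ?_⟩, fun ξ => ?_⟩
  · exact tsum_of_norm_bounded hD.hasSum fun n => (h n).bdd x
  · calc ∫⁻ y, ‖sc k (fun x => ∑' n, κ n x) (x - y)‖ₑ * w y
        ≤ ∫⁻ y, ∑' n, ‖sc k (κ n) (x - y)‖ₑ * w y := by
          refine lintegral_mono fun y => ?_
          rw [ENNReal.tsum_mul_right]
          refine mul_le_mul_left ?_ _
          simp only [enorm_sc]
          rw [ENNReal.tsum_mul_left]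
          exact mul_le_mul_right (hle _) _
      _ = ∑' n, ∫⁻ y, ‖sc k (κ n) (x - y)‖ₑ * w y := by
          refine lintegral_tsum fun n => ?_
          have := continuous_sc (h n).cont k
          exact ((by fun_prop : Continuous fun y => sc k (κ n) (x - y)).measurable.enorm.mul
            hw).aemeasurable
      _ ≤ ∑' n, ENNReal.ofReal (D n) * mx k w x := ENNReal.tsum_le_tsum fun n => (h n).low w hw k x
      _ = _ := by
          rw [ENNReal.tsum_mul_right, ENNReal.ofReal_tsum_of_nonneg (fun n => (h n).nonneg) hD]
  · simp only [fourier_eq_char]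
    have := hasSum_integral_of_summable_integral_norm (μ := volume)
      (F := fun n v => (𝐞 (-(v * ξ)) : ℂ) * κ n v)
      (fun n => integrable_char_mul (by fun_prop) (h n).integrable) ?_
    · simpa only [tsum_mul_left] using this
    · simp only [norm_mul, Circle.norm_coe, one_mul]
      exact Summable.of_nonneg_of_le (fun n => integral_nonneg fun _ => norm_nonneg _)
        (fun n => (h n).integral_norm_le) (hD.mul_left 3)

lemma LowKer.enorm_cv_le {φ : ℝ → ℂ} {D : ℝ} (h : LowKer φ D) {F : ℝ → ℂ} (hF : Measurable F)
    (k : ℤ) (x : ℝ) :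
    ‖cv k φ F x‖ₑ ≤ ENNReal.ofReal D * mx k (fun y => ‖F y‖ₑ) x :=
  (_root_.enorm_cv_le k φ F x).trans (h.low _ hF.enorm k x)

lemma LPKer.lowKer {ψ : ℝ → ℂ} {D : ℝ} (h : LPKer ψ D) : LowKer ψ (5 * D) :=
  LowKer.of_bound h.cont h.bound

/-! ### Frequency side of rescaled convolutions -/

lemma integrable_sc {ψ : ℝ → ℂ} (h : Integrable ψ) (k : ℤ) : Integrable (sc k ψ) :=
  (h.comp_mul_left' (by positivity)).const_mul _

lemma fourier_sc (k : ℤ) (ψ : ℝ → ℂ) (ξ : ℝ) : 𝓕 (sc k ψ) ξ = 𝓕 ψ (2 ^ (-k) * ξ) := by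
  have hk : (2 : ℝ) ^ k ≠ 0 := by positivity
  have := Measure.integral_comp_mul_left
    (fun v => (𝐞 (-(v * (2 ^ (-k) * ξ))) : ℂ) * ψ v) ((2 : ℝ) ^ k)
  rw [abs_of_pos (by positivity), Complex.real_smul, ← fourier_eq_char] at this
  have h2 : 𝓕 ψ (2 ^ (-k) * ξ) = ((2 : ℝ) ^ k : ℝ) *
      ∫ x, (𝐞 (-(2 ^ k * x * (2 ^ (-k) * ξ))) : ℂ) * ψ (2 ^ k * x) := by
    rw [this, ← mul_assoc, ← Complex.ofReal_mul, mul_inv_cancel₀ hk, Complex.ofReal_one, one_mul]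
  rw [h2, ← integral_const_mul, fourier_eq_char]
  refine integral_congr_ae (Eventually.of_forall fun x => ?_)
  have e : (2 : ℝ) ^ k * x * (2 ^ (-k) * ξ) = x * ξ := by
    rw [zpow_neg]; field_simp
  simp only [sc, e]
  ring

lemma continuous_fourierInv {f : ℝ → ℂ} (hf : Integrable f) : Continuous (𝓕⁻ f) := by
  simp only [funext (Real.fourierInv_eq_fourier_neg f)]
  exact (VectorFourier.fourierIntegral_continuous Real.continuous_fourierChar
    (L := innerₗ ℝ) continuous_inner hf).comp continuous_neg

lemma continuous_fourier {f : ℝ → ℂ} (hf : Integrable f) : Continuous (𝓕 f) :=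
  VectorFourier.fourierIntegral_continuous Real.continuous_fourierChar
    (L := innerₗ ℝ) continuous_inner hf

lemma norm_fourierInv_le (f : ℝ → ℂ) (x : ℝ) : ‖𝓕⁻ f x‖ ≤ ∫ y, ‖f y‖ := by
  rw [fourierInv_eq_char]
  exact (norm_integral_le_integral_norm _).trans_eq
    (by simp only [norm_mul, Circle.norm_coe, one_mul])

lemma integral_mul_fourierInv {f g : ℝ → ℂ} (hf : Integrable f) (hg : Integrable g) :
    ∫ x, f x * 𝓕⁻ g x = ∫ x, 𝓕⁻ f x * g x := by
  have := VectorFourier.integral_fourierIntegral_smul_eq_flip (μ := volume) (ν := volume)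
    (L := -innerₗ ℝ) Real.continuous_fourierChar 
    (show Continuous fun p : ℝ × ℝ => -(inner ℝ p.1 p.2) from continuous_inner.neg) hf hg
  simp only [smul_eq_mul] at this
  refine Eq.trans ?_ (this.symm.trans ?_)
  · refine integral_congr_ae (Eventually.of_forall fun x => ?_)
    simp only [VectorFourier.fourierIntegral, fourierInv_eq_char, Circle.smul_def, smul_eq_mul]
    simp [mul_comm]
  · refine integral_congr_ae (Eventually.of_forall fun x => ?_)
    simp only [VectorFourier.fourierIntegral, fourierInv_eq_char, Circle.smul_def, smul_eq_mul]
    simp [mul_comm]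

lemma fourierInv_char_mul (f : ℝ → ℂ) (a x : ℝ) :
    𝓕⁻ (fun y => (𝐞 (y * a) : ℂ) * f y) x = 𝓕⁻ f (x + a) := by
  simp only [fourierInv_eq_char]
  refine integral_congr_ae (Eventually.of_forall fun y => ?_)
  simp only [mul_add, char_add]
  ring

lemma cv_fourierInv {ψ A : ℝ → ℂ} (hψ : Integrable ψ) (hA : Integrable A) (k : ℤ) (x : ℝ) :
    cv k ψ (𝓕⁻ A) x = 𝓕⁻ (fun ξ => 𝓕 ψ (2 ^ (-k) * ξ) * A ξ) x := by
  have h1 : cv k ψ (𝓕⁻ A) x = ∫ y, sc k ψ y * 𝓕⁻ A (x - y) := by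
    rw [cv, ← integral_sub_left_eq_self (fun y => sc k ψ y * 𝓕⁻ A (x - y)) volume x]
    simp
  have h2 : ∀ y, 𝓕⁻ A (x - y) = 𝓕⁻ (fun ξ => (𝐞 (-(ξ * x)) : ℂ) * A (-ξ)) y := fun y => by
    simp only [fourierInv_eq_char]
    rw [← integral_neg_eq_self]
    refine integral_congr_ae (Eventually.of_forall fun z => ?_)
    simp only
    rw [← mul_assoc, ← char_add]
    congr 3; ring
  simp only [h1, h2]
  rw [integral_mul_fourierInv (integrable_sc hψ k) (integrable_char_mul (by fun_prop) hA.comp_neg)]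
  simp only [Real.fourierInv_eq_fourier_neg (sc k ψ), fourier_sc]
  rw [fourierInv_eq_char, ← integral_neg_eq_self]
  refine integral_congr_ae (Eventually.of_forall fun z => ?_)
  simp only [neg_neg, neg_mul]
  ring

lemma integrable_cv {φ h : ℝ → ℂ} (hφ : Integrable φ) (hh : Integrable h) (k : ℤ) :
    Integrable (cv k φ h) := by
  have := (hh.integrable_convolution (ContinuousLinearMap.mul ℂ ℂ) (integrable_sc hφ k))
  refine this.congr (Eventually.of_forall fun x => ?_)
  simp only [convolution, cv, ContinuousLinearMap.mul_apply', mul_comm]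

lemma fourierInv_cv {φ h : ℝ → ℂ} (hφ : Integrable φ) (hh : Integrable h) (k : ℤ) (ζ : ℝ) :
    𝓕⁻ (cv k φ h) ζ = 𝓕 φ (-(2 ^ (-k) * ζ)) * 𝓕⁻ h ζ := by
  have := Real.fourier_mul_convolution_eq hh (integrable_sc hφ k) (-ζ)
  rw [fourier_sc] at this
  rw [Real.fourierInv_eq_fourier_neg, Real.fourierInv_eq_fourier_neg, ← mul_neg,
    mul_comm (𝓕 φ _), ← this]
  refine congrFun (congrArg _ (funext fun x => ?_)) _
  simp only [convolution, cv, ContinuousLinearMap.mul_apply', mul_comm]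

/-- The trilinear form with symbol `p`. -/
def triForm (p : ℝ → ℝ → ℂ) (A B h : ℝ → ℂ) : ℂ :=
  ∫ z : ℝ × ℝ, p z.1 z.2 * A z.1 * B z.2 * 𝓕⁻ h (z.1 + z.2)

lemma integrable_triForm {p : ℝ → ℝ → ℂ} {P : ℝ} (hpm : Measurable fun z : ℝ × ℝ => p z.1 z.2)
    (hp : ∀ ξ η, ‖p ξ η‖ ≤ P) {A B h : ℝ → ℂ} (hA : Integrable A) (hB : Integrable B)
    (hh : Integrable h) :
    Integrable fun z : ℝ × ℝ => p z.1 z.2 * A z.1 * B z.2 * 𝓕⁻ h (z.1 + z.2) := by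
  have h1 : Integrable fun z : ℝ × ℝ => A z.1 * B z.2 := hA.mul_prod hB
  have h2 : Integrable fun z : ℝ × ℝ => (p z.1 z.2 * 𝓕⁻ h (z.1 + z.2)) * (A z.1 * B z.2) := by
    refine h1.bdd_mul (c := P * ∫ y, ‖h y‖) ?_ (Eventually.of_forall fun z => ?_)
    · exact (hpm.mul ((continuous_fourierInv hh).measurable.comp
        (measurable_fst.add measurable_snd))).aestronglyMeasurable
    · rw [norm_mul]
      exact mul_le_mul (hp _ _) (norm_fourierInv_le h _) (norm_nonneg _)
        ((norm_nonneg _).trans (hp 0 0))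
  refine h2.congr (Eventually.of_forall fun z => ?_)
  simp only; ring

lemma integral_integral_mul_fourierInv {P Q R : ℝ → ℂ} (hP : Integrable P) (hQ : Integrable Q)
    (hR : Integrable R) :
    ∫ z : ℝ × ℝ, P z.1 * Q z.2 * 𝓕⁻ R (z.1 + z.2) = ∫ x, 𝓕⁻ P x * 𝓕⁻ Q x * R x := by
  have hi := integrable_triForm (p := fun _ _ => 1) (P := 1) measurable_const
    (fun _ _ => by simp) hP hQ hR
  simp only [one_mul] at hi
  rw [Measure.volume_eq_prod, integral_prod_symm _ hi]
  have hPR : Integrable fun x => 𝓕⁻ P x * R x :=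
    hR.bdd_mul (continuous_fourierInv hP).aestronglyMeasurable
      (Eventually.of_forall (norm_fourierInv_le P))
  have e1 : ∀ η, ∫ ξ, P ξ * Q η * 𝓕⁻ R (ξ + η) = Q η * 𝓕⁻ (fun x => 𝓕⁻ P x * R x) η := fun η => by
    simp only [← fourierInv_char_mul R η, mul_right_comm _ (Q η)]
    rw [integral_mul_const, integral_mul_fourierInv hP (integrable_char_mul (by fun_prop) hR),
      mul_comm, fourierInv_eq_char]
    congr 1
    refine integral_congr_ae (Eventually.of_forall fun z => ?_)
    simp only; ring
  simp only [e1]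
  rw [integral_mul_fourierInv hQ hPR]
  refine integral_congr_ae (Eventually.of_forall fun z => ?_)
  simp only; ring

lemma triForm_product {ψ₁ ψ₂ φ A B h : ℝ → ℂ} (h₁ : Integrable ψ₁) (h₂ : Integrable ψ₂)
    (hφ : Integrable φ) (hA : Integrable A) (hB : Integrable B) (hh : Integrable h) (k : ℤ) :
    triForm (fun ξ η => 𝓕 ψ₁ (2 ^ (-k) * ξ) * 𝓕 ψ₂ (2 ^ (-k) * η) *
      𝓕 φ (-(2 ^ (-k) * ξ + 2 ^ (-k) * η))) A B h =
      ∫ x, cv k ψ₁ (𝓕⁻ A) x * cv k ψ₂ (𝓕⁻ B) x * cv k φ h x := by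
  have hb : ∀ {ψ : ℝ → ℂ} {A : ℝ → ℂ}, Integrable ψ → Integrable A →
      Integrable fun ξ => 𝓕 ψ (2 ^ (-k) * ξ) * A ξ := fun {ψ A} hψ hA => by
    refine hA.bdd_mul (c := ∫ y, ‖ψ y‖) ?_ (Eventually.of_forall fun ξ => ?_)
    · exact ((continuous_fourier hψ).comp (continuous_const.mul continuous_id)).aestronglyMeasurable
    · exact VectorFourier.norm_fourierIntegral_le_integral_norm _ _ _ ψ _
  simp only [cv_fourierInv h₁ hA, cv_fourierInv h₂ hB]
  rw [← integral_integral_mul_fourierInv (hb h₁ hA) (hb h₂ hB) (integrable_cv hφ hh k)]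
  refine integral_congr_ae (Eventually.of_forall fun z => ?_)
  simp only [fourierInv_cv hφ hh, mul_add]
  ring

lemma IsBddTest.integrable {h : ℝ → ℂ} (hh : IsBddTest h) : Integrable h := by
  obtain ⟨hm, B, hB⟩ := hh
  refine Integrable.mono' (g := (Icc (-B) B).indicator fun _ => B)
    ((integrable_indicator_iff measurableSet_Icc).2 (integrableOn_const (by simp)))
    hm.aestronglyMeasurable (Eventually.of_forall fun x => ?_)
  by_cases hx : x ∈ Icc (-B) B
  · rw [indicator_of_mem hx]; exact (hB x).1
  · rw [indicator_of_notMem hx, (hB x).2 (by rw [← not_le, abs_le]; exact hx), norm_zero]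

/-- The integral of the product of the three maximal functions. -/
def maxForm (F G h : ℝ → ℂ) : ℝ≥0∞ :=
  ∫⁻ x, Mx (fun y => ‖F y‖ₑ) x * Mx (fun y => ‖G y‖ₑ) x * Mx (fun y => ‖h y‖ₑ) x

/-- Symbols at unit scale whose dyadic rescalings give trilinear forms that are summable over the
scales, with a bound by maximal functions. -/
structure GoodSym (p : ℝ → ℝ → ℂ) (C : ℝ≥0∞) : Prop where
  meas : Measurable fun z : ℝ × ℝ => p z.1 z.2
  bdd : ∃ P : ℝ, ∀ ξ η, ‖p ξ η‖ ≤ P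
  sum_le : ∀ A B h : ℝ → ℂ, Integrable A → Integrable B → IsBddTest h → ∀ K0 K : ℤ,
    ∑ k ∈ Finset.Icc K0 K, ‖triForm (fun ξ η => p (2 ^ (-k) * ξ) (2 ^ (-k) * η)) A B h‖ₑ ≤
      C * maxForm (𝓕⁻ A) (𝓕⁻ B) h

lemma measurable_fourierInv {A : ℝ → ℂ} (hA : Integrable A) : Measurable (𝓕⁻ A) :=
  (continuous_fourierInv hA).measurable

lemma exists_common_bound {A B h : ℝ → ℂ} (hh : IsBddTest h) : ∃ M : ℝ≥0,
    (∀ x, ‖𝓕⁻ A x‖ₑ ≤ M) ∧ (∀ x, ‖𝓕⁻ B x‖ₑ ≤ M) ∧ ∀ x, ‖h x‖ₑ ≤ M := by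
  obtain ⟨_, b, hb⟩ := hh
  refine ⟨Real.toNNReal ((∫ y, ‖A y‖) + (∫ y, ‖B y‖) + |b|), fun x => ?_, fun x => ?_,
    fun x => ?_⟩
  all_goals
    rw [← ofReal_norm]
    refine ENNReal.ofReal_le_ofReal ?_
    have h1 : 0 ≤ ∫ y, ‖A y‖ := integral_nonneg fun _ => norm_nonneg _
    have h2 : 0 ≤ ∫ y, ‖B y‖ := integral_nonneg fun _ => norm_nonneg _
    have h3 := abs_nonneg b
  · linarith [norm_fourierInv_le A x]
  · linarith [norm_fourierInv_le B x]
  · linarith [(hb x).1, le_abs_self b]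

lemma enorm_triForm_product_le {ψ₁ ψ₂ φ A B h : ℝ → ℂ} (h₁ : Integrable ψ₁) (h₂ : Integrable ψ₂)
    (hφ : Integrable φ) (hA : Integrable A) (hB : Integrable B) (hh : Integrable h) (k : ℤ) :
    ‖triForm (fun ξ η => 𝓕 ψ₁ (2 ^ (-k) * ξ) * 𝓕 ψ₂ (2 ^ (-k) * η) *
      𝓕 φ (-(2 ^ (-k) * ξ + 2 ^ (-k) * η))) A B h‖ₑ ≤
      ∫⁻ x, ‖cv k ψ₁ (𝓕⁻ A) x‖ₑ * ‖cv k ψ₂ (𝓕⁻ B) x‖ₑ * ‖cv k φ h x‖ₑ := by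
  rw [triForm_product h₁ h₂ hφ hA hB hh]
  refine (enorm_integral_le_lintegral_enorm _).trans_eq ?_
  simp only [enorm_mul]

lemma measurable_product_symbol {ψ₁ ψ₂ φ : ℝ → ℂ} (h₁ : Integrable ψ₁) (h₂ : Integrable ψ₂)
    (hφ : Integrable φ) :
    Measurable fun z : ℝ × ℝ => 𝓕 ψ₁ z.1 * 𝓕 ψ₂ z.2 * 𝓕 φ (-(z.1 + z.2)) := by
  have c1 := continuous_fourier h₁
  have c2 := continuous_fourier h₂
  have c3 := continuous_fourier hφ
  exact Continuous.measurable (by fun_prop)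

lemma bounded_product_symbol {ψ₁ ψ₂ φ : ℝ → ℂ} : ∃ P : ℝ, ∀ ξ η : ℝ,
    ‖𝓕 ψ₁ ξ * 𝓕 ψ₂ η * 𝓕 φ (-(ξ + η))‖ ≤ P := by
  refine ⟨(∫ y, ‖ψ₁ y‖) * (∫ y, ‖ψ₂ y‖) * ∫ y, ‖φ y‖, fun ξ η => ?_⟩
  rw [norm_mul, norm_mul]
  gcongr <;> exact VectorFourier.norm_fourierIntegral_le_integral_norm _ _ _ _ _

lemma goodSym_low_sum {ψ₁ ψ₂ φ : ℝ → ℂ} {D₁ D₂ D₃ : ℝ} (h₁ : LPKer ψ₁ D₁) (h₂ : LPKer ψ₂ D₂)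
    (hφ : LowKer φ D₃) (hD₁ : 0 < D₁) (hD₂ : 0 < D₂) :
    GoodSym (fun ξ η => 𝓕 ψ₁ ξ * 𝓕 ψ₂ η * 𝓕 φ (-(ξ + η)))
      (200000000 * (ENNReal.ofReal D₁ * ENNReal.ofReal D₂ * ENNReal.ofReal D₃)) := by
  refine ⟨measurable_product_symbol h₁.lowKer.integrable h₂.lowKer.integrable hφ.integrable,
    bounded_product_symbol, fun A B h hA hB hh K0 K => ?_⟩
  obtain ⟨M, hM1, hM2, hM3⟩ := exists_common_bound (A := A) (B := B) hh
  refine (Finset.sum_le_sum fun k _ => enorm_triForm_product_le h₁.lowKer.integrable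
    h₂.lowKer.integrable hφ.integrable hA hB hh.integrable k).trans ?_
  exact sum_lintegral_cv_mul_cv_le h₁ h₂ hD₁ hD₂ (measurable_fourierInv hA)
    (measurable_fourierInv hB) hh.1.enorm hM1 hM2 hM3 ENNReal.ofReal_ne_top
    (fun k x => hφ.enorm_cv_le hh.1 k x) K0 K

lemma goodSym_low_right {ψ₁ ψ₂ φ : ℝ → ℂ} {D₁ D₂ D₃ : ℝ} (h₁ : LPKer ψ₁ D₁) (h₂ : LPKer ψ₂ D₂)
    (hφ : LowKer φ D₃) (hD₁ : 0 < D₁) (hD₂ : 0 < D₂) :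
    GoodSym (fun ξ η => 𝓕 ψ₁ ξ * 𝓕 φ η * 𝓕 ψ₂ (-(ξ + η)))
      (200000000 * (ENNReal.ofReal D₁ * ENNReal.ofReal D₂ * ENNReal.ofReal D₃)) := by
  refine ⟨measurable_product_symbol h₁.lowKer.integrable hφ.integrable h₂.lowKer.integrable,
    bounded_product_symbol, fun A B h hA hB hh K0 K => ?_⟩
  obtain ⟨M, hM1, hM2, hM3⟩ := exists_common_bound (A := A) (B := B) hh
  refine (Finset.sum_le_sum fun k _ => enorm_triForm_product_le h₁.lowKer.integrable
    hφ.integrable h₂.lowKer.integrable hA hB hh.integrable k).trans ?_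
  have := sum_lintegral_cv_mul_cv_le h₁ h₂ hD₁ hD₂ (measurable_fourierInv hA)
    hh.1 (measurable_fourierInv hB).enorm hM1 hM3 hM2 ENNReal.ofReal_ne_top
    (fun k x => hφ.enorm_cv_le (measurable_fourierInv hB) k x) K0 K
  simpa only [maxForm, mul_right_comm (Mx (fun y => ‖𝓕⁻ A y‖ₑ) _),
    mul_right_comm ‖cv _ ψ₁ (𝓕⁻ A) _‖ₑ] using this

lemma goodSym_low_left {ψ₁ ψ₂ φ : ℝ → ℂ} {D₁ D₂ D₃ : ℝ} (h₁ : LPKer ψ₁ D₁) (h₂ : LPKer ψ₂ D₂)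
    (hφ : LowKer φ D₃) (hD₁ : 0 < D₁) (hD₂ : 0 < D₂) :
    GoodSym (fun ξ η => 𝓕 φ ξ * 𝓕 ψ₁ η * 𝓕 ψ₂ (-(ξ + η)))
      (200000000 * (ENNReal.ofReal D₁ * ENNReal.ofReal D₂ * ENNReal.ofReal D₃)) := by
  refine ⟨measurable_product_symbol hφ.integrable h₁.lowKer.integrable h₂.lowKer.integrable,
    bounded_product_symbol, fun A B h hA hB hh K0 K => ?_⟩
  obtain ⟨M, hM1, hM2, hM3⟩ := exists_common_bound (A := A) (B := B) hh
  refine (Finset.sum_le_sum fun k _ => enorm_triForm_product_le hφ.integrable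
    h₁.lowKer.integrable h₂.lowKer.integrable hA hB hh.integrable k).trans ?_
  have := sum_lintegral_cv_mul_cv_le h₁ h₂ hD₁ hD₂ (measurable_fourierInv hB)
    hh.1 (measurable_fourierInv hA).enorm hM2 hM3 hM1 ENNReal.ofReal_ne_top
    (fun k x => hφ.enorm_cv_le (measurable_fourierInv hA) k x) K0 K
  have e : ∀ a b c : ℝ≥0∞, a * b * c = b * c * a := fun a b c => by ring
  simpa only [maxForm, e (Mx (fun y => ‖𝓕⁻ A y‖ₑ) _), e ‖cv _ φ (𝓕⁻ A) _‖ₑ] using this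

lemma triForm_add {p₁ p₂ : ℝ → ℝ → ℂ} (hm₁ : Measurable fun z : ℝ × ℝ => p₁ z.1 z.2)
    (hm₂ : Measurable fun z : ℝ × ℝ => p₂ z.1 z.2) {P₁ P₂ : ℝ} (hb₁ : ∀ ξ η, ‖p₁ ξ η‖ ≤ P₁)
    (hb₂ : ∀ ξ η, ‖p₂ ξ η‖ ≤ P₂) {A B h : ℝ → ℂ} (hA : Integrable A) (hB : Integrable B)
    (hh : Integrable h) :
    triForm (fun ξ η => p₁ ξ η + p₂ ξ η) A B h = triForm p₁ A B h + triForm p₂ A B h := by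
  rw [triForm, triForm, triForm, ← integral_add (integrable_triForm hm₁ hb₁ hA hB hh)
    (integrable_triForm hm₂ hb₂ hA hB hh)]
  refine integral_congr_ae (Eventually.of_forall fun z => ?_)
  simp only; ring

lemma GoodSym.meas_scale {p : ℝ → ℝ → ℂ} {C : ℝ≥0∞} (h : GoodSym p C) (k : ℤ) :
    Measurable fun z : ℝ × ℝ => p (2 ^ (-k) * z.1) (2 ^ (-k) * z.2) :=
  h.meas.comp ((measurable_fst.const_mul _).prodMk (measurable_snd.const_mul _))

lemma GoodSym.add {p₁ p₂ : ℝ → ℝ → ℂ} {C₁ C₂ : ℝ≥0∞} (h₁ : GoodSym p₁ C₁) (h₂ : GoodSym p₂ C₂) :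
    GoodSym (fun ξ η => p₁ ξ η + p₂ ξ η) (C₁ + C₂) := by
  obtain ⟨P₁, hP₁⟩ := h₁.bdd
  obtain ⟨P₂, hP₂⟩ := h₂.bdd
  refine ⟨h₁.meas.add h₂.meas, ⟨P₁ + P₂, fun ξ η => (norm_add_le _ _).trans
    (add_le_add (hP₁ ξ η) (hP₂ ξ η))⟩, fun A B h hA hB hh K0 K => ?_⟩
  rw [add_mul]
  refine le_trans ?_ (add_le_add (h₁.sum_le A B h hA hB hh K0 K) (h₂.sum_le A B h hA hB hh K0 K))
  rw [← Finset.sum_add_distrib]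
  refine Finset.sum_le_sum fun k _ => ?_
  rw [triForm_add (h₁.meas_scale k) (h₂.meas_scale k) (fun _ _ => hP₁ _ _) (fun _ _ => hP₂ _ _)
    hA hB hh.integrable]
  exact enorm_add_le _ _

lemma GoodSym.neg {p : ℝ → ℝ → ℂ} {C : ℝ≥0∞} (hp : GoodSym p C) :
    GoodSym (fun ξ η => -p ξ η) C := by
  obtain ⟨P, hP⟩ := hp.bdd
  refine ⟨hp.meas.neg, ⟨P, fun ξ η => by rw [norm_neg]; exact hP ξ η⟩,
    fun A B h hA hB hh K0 K => ?_⟩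
  refine le_trans (le_of_eq ?_) (hp.sum_le A B h hA hB hh K0 K)
  refine Finset.sum_congr rfl fun k _ => ?_
  simp only [triForm, neg_mul, integral_neg, enorm_neg]

/-! ### Plancherel on `L¹ ∩ L²` -/

lemma coeFn_fourierInv_toLp {G : ℝ → ℂ} (hG : Integrable G) (hG2 : MemLp G 2) :
    (𝓕⁻ (hG2.toLp G) : Lp ℂ 2 (volume : Measure ℝ)) =ᵐ[volume] 𝓕⁻ G := by
  refine ae_eq_of_integral_contDiff_smul_eq
    ((Lp.memLp _).locallyIntegrable (by norm_num))
    (continuous_fourierInv hG).locallyIntegrable fun g hg hgs => ?_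
  have hgs' : HasCompactSupport fun x => (g x : ℂ) := hgs.comp_left Complex.ofReal_zero
  have hg' : ContDiff ℝ (⊤ : ℕ∞) fun x => (g x : ℂ) := Complex.ofRealCLM.contDiff.comp hg
  obtain ⟨S, hS⟩ : ∃ S : SchwartzMap ℝ ℂ, ∀ x, S x = g x :=
    ⟨hgs'.toSchwartzMap hg', fun x => rfl⟩
  have h1 := congrArg (fun T => T S)
    (Lp.fourierInv_toTemperedDistribution_eq (hG2.toLp G))
  simp only [TemperedDistribution.fourierInv_apply, Lp.toTemperedDistribution_apply] at h1
  have h2 : ∫ x, g x • (𝓕⁻ (hG2.toLp G) : Lp ℂ 2 (volume : Measure ℝ)) x =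
      ∫ x, S x • (𝓕⁻ (hG2.toLp G) : Lp ℂ 2 (volume : Measure ℝ)) x := by
    simp only [hS, Complex.real_smul, smul_eq_mul]
  rw [h2, ← h1]
  have h3 : ∫ x, (𝓕⁻ S) x • (hG2.toLp G) x = ∫ x, G x * 𝓕⁻ (S : ℝ → ℂ) x := by
    refine integral_congr_ae ?_
    filter_upwards [hG2.coeFn_toLp] with x hx
    rw [hx, smul_eq_mul, mul_comm, SchwartzMap.fourierInv_coe]
  rw [h3, integral_mul_fourierInv hG S.integrable]
  simp only [hS, Complex.real_smul, mul_comm]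

lemma lintegral_enorm_sq_fourierInv {G : ℝ → ℂ} (hG : Integrable G) (hG2 : MemLp G 2) :
    ∫⁻ x, ‖𝓕⁻ G x‖ₑ ^ 2 = ∫⁻ x, ‖G x‖ₑ ^ 2 := by
  have e : ∀ f : ℝ → ℂ, ∫⁻ x, ‖f x‖ₑ ^ 2 = eLpNorm f 2 volume ^ 2 := fun f => by
    rw [eLpNorm_eq_lintegral_rpow_enorm_toReal (by norm_num) (by norm_num), ← ENNReal.rpow_natCast,
      ← ENNReal.rpow_mul]
    norm_num
  have h1 : eLpNorm (𝓕⁻ G) 2 volume = ‖(𝓕⁻ (hG2.toLp G) : Lp ℂ 2 (volume : Measure ℝ))‖ₑ := by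
    rw [← eLpNorm_congr_ae (coeFn_fourierInv_toLp hG hG2), Lp.enorm_def]
  have h2 : ‖(𝓕⁻ (hG2.toLp G) : Lp ℂ 2 (volume : Measure ℝ))‖ = ‖hG2.toLp G‖ := by
    rw [← Lp.norm_fourier_eq, FourierTransform.fourier_fourierInv_eq]
  rw [e, e, h1, ← ofReal_norm, h2, ofReal_norm, Lp.enorm_def, eLpNorm_congr_ae hG2.coeFn_toLp]

/-! ### Kernels of annular symbols -/

/-- Smooth symbols supported in a fixed annulus. -/
structure AnnSym (θ : ℝ → ℂ) : Prop where
  smooth : ContDiff ℝ (⊤ : ℕ∞) θ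
  supp : ∀ ξ, θ ξ ≠ 0 → (2 : ℝ) ^ (-5 : ℤ) ≤ |ξ| ∧ |ξ| ≤ 2 ^ (5 : ℤ)

lemma AnnSym.hasCompactSupport {θ : ℝ → ℂ} (h : AnnSym θ) : HasCompactSupport θ := by
  refine HasCompactSupport.intro (isCompact_Icc (a := -(2 : ℝ) ^ (5 : ℤ)) (b := 2 ^ (5 : ℤ)))
    fun x hx => ?_
  by_contra h0
  exact hx (abs_le.1 (h.supp x h0).2)

lemma AnnSym.exists_schwartz {θ : ℝ → ℂ} (h : AnnSym θ) :
    ∃ S : SchwartzMap ℝ ℂ, ⇑S = 𝓕⁻ θ ∧ 𝓕 (𝓕⁻ θ) = θ := by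
  refine ⟨𝓕⁻ (h.hasCompactSupport.toSchwartzMap h.smooth), ?_, ?_⟩
  · rw [SchwartzMap.fourierInv_coe]; rfl
  · have h2 : ((𝓕 (𝓕⁻ (h.hasCompactSupport.toSchwartzMap h.smooth) : SchwartzMap ℝ ℂ) :
        SchwartzMap ℝ ℂ) : ℝ → ℂ) = (h.hasCompactSupport.toSchwartzMap h.smooth : ℝ → ℂ) := by
      rw [FourierTransform.fourier_fourierInv_eq]
    simp only [SchwartzMap.fourier_coe, SchwartzMap.fourierInv_coe] at h2
    exact h2

lemma schwartz_bound (S : SchwartzMap ℝ ℂ) :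
    ∃ D : ℝ, 0 < D ∧ ∀ x, ‖S x‖ ≤ D / (1 + |x|) ^ 2 := by
  obtain ⟨C0, h0, hC0⟩ := S.decay 0 0
  obtain ⟨C2, h2, hC2⟩ := S.decay 2 0
  refine ⟨2 * C0 + 2 * C2, by positivity, fun x => ?_⟩
  rw [le_div_iff₀ (by positivity)]
  have a0 := hC0 x
  have a2 := hC2 x
  simp only [pow_zero, one_mul, norm_iteratedFDeriv_zero, Real.norm_eq_abs] at a0 a2
  nlinarith [norm_nonneg (S x), mul_nonneg (norm_nonneg (S x)) (sq_nonneg (1 - |x|))]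

lemma shift_weight {D : ℝ} (hD : 0 ≤ D) (x u : ℝ) :
    D / (1 + |x - u|) ^ 2 ≤ D * (1 + |u|) ^ 2 / (1 + |x|) ^ 2 := by
  rw [div_le_div_iff₀ (by positivity) (by positivity), mul_assoc, ← mul_pow]
  refine mul_le_mul_of_nonneg_left (pow_le_pow_left₀ (by positivity) ?_ 2) hD
  have h1 : |x| ≤ |x - u| + |u| := by
    have := abs_add_le (x - u) u
    rwa [sub_add_cancel] at this
  nlinarith [abs_nonneg (x - u), abs_nonneg u, mul_nonneg (abs_nonneg u) (abs_nonneg (x - u))]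

lemma schwartz_diff_bound (S : SchwartzMap ℝ ℂ) :
    ∃ D : ℝ, 0 < D ∧ ∀ x a, ‖S (x - a) - S x‖ ≤ D * |a| * (1 + |a|) ^ 2 / (1 + |x|) ^ 2 := by
  obtain ⟨D, hD, h⟩ := schwartz_bound (SchwartzMap.derivCLM ℂ ℂ S)
  simp only [SchwartzMap.derivCLM_apply] at h
  refine ⟨D, hD, fun x a => ?_⟩
  have hb : ∀ y ∈ segment ℝ x (x - a), ‖deriv S y‖ ≤ D * (1 + |a|) ^ 2 / (1 + |x|) ^ 2 := by
    intro y hy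
    have hya : |x - y| ≤ |a| := by
      rw [segment_eq_uIcc] at hy
      have := abs_sub_left_of_mem_uIcc hy
      rw [abs_sub_comm]
      refine this.trans_eq ?_
      rw [sub_sub_cancel_left, abs_neg]
    have h2 := (h y).trans (by simpa using shift_weight hD.le x (x - y))
    refine h2.trans ?_
    gcongr
  have := (convex_segment x (x - a)).norm_image_sub_le_of_norm_deriv_le
    (fun y _ => S.differentiableAt) hb (left_mem_segment ℝ _ _) (right_mem_segment ℝ _ _)
  refine this.trans_eq ?_
  rw [sub_sub_cancel_left, norm_neg, Real.norm_eq_abs]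
  ring

lemma sum_annulus_le {θ : ℝ → ℂ} (h : AnnSym θ) {B : ℝ≥0∞} (hB : ∀ ξ, ‖θ ξ‖ₑ ^ 2 ≤ B)
    (s : Finset ℤ) (ξ : ℝ) : ∑ k ∈ s, ‖θ (2 ^ (-k) * ξ)‖ₑ ^ 2 ≤ 11 * B := by
  set k0 := Int.log 2 |ξ|
  have hz : ∀ k, k ∉ Finset.Icc (k0 - 5) (k0 + 5) → ‖θ (2 ^ (-k) * ξ)‖ₑ ^ 2 = 0 := by
    intro k hk
    by_contra h0
    have h1 : θ (2 ^ (-k) * ξ) ≠ 0 := fun h1 => h0 (by rw [h1]; simp)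
    obtain ⟨h2, h3⟩ := h.supp _ h1
    rw [abs_mul, abs_of_pos (by positivity : (0:ℝ) < 2 ^ (-k))] at h2 h3
    have hpos : 0 < |ξ| := by
      by_contra hn
      have : |ξ| = 0 := le_antisymm (not_lt.1 hn) (abs_nonneg _)
      rw [this, mul_zero] at h2
      exact absurd h2 (by norm_num)
    have e : ∀ j : ℤ, (2:ℝ) ^ j = 2 ^ (-k) * 2 ^ (j + k) := fun j => by
      rw [← zpow_add₀ (by norm_num)]; congr 1; ring
    rw [e (-5)] at h2
    rw [e 5] at h3
    have h4 := le_of_mul_le_mul_left h2 (by positivity)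
    have h5 := le_of_mul_le_mul_left h3 (by positivity)
    have h6 := Int.zpow_log_le_self (b := 2) (by norm_num) hpos
    have h7 := Int.lt_zpow_succ_log_self (b := 2) (by norm_num) |ξ|
    have h8 := (zpow_lt_zpow_iff_right₀ (by norm_num : (1:ℝ) < 2)).1 (h4.trans_lt (by exact_mod_cast h7))
    have h9 := (zpow_le_zpow_iff_right₀ (by norm_num : (1:ℝ) < 2)).1 (le_trans (by exact_mod_cast h6) h5)
    refine hk (Finset.mem_Icc.2 ⟨?_, ?_⟩) <;> omega
  calc ∑ k ∈ s, ‖θ (2 ^ (-k) * ξ)‖ₑ ^ 2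
      ≤ ∑ k ∈ Finset.Icc (k0 - 5) (k0 + 5), ‖θ (2 ^ (-k) * ξ)‖ₑ ^ 2 :=
        Finset.sum_le_sum_of_ne_zero fun k _ h0 => by_contra fun hk => h0 (hz k hk)
    _ ≤ ∑ _k ∈ Finset.Icc (k0 - 5) (k0 + 5), B := Finset.sum_le_sum fun k _ => hB _
    _ = 11 * B := by
      rw [Finset.sum_const, Int.card_Icc, show k0 + 5 + 1 - (k0 - 5) = 11 by ring, nsmul_eq_mul]
      rfl

lemma memLp_two_cv {ψ G : ℝ → ℂ} {B : ℝ} (hψ : Integrable ψ) (hb : ∀ x, ‖ψ x‖ ≤ B)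
   
    (hG : Integrable G) (k : ℤ) : MemLp (cv k ψ G) 2 := by
  have hi := integrable_cv hψ hG k
  have hbd : ∀ x, ‖cv k ψ G x‖ ≤ 2 ^ k * B * ∫ y, ‖G y‖ := fun x => by
    rw [← integral_const_mul]
    refine norm_integral_le_of_norm_le (hG.norm.const_mul _) (Eventually.of_forall fun y => ?_)
    rw [norm_mul, sc, norm_mul, Complex.norm_real, Real.norm_of_nonneg (by positivity)]
    gcongr
    exact hb _
  refine ⟨hi.aestronglyMeasurable, ?_⟩
  rw [eLpNorm_lt_top_iff_lintegral_rpow_enorm_lt_top two_ne_zero (by norm_num)]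
  simp only [ENNReal.toReal_ofNat, ENNReal.rpow_ofNat]
  calc ∫⁻ x, ‖cv k ψ G x‖ₑ ^ 2
      ≤ ∫⁻ x, ENNReal.ofReal (2 ^ k * B * ∫ y, ‖G y‖) * ‖cv k ψ G x‖ₑ := by
        refine lintegral_mono fun x => ?_
        rw [pow_two]
        exact mul_le_mul_left (by rw [← ofReal_norm]; exact ENNReal.ofReal_le_ofReal (hbd x)) _
    _ = ENNReal.ofReal (2 ^ k * B * ∫ y, ‖G y‖) * ∫⁻ x, ‖cv k ψ G x‖ₑ :=
        lintegral_const_mul' _ _ ENNReal.ofReal_ne_top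
    _ < ∞ := ENNReal.mul_lt_top ENNReal.ofReal_lt_top hi.2

lemma fourier_shift (ψ : ℝ → ℂ) (u ξ : ℝ) :
    𝓕 (fun x => ψ (x - u)) ξ = 𝐞 (-(u * ξ)) * 𝓕 ψ ξ := by
  rw [fourier_eq_char, fourier_eq_char, ← integral_const_mul,
    ← integral_add_right_eq_self _ u]
  refine integral_congr_ae (Eventually.of_forall fun x => ?_)
  simp only [add_sub_cancel_right, add_mul, neg_add, char_add]
  ring

lemma norm_le_of_annSym {θ : ℝ → ℂ} (h : AnnSym θ) : ∃ B : ℝ, 0 ≤ B ∧ ∀ ξ, ‖θ ξ‖ ≤ B := by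
  obtain ⟨S, hS, hθ⟩ := h.exists_schwartz
  refine ⟨∫ x, ‖𝓕⁻ θ x‖, integral_nonneg fun _ => norm_nonneg _, fun ξ => ?_⟩
  conv_lhs => rw [← hθ]
  exact VectorFourier.norm_fourierIntegral_le_integral_norm _ _ _ _ _

lemma sum_lintegral_cv_annSym_le {θ ψ : ℝ → ℂ} (hθ : AnnSym θ) {B : ℝ} (hB : ∀ ξ, ‖θ ξ‖ ≤ B)
    (hψ : Integrable ψ) {B' : ℝ} (hb : ∀ x, ‖ψ x‖ ≤ B')
    (h : ∀ ξ, ‖𝓕 ψ ξ‖ = ‖θ ξ‖) {G : ℝ → ℂ} (hG : Integrable G) (hG2 : MemLp G 2) (s : Finset ℤ) :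
    ∑ k ∈ s, ∫⁻ x, ‖cv k ψ G x‖ₑ ^ 2 ≤ 11 * ENNReal.ofReal B ^ 2 * ∫⁻ x, ‖G x‖ₑ ^ 2 := by
  have e : ∀ k : ℤ, ∫⁻ x, ‖cv k ψ G x‖ₑ ^ 2 =
      ∫⁻ ζ, ‖θ (2 ^ (-k) * -ζ)‖ₑ ^ 2 * ‖𝓕⁻ G ζ‖ₑ ^ 2 := fun k => by
    rw [← lintegral_enorm_sq_fourierInv (integrable_cv hψ hG k) (memLp_two_cv hψ hb hG k)]
    refine lintegral_congr fun ζ => ?_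
    rw [fourierInv_cv hψ hG, enorm_mul, mul_pow, ← ofReal_norm (𝓕 ψ _), h, ofReal_norm, mul_neg]
  have hmθ : Measurable θ := hθ.smooth.continuous.measurable
  have hmG : Measurable (𝓕⁻ G) := measurable_fourierInv hG
  simp only [e]
  rw [← lintegral_finsetSum _ (fun k _ => by fun_prop), ← lintegral_enorm_sq_fourierInv hG hG2,
    ← lintegral_const_mul' _ _ (by finiteness)]
  refine lintegral_mono fun ζ => ?_
  rw [← Finset.sum_mul]
  refine mul_le_mul_left (sum_annulus_le hθ (fun ξ => ?_) s (-ζ)) _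
  gcongr
  rw [← ofReal_norm]
  exact ENNReal.ofReal_le_ofReal (hB ξ)

lemma schwartz_lintegral_diff (S : SchwartzMap ℝ ℂ) : ∃ D : ℝ, 0 < D ∧ ∀ a,
    ∫⁻ x, ‖S (x + a) - S x‖ₑ ≤ ENNReal.ofReal (D * |a|) := by
  obtain ⟨D₁, hD₁, h₁⟩ := schwartz_bound S
  obtain ⟨D₂, hD₂, h₂⟩ := schwartz_diff_bound S
  refine ⟨30 * D₁ + 60 * D₂, by positivity, fun a => ?_⟩
  rcases le_total |a| 1 with ha | ha
  · have hk : LowKer (fun x => S (x + a) - S x) (5 * (4 * D₂ * |a|)) := by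
      refine LowKer.of_bound (by fun_prop) fun x => ?_
      have := h₂ x (-a)
      rw [abs_neg, sub_neg_eq_add] at this
      refine this.trans ?_
      refine div_le_div_of_nonneg_right ?_ (by positivity)
      nlinarith [mul_nonneg hD₂.le (abs_nonneg a), abs_nonneg a,
        mul_nonneg (mul_nonneg hD₂.le (abs_nonneg a)) (by nlinarith [abs_nonneg a] : 0 ≤ 4 - (1 + |a|) ^ 2)]
    refine hk.lintegral_le.trans (ENNReal.ofReal_le_ofReal ?_)
    nlinarith [mul_nonneg hD₁.le (abs_nonneg a)]
  · have h3 := (LowKer.of_bound S.continuous h₁).lintegral_le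
    calc ∫⁻ x, ‖S (x + a) - S x‖ₑ ≤ ∫⁻ x, (‖S (x + a)‖ₑ + ‖S x‖ₑ) :=
          lintegral_mono fun x => enorm_sub_le
      _ = (∫⁻ x, ‖S x‖ₑ) + ∫⁻ x, ‖S x‖ₑ := by
          rw [lintegral_add_right _ S.continuous.measurable.enorm,
            lintegral_add_right_eq_self (fun x => ‖S x‖ₑ) a]
      _ ≤ ENNReal.ofReal (3 * (5 * D₁)) + ENNReal.ofReal (3 * (5 * D₁)) := add_le_add h3 h3
      _ = ENNReal.ofReal (30 * D₁) := by
          rw [← ENNReal.ofReal_add (by positivity) (by positivity)]; congr 1; ring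
      _ ≤ _ := ENNReal.ofReal_le_ofReal (by
          nlinarith [mul_nonneg hD₁.le (sub_nonneg.2 ha), mul_nonneg hD₂.le (abs_nonneg a)])

lemma AnnSym.exists_lpKer {θ : ℝ → ℂ} (h : AnnSym θ) : ∃ D : ℝ, 0 < D ∧
    ∀ u, LPKer (fun x => 𝓕⁻ θ (x - u)) (D * (1 + |u|) ^ 2) := by
  obtain ⟨S, hS, hθ⟩ := h.exists_schwartz
  obtain ⟨D₁, hD₁, h₁⟩ := schwartz_bound S
  obtain ⟨D₂, hD₂, h₂⟩ := schwartz_lintegral_diff S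
  obtain ⟨B, hB0, hB⟩ := norm_le_of_annSym h
  have hle : ∀ u : ℝ, 1 ≤ (1 + |u|) ^ 2 := fun u => one_le_pow₀ (by linarith [abs_nonneg u])
  rw [← hS] at hθ ⊢
  refine ⟨D₁ + D₂ + 11 * B, by positivity, fun u => ?_⟩
  have hb : ∀ x, ‖S (x - u)‖ ≤ D₁ * (1 + |u|) ^ 2 / (1 + |x|) ^ 2 := fun x =>
    (h₁ _).trans (shift_weight hD₁.le x u)
  refine ⟨by fun_prop, fun x => (hb x).trans ?_, fun a => ?_, fun G hG hG2 s => ?_⟩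
  · gcongr; linarith
  · have e := lintegral_sub_right_eq_self (μ := volume) (fun x => ‖S (x + a) - S x‖ₑ) u
    simp only [sub_add_eq_add_sub] at e
    simp only [e]
    refine (h₂ a).trans (ENNReal.ofReal_le_ofReal ?_)
    refine mul_le_mul_of_nonneg_right ?_ (abs_nonneg a)
    calc D₂ ≤ (D₁ + D₂ + 11 * B) * 1 := by linarith
      _ ≤ _ := mul_le_mul_of_nonneg_left (hle u) (by positivity)
  · refine (sum_lintegral_cv_annSym_le h hB (S.integrable.comp_sub_right u)
      (B' := D₁) (fun x => (h₁ _).trans (div_le_self hD₁.le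
        (one_le_pow₀ (by linarith [abs_nonneg (x - u)])))) (fun ξ => ?_) hG hG2 s).trans ?_
    · rw [fourier_shift, norm_mul, Circle.norm_coe, one_mul, hθ]
    · refine mul_le_mul_left ?_ _
      calc 11 * ENNReal.ofReal B ^ 2 ≤ (11 * ENNReal.ofReal B) ^ 2 := by
            rw [mul_pow]; refine mul_le_mul_left ?_ _; norm_num
        _ = ENNReal.ofReal (11 * B) ^ 2 := by
            rw [ENNReal.ofReal_mul (by norm_num), ENNReal.ofReal_ofNat]
        _ ≤ _ := by
            refine pow_le_pow_left' (ENNReal.ofReal_le_ofReal ?_) 2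
            calc 11 * B ≤ (D₁ + D₂ + 11 * B) * 1 := by linarith
              _ ≤ _ := mul_le_mul_of_nonneg_left (hle u) (by positivity)

/-! ### Cutoff functions -/

/-- A smooth even cutoff, equal to `1` on `[-1, 1]` and supported in `[-2, 2]`. -/
def phi (x : ℝ) : ℝ := (⟨1, 2, one_pos, one_lt_two⟩ : ContDiffBump (0 : ℝ)) x

lemma contDiff_phi : ContDiff ℝ (⊤ : ℕ∞) phi := ContDiffBump.contDiff _

lemma phi_nonneg (x : ℝ) : 0 ≤ phi x := ContDiffBump.nonneg _

lemma phi_le_one (x : ℝ) : phi x ≤ 1 := ContDiffBump.le_one _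

lemma phi_eq_one {x : ℝ} (hx : |x| ≤ 1) : phi x = 1 :=
  ContDiffBump.one_of_mem_closedBall _ (by simpa using hx)

lemma phi_eq_zero {x : ℝ} (hx : 2 ≤ |x|) : phi x = 0 :=
  ContDiffBump.zero_of_le_dist _ (by simpa using hx)

lemma phi_neg (x : ℝ) : phi (-x) = phi x := ContDiffBump.neg _ _

/-- The difference of two rescaled cutoffs, supported in an annulus. -/
def ph (a b x : ℝ) : ℝ := phi (a * x) - phi (b * x)

lemma contDiff_ph (a b : ℝ) : ContDiff ℝ (⊤ : ℕ∞) (ph a b) := by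
  have h := contDiff_phi
  unfold ph
  fun_prop

lemma ph_neg (a b x : ℝ) : ph a b (-x) = ph a b x := by
  simp only [ph, mul_neg, phi_neg]

lemma ph_eq_one {a b x : ℝ} (ha : |a * x| ≤ 1) (hb : 2 ≤ |b * x|) : ph a b x = 1 := by
  rw [ph, phi_eq_one ha, phi_eq_zero hb, sub_zero]

lemma ph_supp {a b x : ℝ} (ha : 0 < a) (hab : a ≤ b) (hx : ph a b x ≠ 0) :
    1 ≤ b * |x| ∧ a * |x| ≤ 2 := by
  have hb : 0 < b := ha.trans_le hab
  constructor
  · by_contra! h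
    refine hx ?_
    rw [ph, phi_eq_one, phi_eq_one, sub_self]
    · rw [abs_mul, abs_of_pos hb]; exact h.le
    · rw [abs_mul, abs_of_pos ha]
      exact (mul_le_mul_of_nonneg_right hab (abs_nonneg x)).trans h.le
  · by_contra! h
    refine hx ?_
    rw [ph, phi_eq_zero, phi_eq_zero, sub_self]
    · rw [abs_mul, abs_of_pos hb]
      exact h.le.trans (mul_le_mul_of_nonneg_right hab (abs_nonneg x))
    · rw [abs_mul, abs_of_pos ha]; exact h.le

lemma contDiff_mul_abs_rpow {θ : ℝ → ℝ} (hθ : ContDiff ℝ (⊤ : ℕ∞) θ) {r : ℝ} (hr : 0 < r)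
    (h0 : ∀ x, |x| < r → θ x = 0) (σ : ℝ) :
    ContDiff ℝ (⊤ : ℕ∞) fun x => θ x * |x| ^ σ := by
  rw [contDiff_iff_contDiffAt]
  intro x
  by_cases hx : x = 0
  · subst hx
    refine (contDiffAt_const (c := (0 : ℝ))).congr_of_eventuallyEq ?_
    filter_upwards [Metric.ball_mem_nhds (0 : ℝ) hr] with y hy
    rw [h0 y (by simpa using hy), zero_mul]
  · exact hθ.contDiffAt.mul ((contDiffAt_abs hx).rpow_const_of_ne (abs_ne_zero.2 hx))

lemma annSym_ph {a b : ℝ} (ha : 1 / 16 ≤ a) (hab : a ≤ b) (hb : b ≤ 32) (σ : ℝ) :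
    AnnSym fun ξ => ((ph a b ξ * |ξ| ^ σ : ℝ) : ℂ) := by
  have hs : ∀ x, ph a b x ≠ 0 → 1 / 32 ≤ |x| ∧ |x| ≤ 32 := fun x hx => by
    obtain ⟨h1, h2⟩ := ph_supp (by linarith) hab hx
    constructor
    · nlinarith [mul_le_mul_of_nonneg_right hb (abs_nonneg x)]
    · nlinarith [mul_le_mul_of_nonneg_right ha (abs_nonneg x)]
  refine ⟨Complex.ofRealCLM.contDiff.comp (contDiff_mul_abs_rpow (contDiff_ph a b)
    (r := 1 / 32) (by norm_num) (fun x hx => ?_) σ), fun ξ hξ => ?_⟩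
  · by_contra h
    exact absurd (hs x h).1 (not_le.2 hx)
  · have h : ph a b ξ ≠ 0 := fun h => hξ (by simp [h])
    obtain ⟨h1, h2⟩ := hs ξ h
    norm_num
    exact ⟨h1, h2⟩

lemma hasSum_ph {c ξ : ℝ} (hc : 0 < c) (hξ : ξ ≠ 0) :
    HasSum (fun n : ℕ => ph c (2 * c) (2 ^ n * ξ)) (phi (c * ξ)) := by
  have e : ∀ n : ℕ, ph c (2 * c) (2 ^ n * ξ) = phi (c * (2 ^ n * ξ)) - phi (c * (2 ^ (n + 1) * ξ)) :=
    fun n => by rw [ph]; congr 2; ring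
  obtain ⟨N, hN⟩ := pow_unbounded_of_one_lt (2 / (c * |ξ|)) one_lt_two
  have hpos : 0 < c * |ξ| := mul_pos hc (abs_pos.2 hξ)
  have hz : ∀ n, N ≤ n → phi (c * (2 ^ n * ξ)) = 0 := fun n hn => by
    refine phi_eq_zero ?_
    rw [abs_mul, abs_mul, abs_of_pos hc, abs_of_pos (by positivity : (0:ℝ) < 2 ^ n)]
    rw [div_lt_iff₀ hpos] at hN
    have : (2:ℝ) ^ N ≤ 2 ^ n := pow_le_pow_right₀ one_le_two hn
    nlinarith
  have h1 : HasSum (fun n : ℕ => ph c (2 * c) (2 ^ n * ξ))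
      (∑ n ∈ Finset.range N, ph c (2 * c) (2 ^ n * ξ)) := by
    refine hasSum_sum_of_ne_finset_zero fun n hn => ?_
    rw [Finset.mem_range, not_lt] at hn
    rw [e, hz n hn, hz (n + 1) (by omega), sub_zero]
  convert! h1 using 1
  simp only [e]
  rw [Finset.sum_range_sub', hz N le_rfl, sub_zero, pow_zero, one_mul]

lemma abs_rpow_two_pow_mul (n : ℕ) (ξ σ : ℝ) :
    |2 ^ n * ξ| ^ σ = ((2 : ℝ) ^ σ) ^ n * |ξ| ^ σ := by
  rw [abs_mul, abs_of_pos (by positivity), Real.mul_rpow (by positivity) (abs_nonneg _),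
    ← Real.rpow_natCast, ← Real.rpow_natCast, ← Real.rpow_mul (by norm_num), 
    ← Real.rpow_mul (by norm_num), mul_comm σ]

lemma exists_lowKer_rpow {c : ℝ} (hc : 1 / 16 ≤ c) (hc' : c ≤ 16) {σ : ℝ} (hσ : 0 ≤ σ) :
    ∃ (φ : ℝ → ℂ) (D : ℝ), LowKer φ D ∧ ∀ ξ, 𝓕 φ ξ = ((phi (c * ξ) * |ξ| ^ σ : ℝ) : ℂ) := by
  have hc0 : 0 < c := by linarith
  rcases hσ.eq_or_lt with rfl | hσ
  · have hs : HasCompactSupport fun ξ => ((phi (c * ξ) : ℝ) : ℂ) := by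
      refine HasCompactSupport.intro (isCompact_Icc (a := -(2 / c)) (b := 2 / c)) fun x hx => ?_
      rw [phi_eq_zero, Complex.ofReal_zero]
      rw [abs_mul, abs_of_pos hc0]
      by_contra! h
      refine hx (abs_le.1 ?_)
      rw [le_div_iff₀ hc0]
      linarith
    have hd : ContDiff ℝ (⊤ : ℕ∞) fun ξ => ((phi (c * ξ) : ℝ) : ℂ) :=
      Complex.ofRealCLM.contDiff.comp (contDiff_phi.comp (contDiff_const.mul contDiff_id))
    obtain ⟨D, _, hD⟩ := schwartz_bound (𝓕⁻ (hs.toSchwartzMap hd))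
    refine ⟨_, _, LowKer.of_bound (SchwartzMap.continuous _) hD, fun ξ => ?_⟩
    rw [← SchwartzMap.fourier_coe, FourierTransform.fourier_fourierInv_eq]
    simp
  · have hA := annSym_ph hc (by linarith : c ≤ 2 * c) (by linarith) σ
    obtain ⟨D, hD, hκ⟩ := hA.exists_lpKer
    obtain ⟨_, _, hκf⟩ := hA.exists_schwartz
    set κ := 𝓕⁻ fun ξ => ((ph c (2 * c) ξ * |ξ| ^ σ : ℝ) : ℂ)
    have hlow : LowKer κ (5 * D) := by simpa using (hκ 0).lowKer
    set ρ : ℝ := 2 ^ (-σ)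
    have hρ0 : 0 < ρ := by positivity
    have hρ1 : ρ < 1 := Real.rpow_lt_one_of_one_lt_of_neg one_lt_two (by linarith)
    have hn : ∀ n : ℕ, LowKer (fun x => ((ρ ^ n : ℝ) : ℂ) * sc (-n) κ x) (ρ ^ n * (5 * D)) :=
      fun n => by
        have := (hlow.sc_neg (l := -n) (by simp)).const_mul ((ρ ^ n : ℝ) : ℂ)
        rwa [Complex.norm_real, Real.norm_of_nonneg (by positivity)] at this
    obtain ⟨h1, h2⟩ := LowKer.tsum hn
      ((summable_geometric_of_lt_one hρ0.le hρ1).mul_right _)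
    refine ⟨_, _, h1, fun ξ => (h2 ξ).unique ?_⟩
    have e : ∀ n : ℕ, 𝓕 (fun x => ((ρ ^ n : ℝ) : ℂ) * sc (-n) κ x) ξ =
        ((ph c (2 * c) (2 ^ n * ξ) * |ξ| ^ σ : ℝ) : ℂ) := fun n => by
      have : 𝓕 (fun x => ((ρ ^ n : ℝ) : ℂ) * sc (-n) κ x) ξ = ((ρ ^ n : ℝ) : ℂ) * 𝓕 (sc (-n) κ) ξ := by
        rw [fourier_eq_char, fourier_eq_char, ← integral_const_mul]
        refine integral_congr_ae (Eventually.of_forall fun x => ?_)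
        simp only; ring
      rw [this, fourier_sc, hκf, neg_neg, zpow_natCast, ← Complex.ofReal_mul,
        abs_rpow_two_pow_mul]
      congr 1
      have : ρ ^ n * ((2 : ℝ) ^ σ) ^ n = 1 := by
        rw [← mul_pow, ← Real.rpow_add (by norm_num)]; simp
      linear_combination ph c (2 * c) (2 ^ n * ξ) * |ξ| ^ σ * this
    simp only [e]
    by_cases hξ : ξ = 0
    · subst hξ
      simp [Real.zero_rpow hσ.ne', hasSum_zero]
    · exact Complex.hasSum_ofReal.2 ((hasSum_ph hc0 hξ).mul_right _)

lemma exists_lowKer_diff {c : ℝ} (hc : 1 / 16 ≤ c) (hc' : c ≤ 16) {s : ℝ} (hs : s < 1) :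
    ∃ D : ℝ, 0 < D ∧ ∀ u : ℝ, ∃ φ : ℝ → ℂ, LowKer φ (D * (|u| * (1 + |u|) ^ 2)) ∧
      ∀ ξ, 𝓕 φ ξ = ((phi (c * ξ) * |ξ| ^ (-s) : ℝ) : ℂ) * (𝐞 (-(u * ξ)) - 1) := by
  have hc0 : 0 < c := by linarith
  have hA := annSym_ph hc (by linarith : c ≤ 2 * c) (by linarith) (-s)
  obtain ⟨S, hS, hκf⟩ := hA.exists_schwartz
  obtain ⟨D, hD, hκ⟩ := schwartz_diff_bound S
  rw [← hS] at hκf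
  replace hκf : ∀ ξ, 𝓕 (S : ℝ → ℂ) ξ = ((ph c (2 * c) ξ * |ξ| ^ (-s) : ℝ) : ℂ) :=
    fun ξ => congrFun hκf ξ
  set ρ : ℝ := 2 ^ (s - 1)
  have hρ0 : 0 < ρ := by positivity
  have hρ1 : ρ < 1 := Real.rpow_lt_one_of_one_lt_of_neg one_lt_two (by linarith)
  have hsum := summable_geometric_of_lt_one hρ0.le hρ1
  have hsum0 : 0 < ∑' n : ℕ, ρ ^ n := hsum.tsum_pos (fun n => by positivity) 0 (by simp)
  refine ⟨(∑' n : ℕ, ρ ^ n) * (5 * D), by positivity, fun u => ?_⟩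
  set r : ℝ := 2 ^ s
  have hr0 : 0 < r := by positivity
  have hrρ : ∀ n : ℕ, r ^ n * 2 ^ (-n : ℤ) = ρ ^ n := fun n => by
    rw [zpow_neg, zpow_natCast, ← inv_pow, ← mul_pow]
    congr 1
    rw [show ρ = 2 ^ (s - 1) from rfl, Real.rpow_sub_one (by norm_num), div_eq_mul_inv]
  have hn : ∀ n : ℕ, LowKer (fun x => ((r ^ n : ℝ) : ℂ) *
      sc (-n) (fun y => S (y - 2 ^ (-n : ℤ) * u) - S y) x)
      (ρ ^ n * (5 * D * (|u| * (1 + |u|) ^ 2))) := fun n => by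
    have h2n : (2 : ℝ) ^ (-n : ℤ) ≤ 1 := zpow_le_one_of_nonpos₀ one_le_two (by simp)
    have hb : LowKer (fun y => S (y - 2 ^ (-n : ℤ) * u) - S y)
        (5 * (2 ^ (-n : ℤ) * (D * (|u| * (1 + |u|) ^ 2)))) := by
      refine LowKer.of_bound (by fun_prop) fun x => (hκ x _).trans ?_
      refine div_le_div_of_nonneg_right ?_ (by positivity)
      rw [abs_mul, abs_of_pos (by positivity : (0:ℝ) < 2 ^ (-n : ℤ))]
      have h3 : (1 + 2 ^ (-n : ℤ) * |u|) ^ 2 ≤ (1 + |u|) ^ 2 := by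
        gcongr
        exact mul_le_of_le_one_left (abs_nonneg u) h2n
      calc D * (2 ^ (-n : ℤ) * |u|) * (1 + 2 ^ (-n : ℤ) * |u|) ^ 2
          ≤ D * (2 ^ (-n : ℤ) * |u|) * (1 + |u|) ^ 2 :=
            mul_le_mul_of_nonneg_left h3 (by positivity)
        _ = _ := by ring
    have := (hb.sc_neg (l := -n) (by simp)).const_mul ((r ^ n : ℝ) : ℂ)
    rw [Complex.norm_real, Real.norm_of_nonneg (by positivity)] at this
    refine this.mono (le_of_eq ?_)
    rw [← hrρ]; ring
  obtain ⟨h1, h2⟩ := LowKer.tsum hn (hsum.mul_right _)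
  rw [tsum_mul_right] at h1
  refine ⟨_, h1.mono (le_of_eq (by ring)), fun ξ => (h2 ξ).unique ?_⟩
  have e : ∀ n : ℕ, 𝓕 (fun x => ((r ^ n : ℝ) : ℂ) *
      sc (-n) (fun y => S (y - 2 ^ (-n : ℤ) * u) - S y) x) ξ =
      ((ph c (2 * c) (2 ^ n * ξ) * |ξ| ^ (-s) : ℝ) : ℂ) * (𝐞 (-(u * ξ)) - 1) := fun n => by
    have h3 : 𝓕 (fun x => ((r ^ n : ℝ) : ℂ) *
        sc (-n) (fun y => S (y - 2 ^ (-n : ℤ) * u) - S y) x) ξ = ((r ^ n : ℝ) : ℂ) *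
        𝓕 (sc (-n) (fun y => S (y - 2 ^ (-n : ℤ) * u) - S y)) ξ := by
      rw [fourier_eq_char, fourier_eq_char, ← integral_const_mul]
      refine integral_congr_ae (Eventually.of_forall fun x => ?_)
      simp only; ring
    have h4 : ∀ a ζ : ℝ, 𝓕 (fun y => S (y - a) - S y) ζ = (𝐞 (-(a * ζ)) - 1) * 𝓕 (S : ℝ → ℂ) ζ :=
      fun a ζ => by
        rw [sub_mul, one_mul, ← fourier_shift, fourier_eq_char, fourier_eq_char, fourier_eq_char,
          ← integral_sub (integrable_char_mul (by fun_prop) (S.integrable.comp_sub_right a))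
            (integrable_char_mul (by fun_prop) S.integrable)]
        simp only [mul_sub]
    rw [h3, fourier_sc, h4, hκf, neg_neg, zpow_natCast, abs_rpow_two_pow_mul, zpow_neg,
      zpow_natCast, show ((2:ℝ) ^ n)⁻¹ * u * (2 ^ n * ξ) = u * ξ by field_simp]
    have h5 : r ^ n * ((2 : ℝ) ^ (-s)) ^ n = 1 := by
      rw [← mul_pow, ← Real.rpow_add (by norm_num)]; simp
    have h6 : ((r ^ n : ℝ) : ℂ) * (((2 : ℝ) ^ (-s)) ^ n : ℝ) = 1 := by
      rw [← Complex.ofReal_mul, h5, Complex.ofReal_one]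
    rw [Complex.ofReal_mul, Complex.ofReal_mul, Complex.ofReal_mul]
    linear_combination (ph c (2 * c) (2 ^ n * ξ) : ℂ) * ((|ξ| ^ (-s) : ℝ) : ℂ) *
      (𝐞 (-(u * ξ)) - 1) * h6
  simp only [e]
  by_cases hξ : ξ = 0
  · subst hξ
    simp [hasSum_zero]
  · exact (Complex.hasSum_ofReal.2 ((hasSum_ph hc0 hξ).mul_right _)).mul_right _

/-! ### Superpositions of symbols -/

lemma GoodSym.integral {κ : ℝ → ℂ} {w : ℝ → ℝ} {q : ℝ → ℝ → ℝ → ℂ} {P : ℝ} {C : ℝ≥0∞}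
    (hκ : Measurable κ) (hwm : Measurable w) (hκw : Integrable fun u => ‖κ u‖ * w u)
    (hq : Measurable fun z : ℝ × (ℝ × ℝ) => q z.1 z.2.1 z.2.2)
    (hb : ∀ u ξ η, ‖q u ξ η‖ ≤ P * w u) (hg : ∀ u, GoodSym (q u) (C * ENNReal.ofReal (w u))) :
    GoodSym (fun ξ η => ∫ u, κ u * q u ξ η) (C * ∫⁻ u, ‖κ u‖ₑ * ENNReal.ofReal (w u)) := by
  have hle : ∀ u ξ η, ‖κ u * q u ξ η‖ ≤ P * (‖κ u‖ * w u) := fun u ξ η => by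
    rw [norm_mul, mul_left_comm]
    exact mul_le_mul_of_nonneg_left (hb u ξ η) (norm_nonneg _)
  refine ⟨?_, ⟨∫ u, P * (‖κ u‖ * w u), fun ξ η => norm_integral_le_of_norm_le (hκw.const_mul P)
    (Eventually.of_forall fun u => hle u ξ η)⟩, fun A B h hA hB hh K0 K => ?_⟩
  · have : Measurable fun z : (ℝ × ℝ) × ℝ => κ z.2 * q z.2 z.1.1 z.1.2 :=
      (hκ.comp measurable_snd).mul (hq.comp (measurable_snd.prodMk measurable_fst))
    exact this.stronglyMeasurable.integral_prod_right'.measurable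
  have hi : ∀ k : ℤ, Integrable fun z : ℝ × (ℝ × ℝ) =>
      κ z.1 * (q z.1 (2 ^ (-k) * z.2.1) (2 ^ (-k) * z.2.2) * A z.2.1 * B z.2.2 *
        𝓕⁻ h (z.2.1 + z.2.2)) := by
    intro k
    have h1 : Integrable fun z : ℝ × ℝ => A z.1 * B z.2 * 𝓕⁻ h (z.1 + z.2) := by
      simpa using integrable_triForm (p := fun _ _ => 1) (P := 1) measurable_const
        (fun _ _ => by simp) hA hB hh.integrable
    have hqk : Measurable fun z : ℝ × (ℝ × ℝ) =>
        q z.1 (2 ^ (-k) * z.2.1) (2 ^ (-k) * z.2.2) :=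
      hq.comp (measurable_fst.prodMk ((measurable_snd.fst.const_mul _).prodMk
        (measurable_snd.snd.const_mul _)))
    have h2 := (hκw.const_mul P).mul_prod h1.norm
    refine h2.mono' ?_ (Eventually.of_forall fun z => ?_)
    · have h3 : AEStronglyMeasurable (fun z : ℝ × (ℝ × ℝ) =>
          A z.2.1 * B z.2.2 * 𝓕⁻ h (z.2.1 + z.2.2)) volume :=
        h1.aestronglyMeasurable.comp_snd
      refine (((hκ.comp measurable_fst).mul hqk).aestronglyMeasurable.mul h3).congr
        (Eventually.of_forall fun z => ?_)
      simp only [Pi.mul_apply, Function.comp_apply]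
      ring
    · rw [norm_mul, mul_assoc, mul_assoc, norm_mul, ← mul_assoc, ← mul_assoc]
      refine mul_le_mul_of_nonneg_right ?_ (norm_nonneg _)
      rw [← norm_mul]
      exact hle _ _ _
  have e : ∀ k : ℤ, triForm (fun ξ η => ∫ u, κ u * q u (2 ^ (-k) * ξ) (2 ^ (-k) * η)) A B h =
      ∫ u, κ u * triForm (fun ξ η => q u (2 ^ (-k) * ξ) (2 ^ (-k) * η)) A B h := fun k => by
    simp only [triForm, ← integral_const_mul]
    rw [integral_integral_swap (hi k)]
    refine integral_congr_ae (Eventually.of_forall fun z => ?_)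
    simp only [mul_assoc, ← integral_mul_const]
  have hm : ∀ k : ℤ, AEMeasurable
      (fun u => ‖κ u * triForm (fun ξ η => q u (2 ^ (-k) * ξ) (2 ^ (-k) * η)) A B h‖ₑ) := fun k => by
    have := (hi k).integral_prod_left.aestronglyMeasurable
    simp only [integral_const_mul] at this
    exact this.enorm
  calc ∑ k ∈ Finset.Icc K0 K, ‖triForm (fun ξ η => ∫ u, κ u * q u (2 ^ (-k) * ξ) (2 ^ (-k) * η))
        A B h‖ₑ
      ≤ ∑ k ∈ Finset.Icc K0 K, ∫⁻ u,
          ‖κ u * triForm (fun ξ η => q u (2 ^ (-k) * ξ) (2 ^ (-k) * η)) A B h‖ₑ := by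
        refine Finset.sum_le_sum fun k _ => ?_
        rw [e]
        exact enorm_integral_le_lintegral_enorm _
    _ = ∫⁻ u, ‖κ u‖ₑ * ∑ k ∈ Finset.Icc K0 K,
          ‖triForm (fun ξ η => q u (2 ^ (-k) * ξ) (2 ^ (-k) * η)) A B h‖ₑ := by
        rw [← lintegral_finsetSum' _ fun k _ => hm k]
        simp only [enorm_mul, Finset.mul_sum]
    _ ≤ ∫⁻ u, (C * (‖κ u‖ₑ * ENNReal.ofReal (w u))) * maxForm (𝓕⁻ A) (𝓕⁻ B) h := by
        refine lintegral_mono fun u => ?_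
        calc _ ≤ ‖κ u‖ₑ * (C * ENNReal.ofReal (w u) * maxForm (𝓕⁻ A) (𝓕⁻ B) h) :=
              mul_le_mul_right ((hg u).sum_le A B h hA hB hh K0 K) _
          _ = _ := by ring
    _ = _ := by
        have hm2 : Measurable fun u => ‖κ u‖ₑ * ENNReal.ofReal (w u) := by fun_prop
        rw [lintegral_mul_const _ (hm2.const_mul C), lintegral_const_mul _ hm2]

lemma GoodSym.mono {p : ℝ → ℝ → ℂ} {C C' : ℝ≥0∞} (h : GoodSym p C) (hC : C ≤ C') :
    GoodSym p C' :=
  ⟨h.meas, h.bdd, fun A B h' hA hB hh K0 K =>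
    (h.sum_le A B h' hA hB hh K0 K).trans (mul_le_mul_left hC _)⟩

lemma GoodSym.congr {p p' : ℝ → ℝ → ℂ} {C : ℝ≥0∞} (h : GoodSym p C)
    (he : ∀ ξ η, p' ξ η = p ξ η) : GoodSym p' C := by
  rwa [show p' = p from funext fun ξ => funext fun η => he ξ η]

/-- Symbols satisfying the dyadic bound with some finite constant. -/
def IsGood (p : ℝ → ℝ → ℂ) : Prop := ∃ C : ℝ≥0∞, C ≠ ∞ ∧ GoodSym p C

lemma IsGood.add {p₁ p₂ : ℝ → ℝ → ℂ} (h₁ : IsGood p₁) (h₂ : IsGood p₂) :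
    IsGood fun ξ η => p₁ ξ η + p₂ ξ η := by
  obtain ⟨C₁, hC₁, h₁⟩ := h₁
  obtain ⟨C₂, hC₂, h₂⟩ := h₂
  exact ⟨C₁ + C₂, by finiteness, h₁.add h₂⟩

lemma IsGood.sub {p₁ p₂ : ℝ → ℝ → ℂ} (h₁ : IsGood p₁) (h₂ : IsGood p₂) :
    IsGood fun ξ η => p₁ ξ η - p₂ ξ η := by
  obtain ⟨C₁, hC₁, h₁⟩ := h₁
  obtain ⟨C₂, hC₂, h₂⟩ := h₂
  simp only [sub_eq_add_neg]
  exact ⟨C₁ + C₂, by finiteness, h₁.add h₂.neg⟩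

lemma AnnSym.exists_lpKer_zero {θ : ℝ → ℂ} (h : AnnSym θ) : ∃ D : ℝ, 0 < D ∧ LPKer (𝓕⁻ θ) D := by
  obtain ⟨D, hD, h1⟩ := h.exists_lpKer
  exact ⟨D, hD, by simpa using h1 0⟩

/-- An annular symbol with a power weight. -/
def annPow (a b σ ξ : ℝ) : ℝ := ph a b ξ * |ξ| ^ σ

/-- A low-pass symbol with a power weight. -/
def lowPow (c σ ξ : ℝ) : ℝ := phi (c * ξ) * |ξ| ^ σ

lemma annPow_neg (a b σ ξ : ℝ) : annPow a b σ (-ξ) = annPow a b σ ξ := by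
  simp only [annPow, ph_neg, abs_neg]

lemma annSym_annPow {a b : ℝ} (ha : 1 / 16 ≤ a) (hab : a ≤ b) (hb : b ≤ 32) (σ : ℝ) :
    AnnSym fun ξ => ((annPow a b σ ξ : ℝ) : ℂ) := annSym_ph ha hab hb σ

lemma isGood_low_right {a b a' b' c σ₁ σ₂ σ₃ : ℝ} (ha : 1 / 16 ≤ a) (hab : a ≤ b) (hb : b ≤ 32)
    (ha' : 1 / 16 ≤ a') (hab' : a' ≤ b') (hb' : b' ≤ 32) (hc : 1 / 16 ≤ c) (hc' : c ≤ 16)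
    (hσ : 0 ≤ σ₂) : IsGood fun ξ η =>
      ((annPow a b σ₁ ξ * lowPow c σ₂ η * annPow a' b' σ₃ (ξ + η) : ℝ) : ℂ) := by
  have h₁ := annSym_annPow ha hab hb σ₁
  have h₃ := annSym_annPow ha' hab' hb' σ₃
  obtain ⟨D₁, hD₁, k₁⟩ := h₁.exists_lpKer_zero
  obtain ⟨D₃, hD₃, k₃⟩ := h₃.exists_lpKer_zero
  obtain ⟨φ, D₂, k₂, hφ⟩ := exists_lowKer_rpow hc hc' hσ
  obtain ⟨_, _, e₁⟩ := h₁.exists_schwartz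
  obtain ⟨_, _, e₃⟩ := h₃.exists_schwartz
  have := goodSym_low_right k₁ k₃ k₂ hD₁ hD₃
  simp only [e₁, e₃, hφ, annPow_neg] at this
  exact ⟨200000000 * (ENNReal.ofReal D₁ * ENNReal.ofReal D₃ * ENNReal.ofReal D₂), by finiteness,
    by simpa only [Complex.ofReal_mul, lowPow] using this⟩

lemma isGood_low_sum {a b a' b' c σ₁ σ₂ σ₃ : ℝ} (ha : 1 / 16 ≤ a) (hab : a ≤ b) (hb : b ≤ 32)
    (ha' : 1 / 16 ≤ a') (hab' : a' ≤ b') (hb' : b' ≤ 32) (hc : 1 / 16 ≤ c) (hc' : c ≤ 16)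
    (hσ : 0 ≤ σ₃) : IsGood fun ξ η =>
      ((annPow a b σ₁ ξ * annPow a' b' σ₂ η * lowPow c σ₃ (ξ + η) : ℝ) : ℂ) := by
  have h₁ := annSym_annPow ha hab hb σ₁
  have h₂ := annSym_annPow ha' hab' hb' σ₂
  obtain ⟨D₁, hD₁, k₁⟩ := h₁.exists_lpKer_zero
  obtain ⟨D₂, hD₂, k₂⟩ := h₂.exists_lpKer_zero
  obtain ⟨φ, D₃, k₃, hφ⟩ := exists_lowKer_rpow hc hc' hσ
  obtain ⟨_, _, e₁⟩ := h₁.exists_schwartz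
  obtain ⟨_, _, e₂⟩ := h₂.exists_schwartz
  have := goodSym_low_sum k₁ k₂ k₃ hD₁ hD₂
  simp only [e₁, e₂, hφ, mul_neg, phi_neg, abs_neg] at this
  exact ⟨200000000 * (ENNReal.ofReal D₁ * ENNReal.ofReal D₂ * ENNReal.ofReal D₃), by finiteness,
    by simpa only [Complex.ofReal_mul, lowPow] using this⟩

lemma schwartz_integrable_weight (S : SchwartzMap ℝ ℂ) :
    Integrable fun u => ‖S u‖ * (1 + |u|) ^ 5 := by
  have h1 := S.integrable_pow_mul volume 5
  have h0 := (S.integrable (μ := volume)).norm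
  refine ((h0.add h1).const_mul (2 ^ 4)).mono' (by fun_prop) (Eventually.of_forall fun u => ?_)
  rw [Real.norm_of_nonneg (by positivity)]
  have := add_pow_le zero_le_one (abs_nonneg u) 5
  simp only [Pi.add_apply, Real.norm_eq_abs]
  norm_num at this ⊢
  nlinarith [mul_le_mul_of_nonneg_left this (norm_nonneg (S u))]

lemma isGood_low_left {a b a' b' a₀ b₀ c σ₂ σ₃ σ s : ℝ}
    (ha : 1 / 16 ≤ a) (hab : a ≤ b) (hb : b ≤ 32)
    (ha' : 1 / 16 ≤ a') (hab' : a' ≤ b') (hb' : b' ≤ 32)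
    (ha₀ : 1 / 16 ≤ a₀) (hab₀ : a₀ ≤ b₀) (hb₀ : b₀ ≤ 32)
    (hc : 1 / 16 ≤ c) (hc' : c ≤ 16) (hs : s < 1) : IsGood fun ξ η =>
      ((lowPow c (-s) ξ * annPow a b σ₂ η * annPow a' b' σ₃ (ξ + η) *
        (annPow a₀ b₀ σ (ξ + η) - annPow a₀ b₀ σ η) : ℝ) : ℂ) := by
  have h₁ := annSym_annPow ha hab hb σ₂
  have h₂ := annSym_annPow ha' hab' hb' σ₃
  have h₀ := annSym_annPow ha₀ hab₀ hb₀ σ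
  obtain ⟨S, hS, e₀⟩ := h₀.exists_schwartz
  rw [← hS] at e₀
  replace e₀ : ∀ ξ, 𝓕 (S : ℝ → ℂ) ξ = ((annPow a₀ b₀ σ ξ : ℝ) : ℂ) := fun ξ => congrFun e₀ ξ
  obtain ⟨D₁, hD₁, k₁⟩ := h₁.exists_lpKer
  obtain ⟨D₂, hD₂, k₂⟩ := h₂.exists_lpKer_zero
  obtain ⟨D₃, hD₃, k₃⟩ := exists_lowKer_diff hc hc' hs
  obtain ⟨_, _, e₁⟩ := h₁.exists_schwartz
  obtain ⟨_, _, e₂⟩ := h₂.exists_schwartz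
  obtain ⟨B₁, hB₁, n₁⟩ := norm_le_of_annSym h₁
  obtain ⟨B₂, hB₂, n₂⟩ := norm_le_of_annSym h₂
  choose φ k₃ hφ using k₃
  set q : ℝ → ℝ → ℝ → ℂ := fun u ξ η => ((lowPow c (-s) ξ : ℝ) : ℂ) * (𝐞 (-(u * ξ)) - 1) *
    (𝐞 (-(u * η)) * ((annPow a b σ₂ η : ℝ) : ℂ)) * ((annPow a' b' σ₃ (ξ + η) : ℝ) : ℂ) with hq
  have hm₁ : Measurable fun ξ => annPow a b σ₂ ξ := by
    have := (contDiff_ph a b).continuous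
    unfold annPow; fun_prop
  have hm₂ : Measurable fun ξ => annPow a' b' σ₃ ξ := by
    have := (contDiff_ph a' b').continuous
    unfold annPow; fun_prop
  have hm₃ : Measurable fun ξ => lowPow c (-s) ξ := by
    have := contDiff_phi.continuous
    unfold lowPow; fun_prop
  have hme : Measurable fun x : ℝ => (𝐞 x : ℂ) := (continuous_char continuous_id).measurable
  have hw : ∀ u : ℝ, |u| * (1 + |u|) ^ 2 ≤ (1 + |u|) ^ 5 := fun u => by
    have h1 : 1 ≤ 1 + |u| := by linarith [abs_nonneg u]
    calc |u| * (1 + |u|) ^ 2 ≤ (1 + |u|) * (1 + |u|) ^ 2 := by gcongr; linarith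
      _ = (1 + |u|) ^ 3 := by ring
      _ ≤ _ := pow_le_pow_right₀ h1 (by norm_num)
  have hg : ∀ u, GoodSym (q u) (200000000 * (ENNReal.ofReal D₁ * ENNReal.ofReal D₂ *
      ENNReal.ofReal D₃) * ENNReal.ofReal ((1 + |u|) ^ 5)) := fun u => by
    have := goodSym_low_left (k₁ u) k₂ (k₃ u) (by positivity) hD₂
    simp only [fourier_shift, e₁, e₂, hφ, annPow_neg] at this
    have hq' : GoodSym (q u) (200000000 * (ENNReal.ofReal (D₁ * (1 + |u|) ^ 2) *
        ENNReal.ofReal D₂ * ENNReal.ofReal (D₃ * (|u| * (1 + |u|) ^ 2)))) := by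
      convert! this using 3
    refine hq'.mono ?_
    rw [mul_assoc (200000000 : ℝ≥0∞)]
    refine mul_le_mul_right ?_ _
    rw [← ENNReal.ofReal_mul (by positivity), ← ENNReal.ofReal_mul (by positivity),
      ← ENNReal.ofReal_mul (by positivity), ← ENNReal.ofReal_mul (by positivity),
      ← ENNReal.ofReal_mul (by positivity)]
    refine ENNReal.ofReal_le_ofReal ?_
    calc _ = D₁ * D₂ * D₃ * ((1 + |u|) ^ 4 * |u|) := by ring
      _ ≤ D₁ * D₂ * D₃ * (1 + |u|) ^ 5 := by
        refine mul_le_mul_of_nonneg_left ?_ (by positivity)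
        rw [pow_succ (1 + |u|) 4]
        gcongr; linarith
  have hInt := GoodSym.integral (κ := S) (w := fun u => (1 + |u|) ^ 5) (q := q)
    (P := 3 * D₃ * B₁ * B₂) S.continuous.measurable (by fun_prop)
    (schwartz_integrable_weight S) (by fun_prop) (fun u ξ η => ?_) hg
  · refine ⟨_, ?_, hInt.congr fun ξ η => ?_⟩
    · refine ENNReal.mul_ne_top (by finiteness) ?_
      have := (schwartz_integrable_weight S).2
      rw [HasFiniteIntegral] at this
      refine ne_of_lt (lt_of_le_of_lt (lintegral_mono fun u => ?_) this)
      rw [enorm_mul, Real.enorm_of_nonneg (by positivity : (0:ℝ) ≤ (1 + |u|) ^ 5), enorm_norm]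
    · have i : ∀ x : ℝ, Integrable fun u => (𝐞 (-(u * x)) : ℂ) * S u := fun x =>
        integrable_char_mul (by fun_prop) S.integrable
      rw [show ((lowPow c (-s) ξ * annPow a b σ₂ η * annPow a' b' σ₃ (ξ + η) *
          (annPow a₀ b₀ σ (ξ + η) - annPow a₀ b₀ σ η) : ℝ) : ℂ) = ((lowPow c (-s) ξ : ℝ) : ℂ) *
          ((annPow a b σ₂ η : ℝ) : ℂ) * ((annPow a' b' σ₃ (ξ + η) : ℝ) : ℂ) *
          (((annPow a₀ b₀ σ (ξ + η) : ℝ) : ℂ) - ((annPow a₀ b₀ σ η : ℝ) : ℂ)) by push_cast; ring,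
        ← e₀, ← e₀, fourier_eq_char, fourier_eq_char, ← integral_sub (i _) (i _),
        ← integral_const_mul]
      refine integral_congr_ae (Eventually.of_forall fun u => ?_)
      simp only [hq]
      rw [show -(u * (ξ + η)) = -(u * ξ) + -(u * η) by ring, char_add]
      ring
  · have h3 := (k₃ u).norm_fourier_le ξ
    rw [hφ] at h3
    simp only [hq]
    rw [norm_mul, norm_mul, norm_mul (𝐞 _ : ℂ), Circle.norm_coe, one_mul]
    calc _ ≤ (3 * (D₃ * (|u| * (1 + |u|) ^ 2))) * B₁ * B₂ := by
          gcongr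
          · exact h3
          · exact n₁ η
          · exact n₂ (ξ + η)
      _ ≤ (3 * (D₃ * (1 + |u|) ^ 5)) * B₁ * B₂ := by
          have := hw u
          gcongr
      _ = _ := by ring

/-- The symbol of the commutator, as a multiplier of `D^{α+β} f`, `g` and the dual function. -/
def comSym (α β ξ η : ℝ) : ℝ := |ξ + η| ^ β * (|ξ + η| ^ α - |η| ^ α) * |ξ| ^ (-(α + β))

/-- A dyadic shell in the plane. -/
def shell (x y : ℝ) : ℝ := phi x * phi y - phi (2 * x) * phi (2 * y)

lemma shell_eq (x y : ℝ) : shell x y = ph 1 2 x * phi (16 * y) + phi (16 * x) * ph 1 2 y +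
    ph 1 2 x * ph 1 16 y + ph 2 16 x * ph 1 2 y := by
  simp only [shell, ph, one_mul]; ring

lemma abs_lt_of_phi_ne_zero {c x : ℝ} (hc : 0 < c) (h : phi (c * x) ≠ 0) : c * |x| < 2 := by
  by_contra! h1
  exact h (phi_eq_zero (by rwa [abs_mul, abs_of_pos hc]))

lemma ph_eq_one_of_mem {x : ℝ} (h₁ : 1 / 16 ≤ |x|) (h₂ : |x| ≤ 4) : ph (1 / 4) 32 x = 1 :=
  ph_eq_one (by rw [abs_mul, abs_of_pos (by norm_num)]; linarith)
    (by rw [abs_mul, abs_of_pos (by norm_num)]; linarith)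

lemma shell_mul_comSym {α β : ℝ} (hα : 0 ≤ α) (hβ : 0 ≤ β) (ξ η : ℝ) :
    shell (ξ + η) η * comSym α β ξ η =
      (annPow (1 / 4) 32 (-(α + β)) ξ * lowPow 16 0 η * annPow 1 2 (α + β) (ξ + η) -
        annPow (1 / 4) 32 (-(α + β)) ξ * lowPow 16 α η * annPow 1 2 β (ξ + η)) +
      (annPow (1 / 4) 32 (-(α + β)) ξ * annPow 1 2 0 η * lowPow 16 (α + β) (ξ + η) -
        annPow (1 / 4) 32 (-(α + β)) ξ * annPow 1 2 α η * lowPow 16 β (ξ + η)) +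
      (lowPow (1 / 4) (-(α + β)) ξ * annPow 1 16 0 η * annPow 1 2 β (ξ + η) *
        (annPow (1 / 4) 32 α (ξ + η) - annPow (1 / 4) 32 α η)) +
      (lowPow (1 / 4) (-(α + β)) ξ * annPow 1 2 0 η * annPow 2 16 β (ξ + η) *
        (annPow (1 / 4) 32 α (ξ + η) - annPow (1 / 4) 32 α η)) := by
  have e := rpow_add_of_nonneg (abs_nonneg (ξ + η)) hα hβ
  have t1 := abs_add_le ξ η
  have t2 := abs_sub_le (ξ + η) 0 η
  have t3 : |ξ| ≤ |ξ + η| + |η| := by simpa using abs_sub (ξ + η) η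
  have t4 : |η| ≤ |ξ + η| + |ξ| := by simpa using abs_sub (ξ + η) ξ
  rw [shell_eq, comSym, add_mul, add_mul, add_mul]
  simp only [annPow, lowPow, rpow_zero, mul_one, e]
  congr 1
  · congr 1
    · congr 1
      · by_cases h1 : ph 1 2 (ξ + η) = 0
        · simp [h1]
        by_cases h2 : phi (16 * η) = 0
        · simp [h2]
        have := ph_supp one_pos one_le_two h1
        have := abs_lt_of_phi_ne_zero (by norm_num) h2
        rw [ph_eq_one_of_mem (by linarith) (by linarith)]
        ring
      · by_cases h1 : phi (16 * (ξ + η)) = 0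
        · simp [h1]
        by_cases h2 : ph 1 2 η = 0
        · simp [h2]
        have := ph_supp one_pos one_le_two h2
        have := abs_lt_of_phi_ne_zero (by norm_num) h1
        rw [ph_eq_one_of_mem (by linarith) (by linarith)]
        ring
    · by_cases h1 : ph 1 2 (ξ + η) = 0
      · simp [h1]
      by_cases h2 : ph 1 16 η = 0
      · simp [h2]
      have := ph_supp one_pos one_le_two h1
      have := ph_supp one_pos (by norm_num) h2
      rw [ph_eq_one_of_mem (x := η) (by linarith) (by linarith),
        ph_eq_one_of_mem (x := ξ + η) (by linarith) (by linarith),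
        phi_eq_one (x := 1 / 4 * ξ) (by rw [abs_mul, abs_of_pos (by norm_num)]; linarith)]
      ring
  · by_cases h1 : ph 2 16 (ξ + η) = 0
    · simp [h1]
    by_cases h2 : ph 1 2 η = 0
    · simp [h2]
    have := ph_supp two_pos (by norm_num) h1
    have := ph_supp one_pos one_le_two h2
    rw [ph_eq_one_of_mem (x := η) (by linarith) (by linarith),
      ph_eq_one_of_mem (x := ξ + η) (by linarith) (by linarith),
      phi_eq_one (x := 1 / 4 * ξ) (by rw [abs_mul, abs_of_pos (by norm_num)]; linarith)]
    ring

lemma isGood_shell_comSym {α β : ℝ} (hα : 0 ≤ α) (hβ : 0 ≤ β) (hs : α + β < 1) :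
    IsGood fun ξ η => ((shell (ξ + η) η * comSym α β ξ η : ℝ) : ℂ) := by
  simp only [shell_mul_comSym hα hβ]
  simp only [Complex.ofReal_add]
  refine ((IsGood.add ?_ ?_).add ?_).add ?_
  · simp only [Complex.ofReal_sub]
    refine IsGood.sub (isGood_low_right ?_ ?_ ?_ ?_ ?_ ?_ ?_ ?_ le_rfl)
      (isGood_low_right ?_ ?_ ?_ ?_ ?_ ?_ ?_ ?_ hα) <;> norm_num
  · simp only [Complex.ofReal_sub]
    refine IsGood.sub (isGood_low_sum ?_ ?_ ?_ ?_ ?_ ?_ ?_ ?_ (add_nonneg hα hβ))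
      (isGood_low_sum ?_ ?_ ?_ ?_ ?_ ?_ ?_ ?_ hβ) <;> norm_num
  all_goals
    refine isGood_low_left ?_ ?_ ?_ ?_ ?_ ?_ ?_ ?_ ?_ ?_ ?_ hs <;> norm_num

lemma comSym_scale {α β c : ℝ} (hc : 0 < c) (ξ η : ℝ) :
    comSym α β (c * ξ) (c * η) = comSym α β ξ η := by
  simp only [comSym, ← mul_add, abs_mul, abs_of_pos hc]
  rw [mul_rpow hc.le (abs_nonneg _), mul_rpow hc.le (abs_nonneg _), mul_rpow hc.le (abs_nonneg _),
    mul_rpow hc.le (abs_nonneg _), rpow_neg hc.le, rpow_add hc]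
  have := (rpow_pos_of_pos hc α).ne'
  have := (rpow_pos_of_pos hc β).ne'
  field_simp

lemma sum_Icc_telescope (G : ℤ → ℝ) (N : ℕ) :
    ∑ k ∈ Finset.Icc (-(N : ℤ)) N, (G (-k) - G (-k + 1)) = G (-N) - G (N + 1) := by
  induction N with
  | zero => simp
  | succ N ih =>
    have : Finset.Icc (-((N + 1 : ℕ) : ℤ)) ((N + 1 : ℕ) : ℤ) =
        insert (-((N + 1 : ℕ) : ℤ)) (insert ((N + 1 : ℕ) : ℤ) (Finset.Icc (-(N : ℤ)) N)) := by
      ext k; simp only [Finset.mem_Icc, Finset.mem_insert]; omega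
    rw [this, Finset.sum_insert (by simp; omega), Finset.sum_insert (by simp), ih]
    push_cast
    rw [show -((N : ℤ) + 1) + 1 = -N by ring, neg_neg]
    ring

lemma sum_shell (N : ℕ) (x y : ℝ) :
    ∑ k ∈ Finset.Icc (-(N : ℤ)) N, shell (2 ^ (-k) * x) (2 ^ (-k) * y) =
      phi (2 ^ (-(N : ℤ)) * x) * phi (2 ^ (-(N : ℤ)) * y) -
        phi (2 ^ ((N : ℤ) + 1) * x) * phi (2 ^ ((N : ℤ) + 1) * y) := by
  rw [← sum_Icc_telescope fun k => phi (2 ^ k * x) * phi (2 ^ k * y)]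
  refine Finset.sum_congr rfl fun k _ => ?_
  rw [shell, zpow_add_one₀ two_ne_zero, ← mul_assoc, ← mul_assoc, mul_comm (2 : ℝ)]

lemma abs_sum_shell_le (N : ℕ) (x y : ℝ) :
    |∑ k ∈ Finset.Icc (-(N : ℤ)) N, shell (2 ^ (-k) * x) (2 ^ (-k) * y)| ≤ 1 := by
  rw [sum_shell, abs_le]
  have h : ∀ a b : ℝ, 0 ≤ phi a * phi b ∧ phi a * phi b ≤ 1 := fun a b =>
    ⟨mul_nonneg (phi_nonneg a) (phi_nonneg b), mul_le_one₀ (phi_le_one a) (phi_nonneg b)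
      (phi_le_one b)⟩
  have h1 := h (2 ^ (-(N : ℤ)) * x) (2 ^ (-(N : ℤ)) * y)
  have h2 := h (2 ^ ((N : ℤ) + 1) * x) (2 ^ ((N : ℤ) + 1) * y)
  constructor <;> linarith

lemma tendsto_sum_shell {x y : ℝ} (hy : y ≠ 0) :
    Tendsto (fun N : ℕ => ∑ k ∈ Finset.Icc (-(N : ℤ)) N, shell (2 ^ (-k) * x) (2 ^ (-k) * y))
      atTop (𝓝 1) := by
  simp only [sum_shell]
  have h0 : Tendsto (fun N : ℕ => (2 : ℝ) ^ (-(N : ℤ))) atTop (𝓝 0) := by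
    simpa [zpow_neg, Function.comp_def] using tendsto_inv_atTop_zero.comp
      (tendsto_pow_atTop_atTop_of_one_lt (one_lt_two (α := ℝ)))
  have h1 : ∀ z : ℝ, Tendsto (fun N : ℕ => phi (2 ^ (-(N : ℤ)) * z)) atTop (𝓝 1) := fun z => by
    have := (contDiff_phi.continuous.tendsto (0 * z)).comp (h0.mul_const z)
    rwa [zero_mul, phi_eq_one (by simp)] at this
  have h2 : Tendsto (fun N : ℕ => phi (2 ^ ((N : ℤ) + 1) * x) * phi (2 ^ ((N : ℤ) + 1) * y)) atTop
      (𝓝 0) := by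
    refine tendsto_const_nhds.congr' ?_
    have h3 : Tendsto (fun N : ℕ => (2 : ℝ) ^ (N + 1) * |y|) atTop atTop :=
      ((tendsto_pow_atTop_atTop_of_one_lt one_lt_two).comp (tendsto_add_atTop_nat 1)).atTop_mul_const
        (abs_pos.2 hy)
    filter_upwards [h3.eventually_ge_atTop 2] with N hN
    rw [phi_eq_zero (x := 2 ^ ((N : ℤ) + 1) * y), mul_zero]
    rw [abs_mul, abs_of_pos (by positivity)]
    exact_mod_cast hN
  simpa using ((h1 x).mul (h1 y)).sub h2

/-- The commutator `[D^α, f] g` of two functions of one variable. -/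
def commD (α : ℝ) (f g : ℝ → ℂ) (x : ℝ) : ℂ := Dop α (fun y => f y * g y) x - f x * Dop α g x

/-- The bilinear symbol of `D^β [D^α, f] g`. -/
def comW (α β ξ η : ℝ) : ℝ := |ξ + η| ^ β * (|ξ + η| ^ α - |η| ^ α)

lemma measurable_comW (α β : ℝ) : Measurable fun z : ℝ × ℝ => comW α β z.1 z.2 := by
  unfold comW; fun_prop

lemma abs_rpow_le_one_add {x y σ : ℝ} (hσ : 0 ≤ σ) (hσ' : σ ≤ 1) (h : |x| ≤ y) (hy : 1 ≤ y) :
    |x| ^ σ ≤ y :=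
  (rpow_le_rpow (abs_nonneg x) h hσ).trans
    ((rpow_le_rpow_of_exponent_le hy hσ').trans_eq (rpow_one y))

lemma abs_comW_le {α β : ℝ} (hα : 0 ≤ α) (hα' : α ≤ 1) (hβ : 0 ≤ β) (hβ' : β ≤ 1) (ξ η : ℝ) :
    |comW α β ξ η| ≤ (1 + |ξ|) ^ 5 * (1 + |η|) ^ 5 := by
  have h1 : 1 ≤ 1 + |ξ| := by linarith [abs_nonneg ξ]
  have h2 : 1 ≤ 1 + |η| := by linarith [abs_nonneg η]
  have h3 : 1 ≤ (1 + |ξ|) * (1 + |η|) := one_le_mul_of_one_le_of_one_le h1 h2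
  have h4 : |ξ + η| ≤ (1 + |ξ|) * (1 + |η|) := by
    nlinarith [abs_add_le ξ η, mul_nonneg (abs_nonneg ξ) (abs_nonneg η)]
  have h5 : |η| ≤ (1 + |ξ|) * (1 + |η|) := by
    nlinarith [abs_nonneg ξ, mul_nonneg (abs_nonneg ξ) (abs_nonneg η)]
  have e1 := abs_rpow_le_one_add hβ hβ' h4 h3
  have e2 := abs_rpow_le_one_add hα hα' h4 h3
  have e3 := abs_rpow_le_one_add hα hα' h5 h3
  have e4 : |(|ξ + η| ^ α - |η| ^ α)| ≤ (1 + |ξ|) * (1 + |η|) := by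
    rw [abs_le]
    constructor <;> linarith [rpow_nonneg (abs_nonneg (ξ + η)) α, rpow_nonneg (abs_nonneg η) α]
  rw [comW, abs_mul, abs_of_nonneg (rpow_nonneg (abs_nonneg (ξ + η)) β)]
  calc _ ≤ ((1 + |ξ|) * (1 + |η|)) * ((1 + |ξ|) * (1 + |η|)) :=
        mul_le_mul e1 e4 (abs_nonneg _) (by linarith)
    _ = ((1 + |ξ|) * (1 + |η|)) ^ 2 := by ring
    _ ≤ ((1 + |ξ|) * (1 + |η|)) ^ 5 := pow_le_pow_right₀ h3 (by norm_num)
    _ = _ := by ring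

lemma integrable_weight_mul (S : SchwartzMap ℝ ℂ) {w : ℝ → ℝ} (hw : Measurable w)
    (h : ∀ u, |w u| ≤ (1 + |u|) ^ 5) : Integrable fun u => (w u : ℂ) * S u := by
  refine (schwartz_integrable_weight S).mono' (by fun_prop) (Eventually.of_forall fun u => ?_)
  rw [norm_mul, Complex.norm_real, Real.norm_eq_abs, mul_comm]
  exact mul_le_mul_of_nonneg_left (h u) (norm_nonneg _)

lemma integrable_abs_rpow_mul (S : SchwartzMap ℝ ℂ) {σ : ℝ} (hσ : 0 ≤ σ) (hσ' : σ ≤ 1) :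
    Integrable fun u => ((|u| ^ σ : ℝ) : ℂ) * S u := by
  refine integrable_weight_mul S (by fun_prop) fun u => ?_
  have h1 : 1 ≤ 1 + |u| := by linarith [abs_nonneg u]
  rw [abs_of_nonneg (by positivity)]
  exact (abs_rpow_le_one_add hσ hσ' (by linarith) h1).trans (le_self_pow₀ h1 (by norm_num))

lemma integrable_comW {α β : ℝ} (hα : 0 ≤ α) (hα' : α ≤ 1) (hβ : 0 ≤ β) (hβ' : β ≤ 1)
    (P Q : SchwartzMap ℝ ℂ) :
    Integrable fun z : ℝ × ℝ => (comW α β z.1 z.2 : ℂ) * P z.1 * Q z.2 := by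
  refine ((schwartz_integrable_weight P).mul_prod (schwartz_integrable_weight Q)).mono' ?_
    (Eventually.of_forall fun z => ?_)
  · have := measurable_comW α β
    have := P.continuous
    have := Q.continuous
    exact Measurable.aestronglyMeasurable (by fun_prop)
  · rw [norm_mul, norm_mul, Complex.norm_real, Real.norm_eq_abs]
    calc _ ≤ ((1 + |z.1|) ^ 5 * (1 + |z.2|) ^ 5) * ‖P z.1‖ * ‖Q z.2‖ := by
          gcongr; exact abs_comW_le hα hα' hβ hβ' _ _
      _ = _ := by ring

/-- The Fourier transform of `D^β [D^α, f] g`, with `P = 𝓕 f` and `Q = 𝓕 g`. -/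
def comF (α β : ℝ) (P Q : ℝ → ℂ) (ζ : ℝ) : ℂ := ∫ η, (comW α β (ζ - η) η : ℂ) * P (ζ - η) * Q η

lemma comF_eq (α β : ℝ) (P Q : ℝ → ℂ) (ζ : ℝ) :
    comF α β P Q ζ = ((|ζ| ^ β : ℝ) : ℂ) * comF α 0 P Q ζ := by
  rw [comF, comF, ← integral_const_mul]
  refine integral_congr_ae (Eventually.of_forall fun η => ?_)
  simp only [comW, sub_add_cancel, rpow_zero]
  push_cast
  ring

lemma integrable_comF_prod {α β : ℝ} (hα : 0 ≤ α) (hα' : α ≤ 1) (hβ : 0 ≤ β) (hβ' : β ≤ 1)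
    (P Q : SchwartzMap ℝ ℂ) : Integrable fun z : ℝ × ℝ =>
      (comW α β (z.1 - z.2) z.2 : ℂ) * P (z.1 - z.2) * Q z.2 :=
  (measurePreserving_sub_prod (volume : Measure ℝ) (volume : Measure ℝ)).integrable_comp_of_integrable
    (integrable_comW hα hα' hβ hβ' P Q)

lemma integrable_comF {α β : ℝ} (hα : 0 ≤ α) (hα' : α ≤ 1) (hβ : 0 ≤ β) (hβ' : β ≤ 1)
    (P Q : SchwartzMap ℝ ℂ) : Integrable (comF α β P Q) :=
  (integrable_comF_prod hα hα' hβ hβ' P Q).integral_prod_left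

lemma sc_zero (ψ : ℝ → ℂ) : sc 0 ψ = ψ := by
  funext x; simp [sc]

lemma continuous_cv_zero (P : SchwartzMap ℝ ℂ) {Q : ℝ → ℂ} (hQ : Integrable Q) :
    Continuous (cv 0 P Q) := by
  obtain ⟨B, hB⟩ : ∃ B, ∀ x, ‖P x‖ ≤ B := by
    obtain ⟨B, hB⟩ := P.decay 0 0
    exact ⟨B, fun x => by simpa using hB.2 x⟩
  unfold cv
  rw [sc_zero]
  have := P.continuous
  refine continuous_of_dominated (bound := fun y => B * ‖Q y‖) (fun x => ?_) (fun x => ?_)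
    (hQ.norm.const_mul B) (Eventually.of_forall fun y => by fun_prop)
  · exact (Continuous.aestronglyMeasurable (by fun_prop)).mul hQ.1
  · refine Eventually.of_forall fun y => ?_
    rw [norm_mul]
    exact mul_le_mul_of_nonneg_right (hB _) (norm_nonneg _)

lemma comF_zero_eq {α : ℝ} (hα : 0 ≤ α) (hα' : α ≤ 1) (P Q : SchwartzMap ℝ ℂ) (ζ : ℝ) :
    comF α 0 P Q ζ = ((|ζ| ^ α : ℝ) : ℂ) * cv 0 P Q ζ -
      cv 0 P (fun η => ((|η| ^ α : ℝ) : ℂ) * Q η) ζ := by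
  obtain ⟨B, hB⟩ : ∃ B, ∀ x, ‖P x‖ ≤ B := by
    obtain ⟨B, hB⟩ := P.decay 0 0
    exact ⟨B, fun x => by simpa using hB.2 x⟩
  have hi : ∀ R : ℝ → ℂ, Integrable R → Integrable fun η => P (ζ - η) * R η := fun R hR =>
    hR.bdd_mul (c := B) (P.continuous.comp (by fun_prop)).aestronglyMeasurable
      (Eventually.of_forall fun y => hB _)
  rw [comF, cv, cv, sc_zero, ← integral_const_mul, ← integral_sub ((hi _ Q.integrable).const_mul _)
    (hi _ (integrable_abs_rpow_mul Q hα hα'))]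
  refine integral_congr_ae (Eventually.of_forall fun η => ?_)
  simp only [comW, sub_add_cancel, rpow_zero]
  push_cast
  ring

lemma fourier_fourier_apply (f : SchwartzMap ℝ ℂ) (x : ℝ) :
    𝓕 (𝓕 (f : ℝ → ℂ)) (-x) = f x := by
  rw [← Real.fourierInv_eq_fourier_neg, ← SchwartzMap.fourier_coe, ← SchwartzMap.fourierInv_coe,
    FourierTransform.fourierInv_fourier_eq]

lemma fourierInv_fourier_apply (f : SchwartzMap ℝ ℂ) : 𝓕⁻ (𝓕 (f : ℝ → ℂ)) = f := by
  rw [← SchwartzMap.fourier_coe, ← SchwartzMap.fourierInv_coe,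
    FourierTransform.fourierInv_fourier_eq]

lemma integrable_mul_schwartz (f g : SchwartzMap ℝ ℂ) : Integrable fun x => f x * g x := by
  obtain ⟨B, hB⟩ : ∃ B, ∀ x, ‖f x‖ ≤ B := by
    obtain ⟨B, hB⟩ := f.decay 0 0
    exact ⟨B, fun x => by simpa using hB.2 x⟩
  exact g.integrable.bdd_mul (c := B) f.continuous.aestronglyMeasurable (Eventually.of_forall hB)

lemma fourier_mul_schwartz (f g : SchwartzMap ℝ ℂ) :
    𝓕 (fun x => f x * g x) = cv 0 (𝓕 f : SchwartzMap ℝ ℂ) (𝓕 g : SchwartzMap ℝ ℂ) := by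
  have hP := (𝓕 f : SchwartzMap ℝ ℂ).integrable (μ := volume)
  have hQ := (𝓕 g : SchwartzMap ℝ ℂ).integrable (μ := volume)
  have h1 : 𝓕⁻ (cv 0 (𝓕 f : SchwartzMap ℝ ℂ) (𝓕 g : SchwartzMap ℝ ℂ)) = fun x => f x * g x := by
    funext x
    rw [fourierInv_cv hP hQ, SchwartzMap.fourier_coe, SchwartzMap.fourier_coe,
      fourierInv_fourier_apply]
    simp only [neg_zero, zpow_zero, one_mul, fourier_fourier_apply]
  rw [← h1]
  refine Continuous.fourier_fourierInv_eq (continuous_cv_zero _ hQ) (integrable_cv hP hQ 0) ?_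
  have h2 : 𝓕 (cv 0 (𝓕 f : SchwartzMap ℝ ℂ) (𝓕 g : SchwartzMap ℝ ℂ)) =
      fun x => f (-x) * g (-x) := by
    funext x
    have := congrFun h1 (-x)
    rwa [Real.fourierInv_eq_fourier_neg, neg_neg] at this
  rw [h2]
  exact (integrable_mul_schwartz f g).comp_neg

lemma fourierInv_comF_zero {α : ℝ} (hα : 0 ≤ α) (hα' : α ≤ 1) (f g : SchwartzMap ℝ ℂ) :
    𝓕⁻ (comF α 0 (𝓕 f : SchwartzMap ℝ ℂ) (𝓕 g : SchwartzMap ℝ ℂ)) = commD α f g := by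
  have hP := (𝓕 f : SchwartzMap ℝ ℂ).integrable (μ := volume)
  have hQ := integrable_abs_rpow_mul (𝓕 g : SchwartzMap ℝ ℂ) hα hα'
  have h1 := integrable_comF hα hα' le_rfl zero_le_one (𝓕 f : SchwartzMap ℝ ℂ)
    (𝓕 g : SchwartzMap ℝ ℂ)
  have h2 := integrable_cv hP hQ 0
  have h3 : ∀ ζ, ((|ζ| ^ α : ℝ) : ℂ) * cv 0 (𝓕 f : SchwartzMap ℝ ℂ) (𝓕 g : SchwartzMap ℝ ℂ) ζ =
      comF α 0 (𝓕 f : SchwartzMap ℝ ℂ) (𝓕 g : SchwartzMap ℝ ℂ) ζ +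
        cv 0 (𝓕 f : SchwartzMap ℝ ℂ) (fun η => ((|η| ^ α : ℝ) : ℂ) * (𝓕 g : SchwartzMap ℝ ℂ) η) ζ :=
    fun ζ => by rw [comF_zero_eq hα hα']; ring
  funext x
  rw [commD, Dop, Dop, FMul, FMul, fourier_mul_schwartz, funext h3, ← SchwartzMap.fourier_coe]
  have h4 := fourierInv_cv hP hQ 0 x
  rw [neg_zero, zpow_zero, one_mul, SchwartzMap.fourier_coe f, fourier_fourier_apply] at h4
  rw [← h4, fourierInv_eq_char, fourierInv_eq_char, fourierInv_eq_char, ← integral_sub]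
  · refine integral_congr_ae (Eventually.of_forall fun y => ?_)
    simp only [SchwartzMap.fourier_coe]
    ring
  · exact integrable_char_mul (by fun_prop) (h1.add h2)
  · exact integrable_char_mul (by fun_prop) h2

lemma continuous_comF_zero {α : ℝ} (hα : 0 ≤ α) (hα' : α ≤ 1) (P Q : SchwartzMap ℝ ℂ) :
    Continuous (comF α 0 P Q) := by
  rw [funext (comF_zero_eq hα hα' P Q)]
  have h1 := continuous_cv_zero P (Q.integrable (μ := volume))
  have h2 := continuous_cv_zero P (integrable_abs_rpow_mul Q hα hα')
  have h3 : Continuous fun ζ : ℝ => |ζ| ^ α := continuous_abs.rpow_const fun _ => Or.inr hα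
  fun_prop

lemma Dop_commD {α : ℝ} (hα : 0 ≤ α) (hα' : α ≤ 1) (β : ℝ) (f g : SchwartzMap ℝ ℂ) :
    Dop β (commD α f g) = 𝓕⁻ (comF α β (𝓕 f : SchwartzMap ℝ ℂ) (𝓕 g : SchwartzMap ℝ ℂ)) ∨
      Dop β (commD α f g) = 0 := by
  by_cases hc : Integrable (commD α f g)
  · left
    rw [Dop, FMul, funext (comF_eq α β _ _), ← fourierInv_comF_zero hα hα' f g,
      Continuous.fourier_fourierInv_eq (continuous_comF_zero hα hα' _ _)
        (integrable_comF hα hα' le_rfl zero_le_one _ _)]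
    rw [← fourierInv_comF_zero hα hα' f g] at hc
    refine hc.comp_neg.congr (Eventually.of_forall fun x => ?_)
    simp only [Real.fourierInv_eq_fourier_neg, neg_neg]
  · right
    have : 𝓕 (commD α f g) = 0 := by
      funext ξ
      rw [Real.fourier_eq]
      refine integral_undef fun h => hc ?_
      exact (Real.fourierIntegral_convergent_iff ξ).1 h
    funext x
    rw [Dop, FMul, this, fourierInv_eq_char]
    simp

lemma comW_eq {α β : ℝ} (ξ η : ℝ) (hξ : ξ ≠ 0) :
    comW α β ξ η = comSym α β ξ η * |ξ| ^ (α + β) := by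
  rw [comSym, mul_assoc, ← rpow_add (abs_pos.2 hξ), neg_add_cancel, rpow_zero, mul_one, comW]

lemma ae_prod_ne_zero : ∀ᵐ z : ℝ × ℝ, z.1 ≠ 0 ∧ z.2 ≠ 0 := by
  have h : ∀ᵐ x : ℝ, x ≠ 0 := by simp [ae_iff]
  exact ((Measure.quasiMeasurePreserving_fst (μ := (volume : Measure ℝ))).ae h).and
    ((Measure.quasiMeasurePreserving_snd (ν := (volume : Measure ℝ))).ae h)

lemma integral_fourierInv_comF_mul {α β : ℝ} (hα : 0 ≤ α) (hα' : α ≤ 1) (hβ : 0 ≤ β) (hβ' : β ≤ 1)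
    (P Q : SchwartzMap ℝ ℂ) {h : ℝ → ℂ} (hh : Integrable h) :
    ∫ x, 𝓕⁻ (comF α β P Q) x * h x =
      ∫ z : ℝ × ℝ, (comW α β z.1 z.2 : ℂ) * P z.1 * Q z.2 * 𝓕⁻ h (z.1 + z.2) := by
  have hH := continuous_fourierInv hh
  have hi : Integrable fun z : ℝ × ℝ =>
      (comW α β (z.1 - z.2) z.2 : ℂ) * P (z.1 - z.2) * Q z.2 * 𝓕⁻ h z.1 :=
    (integrable_comF_prod hα hα' hβ hβ' P Q).mul_bdd (c := ∫ y, ‖h y‖)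
      (hH.comp continuous_fst).aestronglyMeasurable
      (Eventually.of_forall fun z => norm_fourierInv_le h _)
  rw [← integral_mul_fourierInv (integrable_comF hα hα' hβ hβ' P Q) hh]
  calc _ = ∫ ζ, ∫ η, (comW α β (ζ - η) η : ℂ) * P (ζ - η) * Q η * 𝓕⁻ h ζ := by
        simp only [integral_mul_const, comF]
    _ = ∫ z : ℝ × ℝ, (comW α β (z.1 - z.2) z.2 : ℂ) * P (z.1 - z.2) * Q z.2 * 𝓕⁻ h z.1 :=
        (integral_prod _ hi).symm
    _ = _ := by
        have hmp := measurePreserving_add_prod (volume : Measure ℝ) (volume : Measure ℝ)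
        have := integral_map hmp.aemeasurable (by rw [hmp.map_eq]; exact hi.1)
        rw [hmp.map_eq] at this
        refine this.trans ?_
        simp only [add_sub_cancel_right]
        rfl

lemma enorm_integral_Dop_commD_le {α β : ℝ} (hα : 0 ≤ α) (hβ : 0 ≤ β) (hs : α + β ≤ 1)
    {C : ℝ≥0∞} (hC : GoodSym (fun ξ η => ((shell (ξ + η) η * comSym α β ξ η : ℝ) : ℂ)) C)
    (f g : SchwartzMap ℝ ℂ) {h : ℝ → ℂ} (hh : IsBddTest h) :
    ‖∫ x, Dop β (commD α f g) x * h x‖ₑ ≤ C * maxForm (Dop (α + β) f) g h := by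
  rcases Dop_commD hα (by linarith) β f g with e | e
  swap
  · simp [e]
  have hα' : α ≤ 1 := by linarith
  have hβ' : β ≤ 1 := by linarith
  set P : SchwartzMap ℝ ℂ := 𝓕 f with hP
  set Q : SchwartzMap ℝ ℂ := 𝓕 g with hQ
  rw [e, integral_fourierInv_comF_mul hα hα' hβ hβ' P Q hh.integrable]
  set A : ℝ → ℂ := fun ξ => ((|ξ| ^ (α + β) : ℝ) : ℂ) * P ξ with hA
  have hAi : Integrable A := integrable_abs_rpow_mul P (by linarith) hs
  have eA : 𝓕⁻ A = Dop (α + β) f := by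
    rw [Dop, FMul, hA, hP, SchwartzMap.fourier_coe]
  have eQ : 𝓕⁻ (Q : ℝ → ℂ) = g := by rw [hQ, SchwartzMap.fourier_coe, fourierInv_fourier_apply]
  clear_value P Q A
  have hB := fun K0 K => hC.sum_le A Q h hAi Q.integrable hh K0 K
  rw [eA, eQ] at hB
  obtain ⟨M, hM⟩ := hC.bdd
  have hH := continuous_fourierInv hh.integrable
  have hInt : Integrable fun z : ℝ × ℝ =>
      (comW α β z.1 z.2 : ℂ) * P z.1 * Q z.2 * 𝓕⁻ h (z.1 + z.2) :=
    (integrable_comW hα hα' hβ hβ' P Q).mul_bdd (c := ∫ y, ‖h y‖)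
      (hH.comp (continuous_fst.add continuous_snd)).aestronglyMeasurable
      (Eventually.of_forall fun z => norm_fourierInv_le h _)
  have hik : ∀ k : ℤ, Integrable fun z : ℝ × ℝ =>
      ((shell (2 ^ (-k) * z.1 + 2 ^ (-k) * z.2) (2 ^ (-k) * z.2) *
        comSym α β (2 ^ (-k) * z.1) (2 ^ (-k) * z.2) : ℝ) : ℂ) * A z.1 * Q z.2 *
          𝓕⁻ h (z.1 + z.2) := fun k =>
    integrable_triForm (p := fun ξ η => ((shell (2 ^ (-k) * ξ + 2 ^ (-k) * η) (2 ^ (-k) * η) *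
      comSym α β (2 ^ (-k) * ξ) (2 ^ (-k) * η) : ℝ) : ℂ)) (hC.meas_scale k) (fun ξ η => hM _ _)
      hAi Q.integrable hh.integrable
  have hsum : ∀ N : ℕ, ∑ k ∈ Finset.Icc (-(N : ℤ)) N, triForm (fun ξ η =>
      ((shell (2 ^ (-k) * ξ + 2 ^ (-k) * η) (2 ^ (-k) * η) *
        comSym α β (2 ^ (-k) * ξ) (2 ^ (-k) * η) : ℝ) : ℂ)) A Q h =
      ∫ z : ℝ × ℝ, ((∑ k ∈ Finset.Icc (-(N : ℤ)) N, shell (2 ^ (-k) * (z.1 + z.2))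
        (2 ^ (-k) * z.2) : ℝ) : ℂ) *
          ((comW α β z.1 z.2 : ℂ) * P z.1 * Q z.2 * 𝓕⁻ h (z.1 + z.2)) := fun N => by
    simp only [triForm]
    rw [← integral_finsetSum _ fun k _ => hik k]
    refine integral_congr_ae ?_
    filter_upwards [ae_prod_ne_zero] with z hz
    rw [comW_eq _ _ hz.1, Complex.ofReal_sum, Finset.sum_mul]
    refine Finset.sum_congr rfl fun k _ => ?_
    rw [comSym_scale (by positivity), ← mul_add]
    simp only [hA]
    push_cast
    ring
  have hlim : Tendsto (fun N : ℕ => ∑ k ∈ Finset.Icc (-(N : ℤ)) N, triForm (fun ξ η =>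
      ((shell (2 ^ (-k) * ξ + 2 ^ (-k) * η) (2 ^ (-k) * η) *
        comSym α β (2 ^ (-k) * ξ) (2 ^ (-k) * η) : ℝ) : ℂ)) A Q h) atTop
      (𝓝 (∫ z : ℝ × ℝ, (comW α β z.1 z.2 : ℂ) * P z.1 * Q z.2 * 𝓕⁻ h (z.1 + z.2))) := by
    simp only [hsum]
    refine tendsto_integral_of_dominated_convergence _ (fun N => ?_) hInt.norm (fun N => ?_) ?_
    · refine Measurable.aestronglyMeasurable ?_ |>.mul hInt.1
      have := contDiff_phi.continuous
      unfold shell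
      fun_prop
    · refine Eventually.of_forall fun z => ?_
      rw [norm_mul, Complex.norm_real, Real.norm_eq_abs]
      exact mul_le_of_le_one_left (norm_nonneg _) (abs_sum_shell_le N _ _)
    · filter_upwards [ae_prod_ne_zero] with z hz
      have := (Complex.continuous_ofReal.tendsto 1).comp
        (tendsto_sum_shell (x := z.1 + z.2) hz.2)
      simpa using this.mul_const ((comW α β z.1 z.2 : ℂ) * P z.1 * Q z.2 * 𝓕⁻ h (z.1 + z.2))
  refine le_of_tendsto hlim.enorm (Eventually.of_forall fun N => ?_)
  exact (enorm_sum_le _ _).trans (hB _ _)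

lemma exists_norm_Dop_le {s : ℝ} (hs : 0 ≤ s) (hs' : s ≤ 1) :
    ∃ (v : Finset (ℕ × ℕ)) (C : ℝ), 0 ≤ C ∧ ∀ (S : SchwartzMap ℝ ℂ) (x : ℝ),
      ‖Dop s S x‖ ≤ C * v.sup (schwartzSeminormFamily ℂ ℝ ℂ) S := by
  let r : Seminorm ℂ (SchwartzMap ℝ ℂ) :=
    (Finset.Iic (3, 0)).sup fun m : ℕ × ℕ => SchwartzMap.seminorm ℂ m.1 m.2
  have hr : Continuous r := by
    refine Seminorm.continuous_finsetSup fun m _ => ?_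
    exact (schwartz_withSeminorms ℂ ℝ ℂ).continuous_seminorm m
  obtain ⟨v, A, -, hA⟩ := Seminorm.bound_of_continuous (schwartz_withSeminorms ℂ ℝ ℂ)
    (r.comp (FourierTransform.fourierCLM ℂ (SchwartzMap ℝ ℂ)).toLinearMap)
    (hr.comp (FourierTransform.fourierCLM ℂ (SchwartzMap ℝ ℂ)).continuous)
  have hA' : ∀ S : SchwartzMap ℝ ℂ, r (𝓕 S) ≤ A * v.sup (schwartzSeminormFamily ℂ ℝ ℂ) S := hA
  have hi : Integrable fun ξ : ℝ => (1 + ‖ξ‖) ^ (-2 : ℝ) := integrable_one_add_norm (by simp)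
  set I := ∫ ξ : ℝ, (1 + ‖ξ‖) ^ (-2 : ℝ)
  have hI : 0 ≤ I := integral_nonneg fun ξ => by positivity
  refine ⟨v, 8 * A * I, by positivity, fun S x => ?_⟩
  have hb : ∀ ξ : ℝ, ‖((|ξ| ^ s : ℝ) : ℂ) * 𝓕 (S : ℝ → ℂ) ξ‖ ≤
      8 * r (𝓕 S) * (1 + ‖ξ‖) ^ (-2 : ℝ) := fun ξ => by
    have h1 : 1 ≤ 1 + |ξ| := by linarith [abs_nonneg ξ]
    have e1 : |ξ| ^ s ≤ 1 + |ξ| := abs_rpow_le_one_add hs hs' (by linarith) h1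
    have e2 : (1 + |ξ|) ^ 3 * ‖𝓕 (S : ℝ → ℂ) ξ‖ ≤ 8 * r (𝓕 S) := by
      have := SchwartzMap.one_add_le_sup_seminorm_apply (𝕜 := ℂ) (m := (3, 0)) (k := 3) (n := 0)
        le_rfl le_rfl (𝓕 S) ξ
      rw [norm_iteratedFDeriv_zero, SchwartzMap.fourier_coe] at this
      norm_num at this
      exact this
    rw [norm_mul, Complex.norm_real, Real.norm_of_nonneg (by positivity), rpow_neg (by positivity),
      Real.norm_eq_abs, ← div_eq_mul_inv, le_div_iff₀ (by positivity), rpow_two]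
    calc |ξ| ^ s * ‖𝓕 (S : ℝ → ℂ) ξ‖ * (1 + |ξ|) ^ 2
        ≤ (1 + |ξ|) * ‖𝓕 (S : ℝ → ℂ) ξ‖ * (1 + |ξ|) ^ 2 := by gcongr
      _ = (1 + |ξ|) ^ 3 * ‖𝓕 (S : ℝ → ℂ) ξ‖ := by ring
      _ ≤ _ := e2
  calc ‖Dop s S x‖ ≤ ∫ ξ, ‖((|ξ| ^ s : ℝ) : ℂ) * 𝓕 (S : ℝ → ℂ) ξ‖ := norm_fourierInv_le _ _
    _ ≤ ∫ ξ : ℝ, 8 * r (𝓕 S) * (1 + ‖ξ‖) ^ (-2 : ℝ) :=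
        integral_mono_of_nonneg (Eventually.of_forall fun _ => norm_nonneg _) (hi.const_mul _)
          (Eventually.of_forall hb)
    _ = 8 * r (𝓕 S) * I := integral_const_mul _ _
    _ ≤ 8 * (A * v.sup (schwartzSeminormFamily ℂ ℝ ℂ) S) * I := by gcongr; exact hA' S
    _ = _ := by ring

lemma norm_le_norm_prodMk (x t : ℝ) : ‖x‖ ≤ ‖(x, t)‖ := norm_fst_le (x, t)

/-- The restriction `x ↦ f (x, t)` of a Schwartz function on the plane. -/
def slice (f : SchwartzMap (ℝ × ℝ) ℂ) (t : ℝ) : SchwartzMap ℝ ℂ :=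
  SchwartzMap.compCLM ℂ (g := fun x : ℝ => (ContinuousLinearMap.inl ℝ ℝ ℝ) x + (0, t))
    ((ContinuousLinearMap.inl ℝ ℝ ℝ).hasTemperateGrowth.add (.const (0, t)))
    ⟨1, 1, fun x => by
      have h := norm_le_norm_prodMk x t
      have e : (ContinuousLinearMap.inl ℝ ℝ ℝ) x + (0, t) = (x, t) := by simp
      rw [e]; linarith⟩ f

lemma slice_apply (f : SchwartzMap (ℝ × ℝ) ℂ) (t x : ℝ) : slice f t x = f (x, t) := by
  simp [slice]

lemma coe_slice (f : SchwartzMap (ℝ × ℝ) ℂ) (t : ℝ) : (slice f t : ℝ → ℂ) = fun x => f (x, t) :=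
  funext fun x => slice_apply f t x

lemma seminorm_slice_le (f : SchwartzMap (ℝ × ℝ) ℂ) (t : ℝ) (k n : ℕ) :
    SchwartzMap.seminorm ℂ k n (slice f t) ≤ SchwartzMap.seminorm ℂ k n f := by
  refine SchwartzMap.seminorm_le_bound ℂ k n _ (apply_nonneg _ _) fun x => ?_
  refine le_trans ?_ (SchwartzMap.le_seminorm ℂ k n f (x, t))
  have e : (slice f t : ℝ → ℂ) =
      (fun z : ℝ × ℝ => f (z + (0, t))) ∘ (ContinuousLinearMap.inl ℝ ℝ ℝ) := by
    ext y; simp [slice_apply]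
  have hc : ContDiff ℝ n fun z : ℝ × ℝ => f (z + (0, t)) :=
    (f.smooth n).comp (contDiff_id.add contDiff_const)
  have h : iteratedFDeriv ℝ n (slice f t) x =
      (iteratedFDeriv ℝ n f (x, t)).compContinuousLinearMap
        fun _ => ContinuousLinearMap.inl ℝ ℝ ℝ := by
    rw [e, ContinuousLinearMap.iteratedFDeriv_comp_right _ hc _ le_rfl, iteratedFDeriv_comp_add_right]
    simp
  rw [h]
  refine mul_le_mul (pow_le_pow_left₀ (norm_nonneg _) (norm_le_norm_prodMk x t) k) ?_
    (norm_nonneg _) (by positivity)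
  refine (ContinuousMultilinearMap.norm_compContinuousLinearMap_le _ _).trans
    (mul_le_of_le_one_right (norm_nonneg _) ?_)
  exact Finset.prod_le_one (fun _ _ => norm_nonneg _) fun _ _ =>
    ContinuousLinearMap.norm_inl_le_one ℝ ℝ ℝ

lemma exists_norm_Dop_slice_le {s : ℝ} (hs : 0 ≤ s) (hs' : s ≤ 1) (f : SchwartzMap (ℝ × ℝ) ℂ) :
    ∃ B : ℝ, ∀ t x, ‖Dop s (slice f t) x‖ ≤ B := by
  obtain ⟨v, C, hC, h⟩ := exists_norm_Dop_le hs hs'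
  refine ⟨C * v.sup (schwartzSeminormFamily ℂ (ℝ × ℝ) ℂ) f, fun t x => (h _ x).trans ?_⟩
  refine mul_le_mul_of_nonneg_left (Seminorm.finset_sup_apply_le (apply_nonneg _ _) fun m hm => ?_)
    hC
  exact (seminorm_slice_le f t m.1 m.2).trans
    (Seminorm.le_finset_sup_apply (p := schwartzSeminormFamily ℂ (ℝ × ℝ) ℂ) hm)

lemma measurable_fourier_slice {F : ℝ → ℝ → ℂ} (hF : Measurable fun z : ℝ × ℝ => F z.1 z.2) :
    Measurable fun z : ℝ × ℝ => 𝓕 (fun y => F y z.2) z.1 := by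
  simp only [fourier_eq_char]
  have hm : Measurable fun w : (ℝ × ℝ) × ℝ => (𝐞 (-(w.2 * w.1.1)) : ℂ) * F w.2 w.1.2 :=
    (continuous_char (by fun_prop)).measurable.mul
      (hF.comp (measurable_snd.prodMk (measurable_snd.comp measurable_fst)))
  exact hm.stronglyMeasurable.integral_prod_right'.measurable

lemma measurable_fourierInv_slice {F : ℝ → ℝ → ℂ} (hF : Measurable fun z : ℝ × ℝ => F z.1 z.2) :
    Measurable fun z : ℝ × ℝ => 𝓕⁻ (fun y => F y z.2) z.1 := by
  simp only [fourierInv_eq_char]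
  have hm : Measurable fun w : (ℝ × ℝ) × ℝ => (𝐞 (w.2 * w.1.1) : ℂ) * F w.2 w.1.2 :=
    (continuous_char (by fun_prop)).measurable.mul
      (hF.comp (measurable_snd.prodMk (measurable_snd.comp measurable_fst)))
  exact hm.stronglyMeasurable.integral_prod_right'.measurable

lemma measurable_sliceOp_Dop {F : ℝ → ℝ → ℂ} (hF : Measurable fun z : ℝ × ℝ => F z.1 z.2) (s : ℝ) :
    Measurable fun z : ℝ × ℝ => sliceOp (Dop s) F z.1 z.2 := by
  refine measurable_fourierInv_slice
    (F := fun ξ t => ((|ξ| ^ s : ℝ) : ℂ) * 𝓕 (fun y => F y t) ξ) ?_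
  exact Measurable.mul (by fun_prop) (measurable_fourier_slice hF)

lemma LpLq_le {p q : ℝ≥0∞} {T : ℝ} {f : ℝ → ℝ → ℂ} :
    LpLq p q T f ≤ eLpNorm (fun x => eLpNorm (f x) q (volume.restrict (Ioc 0 T))) p volume :=
  eLpNorm_mono_enorm fun x => by
    rw [Real.enorm_of_nonneg ENNReal.toReal_nonneg, enorm_eq_self]
    exact ENNReal.ofReal_toReal_le

lemma LpLq_eq {p q : ℝ≥0∞} {T : ℝ} {f : ℝ → ℝ → ℂ} {B : ℝ} (h : ∀ x t, ‖f x t‖ ≤ B) :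
    eLpNorm (fun x => eLpNorm (fun t => ‖f x t‖ₑ) q (volume.restrict (Ioc 0 T))) p volume =
      LpLq p q T f := by
  refine eLpNorm_congr_enorm_ae (Eventually.of_forall fun x => ?_)
  have hfin : eLpNorm (f x) q (volume.restrict (Ioc 0 T)) ≠ ∞ :=
    ne_top_of_le_ne_top (by finiteness)
      (eLpNorm_le_of_ae_bound (Eventually.of_forall fun t => h x t))
  change _ = ‖(eLpNorm (f x) q (volume.restrict (Ioc 0 T))).toReal‖ₑ
  rw [Real.enorm_of_nonneg ENNReal.toReal_nonneg, ENNReal.ofReal_toReal hfin, enorm_eq_self,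
    eLpNorm_enorm]

/-- **Commutator estimate** (Lemma 2.11 of the paper).  For `0 < α < 1`,
`0 ≤ β < 1 - α`, `1 < p,q < ∞` and Hölder-compatible exponents (if `β > 0`
then `q₁ = ∞` is also allowed),
`‖D_x^β([D_x^α, f]g)‖_{L^p_x L^q_T} ≲ ‖g‖_{L^{p₁}_x L^{q₁}_T} ‖D_x^{α+β} f‖_{L^{p₂}_x L^{q₂}_T}`. -/
theorem commutator_estimate_mixed
    (α β : ℝ) (hα0 : 0 < α) (hα1 : α < 1) (hβ0 : 0 ≤ β) (hβ1 : β < 1 - α)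
    (p q p₁ q₁ p₂ q₂ : ℝ≥0∞)
    (hp : 1 < p) (hp' : p ≠ ∞) (hq : 1 < q) (hq' : q ≠ ∞)
    (hp₁ : 1 < p₁) (hp₁' : p₁ ≠ ∞)
    (hq₁ : 1 < q₁) (hq₁' : q₁ ≠ ∞ ∨ 0 < β)
    (hp₂ : 1 < p₂) (hp₂' : p₂ ≠ ∞) (hq₂ : 1 < q₂) (hq₂' : q₂ ≠ ∞)
    (hpsum : 1/p₁ + 1/p₂ = 1/p) (hqsum : 1/q₁ + 1/q₂ = 1/q) :
    ∃ C : ℝ≥0, 0 < C ∧ ∀ (T : ℝ), 0 < T → ∀ f g : SchwartzMap (ℝ × ℝ) ℂ,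
      LpLq p q T (sliceOp (Dop β) (commDf α (fun x t => f (x, t)) (fun x t => g (x, t))))
        ≤ C * LpLq p₁ q₁ T (fun x t => g (x, t))
            * LpLq p₂ q₂ T (sliceOp (Dop (α + β)) (fun x t => f (x, t))) := by
  have hs : α + β < 1 := by linarith
  obtain ⟨C, hC, H⟩ := mixed_trilinear hp hp' hq hq' hp₁ hp₁' hq₁ hp₂ hp₂' hq₂ hq₂' hpsum hqsum
  obtain ⟨K, hK, hgood⟩ := isGood_shell_comSym hα0.le hβ0 hs
  have hCK : C * K ≠ ∞ := ENNReal.mul_ne_top hC hK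
  refine ⟨(C * K).toNNReal + 1, by positivity, fun T _ f g => ?_⟩
  have hf : Measurable fun z : ℝ × ℝ => f (z.1, z.2) := f.continuous.measurable
  have hg : Measurable fun z : ℝ × ℝ => g (z.1, z.2) := g.continuous.measurable
  have hcomm : Measurable fun z : ℝ × ℝ =>
      commDf α (fun x t => f (x, t)) (fun x t => g (x, t)) z.1 z.2 :=
    (measurable_sliceOp_Dop (F := fun x t => f (x, t) * g (x, t)) (hf.mul hg) α).sub
      (hf.mul (measurable_sliceOp_Dop (F := fun x t => g (x, t)) hg α))
  have hDf := measurable_sliceOp_Dop (F := fun x t => f (x, t)) hf (α + β)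
  obtain ⟨B, hB⟩ := exists_norm_Dop_slice_le (s := α + β) (by linarith) hs.le f
  have hB' : ∀ x t, ‖sliceOp (Dop (α + β)) (fun x t => f (x, t)) x t‖ ≤ B := fun x t => by
    have := hB t x
    rwa [coe_slice] at this
  rw [← LpLq_eq hB', ← LpLq_eq (f := fun x t => g (x, t)) fun x t =>
    SchwartzMap.norm_le_seminorm ℝ g (x, t)]
  refine LpLq_le.trans ((H (volume.restrict (Ioc 0 T))
    (sliceOp (Dop β) (commDf α (fun x t => f (x, t)) (fun x t => g (x, t))))
    (fun x t => ‖g (x, t)‖ₑ) (fun x t => ‖sliceOp (Dop (α + β)) (fun x t => f (x, t)) x t‖ₑ) K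
    (measurable_sliceOp_Dop hcomm β) hg.enorm hDf.enorm fun t h hh => ?_).trans ?_)
  · have := enorm_integral_Dop_commD_le hα0.le hβ0 hs.le hgood (slice f t) (slice g t) hh
    rw [coe_slice, coe_slice] at this
    refine this.trans_eq ?_
    rw [maxForm]
    congr 2 with x
    rw [mul_comm (Mx _ x) (Mx (fun y => ‖g (y, t)‖ₑ) x)]
    rfl
  · have hle : C * K ≤ (((C * K).toNNReal + 1 : ℝ≥0) : ℝ≥0∞) := by
      rw [ENNReal.coe_add, ENNReal.coe_toNNReal hCK]
      exact le_self_add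
    gcongr

end
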